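/- arXiv:2009.10016 — 2 statements merged into one kernel-verified Lean document; each statement's English description precedes it below -/
import Mathlib

section
/- Let γ₁ = γ₂ = γ ∈ (0,1), let p > 1, q > 1 with p ≤ q, let f(v) = |v|^p, g(u) = |u|^q, and let u₀, v₀ ∈ C₀(ℝᴺ) be nonnegative. Let χ(x) = (∫_{ℝᴺ} e^{−√(N²+|y|²)} dy)^{−1} e^{−√(N²+|x|²)} and set Z₀ = ∫_{ℝᴺ}(u₀(x) + v₀(x)) χ(x) dx. If Z₀ > 2^{p/(p−1)}, then the solution of the system blows up in finite time; more precisely, there is no mild solution (u, v) on [0, T) with T > [ Γ(γ+1) · ln(1 − 2^p Z₀^{1−p}) / (2(1−p)) ]^{1/γ}. -/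
open MeasureTheory Filter Topology

noncomputable section

abbrev Euc (N : ℕ) := EuclideanSpace ℝ (Fin N)

/-- Wright type function `φ_α(z) = Σ_{k} (−z)^k/(k! Γ(−αk + 1 − α))`. -/
def wrightFn (α z : ℝ) : ℝ :=
  ∑' k : ℕ, (-z) ^ k / ((k.factorial : ℝ) * Real.Gamma (-α * (k : ℝ) + 1 - α))

/-- Heat kernel `G(t,x) = (4πt)^{−N/2} exp(−|x|²/(4t))` on `ℝᴺ`. -/
def heatKernel (N : ℕ) (t : ℝ) (x : Euc N) : ℝ :=
  (4 * Real.pi * t) ^ (-(N : ℝ) / 2) * Real.exp (-‖x‖ ^ 2 / (4 * t))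

/-- Heat semigroup `T(t)` acting by convolution with the heat kernel. -/
def heatOp (N : ℕ) (t : ℝ) (w : Euc N → ℝ) (x : Euc N) : ℝ :=
  ∫ y, heatKernel N t (x - y) * w y

/-- `(P_α(t)w)(x) = ∫_0^∞ φ_α(θ) (T(t^α θ)w)(x) dθ`. -/
def Pop (N : ℕ) (α t : ℝ) (w : Euc N → ℝ) (x : Euc N) : ℝ :=
  ∫ θ in Set.Ioi (0 : ℝ), wrightFn α θ * heatOp N (t ^ α * θ) w x

/-- `(S_α(t)w)(x) = α ∫_0^∞ θ φ_α(θ) (T(t^α θ)w)(x) dθ`. -/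
def Sop (N : ℕ) (α t : ℝ) (w : Euc N → ℝ) (x : Euc N) : ℝ :=
  α * ∫ θ in Set.Ioi (0 : ℝ), θ * wrightFn α θ * heatOp N (t ^ α * θ) w x

/-- Mild solution of the coupled system `ᶜD^{γ₁}u − Δu = f(v)`, `ᶜD^{γ₂}v − Δv = g(u)`
with data `(u₀, v₀)`, on the time set `s`: a pair of continuous curves into `C₀(ℝᴺ)`
satisfying the Duhamel integral equations. -/
def IsMildSolution (N : ℕ) (γ₁ γ₂ : ℝ) (f g : ℝ → ℝ)
    (u₀ v₀ : ZeroAtInftyContinuousMap (Euc N) ℝ) (s : Set ℝ)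
    (u v : ℝ → ZeroAtInftyContinuousMap (Euc N) ℝ) : Prop :=
  ContinuousOn u s ∧ ContinuousOn v s ∧ u 0 = u₀ ∧ v 0 = v₀ ∧
  ∀ t ∈ s, 0 < t → ∀ x : Euc N,
    (u t x = Pop N γ₁ t (⇑u₀) x +
      ∫ τ in (0:ℝ)..t, (t - τ) ^ (γ₁ - 1) * Sop N γ₁ (t - τ) (fun y => f (v τ y)) x) ∧
    (v t x = Pop N γ₂ t (⇑v₀) x +
      ∫ τ in (0:ℝ)..t, (t - τ) ^ (γ₂ - 1) * Sop N γ₂ (t - τ) (fun y => g (u τ y)) x)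


/-- The weight `χ(x) = c⁻¹ e^{−√(N²+|x|²)}`, normalized so that `∫ χ = 1`. -/
def chiFn (N : ℕ) (x : Euc N) : ℝ :=
  (∫ y : Euc N, Real.exp (-Real.sqrt ((N : ℝ) ^ 2 + ‖y‖ ^ 2)))⁻¹ *
    Real.exp (-Real.sqrt ((N : ℝ) ^ 2 + ‖x‖ ^ 2))

/-- Real part of `e^w − θ e^{αw} + κw` at `w = x + iη`. -/
def phaseRe (α θ κ x η : ℝ) : ℝ :=
  Real.exp x * Real.cos η - θ * (Real.exp (α * x) * Real.cos (α * η)) + κ * x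

/-- Imaginary part of `e^w − θ e^{αw} + κw` at `w = x + iη`. -/
def phaseIm (α θ κ x η : ℝ) : ℝ :=
  Real.exp x * Real.sin η - θ * (Real.exp (α * x) * Real.sin (α * η)) + κ * η

/-- Real part of `exp (e^w − θ e^{αw} + κw)` at `w = x + iη`. -/
def kerCos (α θ κ x η : ℝ) : ℝ := Real.exp (phaseRe α θ κ x η) * Real.cos (phaseIm α θ κ x η)

/-- Imaginary part of `exp (e^w − θ e^{αw} + κw)` at `w = x + iη`. -/
def kerSin (α θ κ x η : ℝ) : ℝ := Real.exp (phaseRe α θ κ x η) * Real.sin (phaseIm α θ κ x η)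

theorem cexp_phase_eq (α θ κ x η : ℝ) :
    Complex.exp (Complex.exp (x + η * Complex.I) - θ * Complex.exp (α * (x + η * Complex.I))
        + κ * (x + η * Complex.I)) = ⟨kerCos α θ κ x η, kerSin α θ κ x η⟩ := by
  have h1 : Complex.exp (x + η * Complex.I) - θ * Complex.exp (α * (x + η * Complex.I))
      + κ * (x + η * Complex.I) = phaseRe α θ κ x η + phaseIm α θ κ x η * Complex.I := by
    have : (α : ℂ) * (x + η * Complex.I) = ((α * x : ℝ) : ℂ) + ((α * η : ℝ) : ℂ) * Complex.I := by
      push_cast; ring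
    rw [this, Complex.exp_add, Complex.exp_mul_I, Complex.exp_add, Complex.exp_mul_I]
    simp only [phaseRe, phaseIm]
    push_cast
    ring
  rw [h1, Complex.exp_add, Complex.exp_mul_I]
  apply Complex.ext <;> simp [kerCos, kerSin, ← Complex.ofReal_exp, ← Complex.ofReal_cos,
    ← Complex.ofReal_sin, Complex.mul_re, Complex.mul_im]

/-- The entire function `exp (e^w − θ e^{αw} + κw)` has a primitive; `Y x η` is its imaginary
part at `x + iη`. -/
theorem exists_conjugate_primitive (α θ κ : ℝ) :
    ∃ Y : ℝ → ℝ → ℝ, (∀ x, Y x 0 = 0) ∧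
      ∀ (a b : ℝ → ℝ) (a' b' s : ℝ), HasDerivAt a a' s → HasDerivAt b b' s →
        HasDerivAt (fun r => Y (a r) (b r))
          (kerSin α θ κ (a s) (b s) * a' + kerCos α θ κ (a s) (b s) * b') s := by
  set g : ℂ → ℂ := fun w => Complex.exp (Complex.exp w - θ * Complex.exp (α * w) + κ * w) with hg
  have hgd : Differentiable ℂ g := by
    rw [hg]; fun_prop
  obtain ⟨Φ, hΦ0, hΦ⟩ := hgd.isExactOn_univ.with_val_at 0 0
  have hgval : ∀ x η : ℝ, g (x + η * Complex.I) =
      ⟨kerCos α θ κ x η, kerSin α θ κ x η⟩ := by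
    intro x η
    simp only [hg, cexp_phase_eq]
  have key : ∀ (a b : ℝ → ℝ) (a' b' s : ℝ), HasDerivAt a a' s → HasDerivAt b b' s →
        HasDerivAt (fun r => (Φ (a r + b r * Complex.I)).im)
          (kerSin α θ κ (a s) (b s) * a' + kerCos α θ κ (a s) (b s) * b') s := by
    intro a b a' b' s ha hb
    have h1 : HasDerivAt (fun r : ℝ => (a r : ℂ) + b r * Complex.I) (a' + b' * Complex.I) s :=
      ha.ofReal_comp.add (hb.ofReal_comp.mul_const _)
    have h2 := (hΦ (a s + b s * Complex.I) (Set.mem_univ _)).comp s h1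
    have h3 := (Complex.imCLM.hasFDerivAt (x := Φ (a s + b s * Complex.I))).comp_hasDerivAt s h2
    convert! h3 using 1
    simp [hgval]
    ring
  refine ⟨fun x η => (Φ (x + η * Complex.I)).im, fun x => ?_, key⟩
  have hd : ∀ x : ℝ, HasDerivAt (fun r : ℝ => (Φ (r + (0:ℝ) * Complex.I)).im) 0 x := by
    intro x
    have := key id (fun _ => 0) 1 0 x (hasDerivAt_id x) (hasDerivAt_const x 0)
    simpa [kerSin, phaseIm] using this
  have hc := is_const_of_deriv_eq_zero (fun x => (hd x).differentiableAt)
    (fun x => (hd x).deriv) x 0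
  simpa [hΦ0] using hc

theorem hasDerivAt_conj_left {α θ κ : ℝ} {Y : ℝ → ℝ → ℝ}
    (hY : ∀ (a b : ℝ → ℝ) (a' b' s : ℝ), HasDerivAt a a' s → HasDerivAt b b' s →
        HasDerivAt (fun r => Y (a r) (b r))
          (kerSin α θ κ (a s) (b s) * a' + kerCos α θ κ (a s) (b s) * b') s) (x η : ℝ) :
    HasDerivAt (fun r => Y r η) (kerSin α θ κ x η) x := by
  simpa using hY id (fun _ => η) 1 0 x (hasDerivAt_id x) (hasDerivAt_const x η)

theorem hasDerivAt_conj_right {α θ κ : ℝ} {Y : ℝ → ℝ → ℝ}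
    (hY : ∀ (a b : ℝ → ℝ) (a' b' s : ℝ), HasDerivAt a a' s → HasDerivAt b b' s →
        HasDerivAt (fun r => Y (a r) (b r))
          (kerSin α θ κ (a s) (b s) * a' + kerCos α θ κ (a s) (b s) * b') s) (x η : ℝ) :
    HasDerivAt (fun r => Y x r) (kerCos α θ κ x η) η := by
  simpa using hY (fun _ => x) id 0 1 η (hasDerivAt_const η x) (hasDerivAt_id η)

/-- Majorant of the kernels in the sector `ψ ≤ η ≤ π`. -/
def sectorBound (α θ κ c x : ℝ) : ℝ := Real.exp (Real.exp x * c + θ * Real.exp (α * x) + κ * x)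

theorem phaseRe_le {α θ κ x η c : ℝ} (hθ : 0 ≤ θ) (hc : Real.cos η ≤ c) :
    phaseRe α θ κ x η ≤ Real.exp x * c + θ * Real.exp (α * x) + κ * x := by
  unfold phaseRe
  have h1 : Real.exp x * Real.cos η ≤ Real.exp x * c := by gcongr
  have h2 : -(θ * Real.exp (α * x)) ≤ θ * (Real.exp (α * x) * Real.cos (α * η)) := by
    have := Real.neg_one_le_cos (α * η)
    have h3 : 0 ≤ θ * Real.exp (α * x) := by positivity
    nlinarith
  linarith

theorem abs_kerCos_le {α θ κ x η c : ℝ} (hθ : 0 ≤ θ) (hc : Real.cos η ≤ c) :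
    |kerCos α θ κ x η| ≤ sectorBound α θ κ c x := by
  unfold kerCos sectorBound
  rw [abs_mul, Real.abs_exp]
  calc _ ≤ Real.exp (phaseRe α θ κ x η) * 1 := by gcongr; exact Real.abs_cos_le_one _
    _ ≤ _ := by rw [mul_one]; exact Real.exp_le_exp.2 (phaseRe_le hθ hc)

theorem abs_kerSin_le {α θ κ x η c : ℝ} (hθ : 0 ≤ θ) (hc : Real.cos η ≤ c) :
    |kerSin α θ κ x η| ≤ sectorBound α θ κ c x := by
  unfold kerSin sectorBound
  rw [abs_mul, Real.abs_exp]
  calc _ ≤ Real.exp (phaseRe α θ κ x η) * 1 := by gcongr; exact Real.abs_sin_le_one _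
    _ ≤ _ := by rw [mul_one]; exact Real.exp_le_exp.2 (phaseRe_le hθ hc)

theorem continuous_kerSin (α θ κ : ℝ) : Continuous fun q : ℝ × ℝ => kerSin α θ κ q.1 q.2 := by
  unfold kerSin phaseRe phaseIm; fun_prop

theorem continuous_kerCos (α θ κ : ℝ) : Continuous fun q : ℝ × ℝ => kerCos α θ κ q.1 q.2 := by
  unfold kerCos phaseRe phaseIm; fun_prop

theorem tendsto_sectorBound {α : ℝ} (hα' : α < 1) (θ κ : ℝ) {c : ℝ} (hc : c < 0) :
    Tendsto (sectorBound α θ κ c) atTop (𝓝 0) := by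
  unfold sectorBound
  refine Real.tendsto_exp_atBot.comp ?_
  have h1 : Tendsto (fun x : ℝ => c + θ * Real.exp ((α - 1) * x) + κ * (x * Real.exp (-x)))
      atTop (𝓝 (c + θ * 0 + κ * 0)) := by
    refine Tendsto.add (Tendsto.add tendsto_const_nhds (Tendsto.const_mul _ ?_))
      (Tendsto.const_mul _ ?_)
    · exact Real.tendsto_exp_atBot.comp (tendsto_id.const_mul_atTop_of_neg (by linarith))
    · simpa using Real.tendsto_pow_mul_exp_neg_atTop_nhds_zero 1
  have h2 := Real.tendsto_exp_atTop.atTop_mul_neg (C := c) hc (by simpa using h1)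
  refine h2.congr fun x => ?_
  have e1 : Real.exp x * Real.exp ((α - 1) * x) = Real.exp (α * x) := by
    rw [← Real.exp_add]; ring_nf
  have e2 : Real.exp x * Real.exp (-x) = 1 := by rw [← Real.exp_add]; simp
  linear_combination θ * e1 + κ * x * e2

theorem integrableOn_sectorBound {α : ℝ} (hα' : α < 1) (θ κ : ℝ) {c : ℝ} (hc : c < 0) (x₀ : ℝ) :
    IntegrableOn (sectorBound α θ κ c) (Set.Ioi x₀) := by
  refine integrable_of_isBigO_exp_neg (b := 1) one_pos ?_ ?_
  · unfold sectorBound; fun_prop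
  · have h := tendsto_sectorBound hα' θ (κ + 1) hc
    have h2 := h.isBigO_one ℝ
    have h3 := h2.mul (Asymptotics.isBigO_refl (fun x : ℝ => Real.exp (-1 * x)) atTop)
    refine (h3.congr' ?_ ?_)
    · filter_upwards with x
      unfold sectorBound; rw [← Real.exp_add]; ring_nf
    · filter_upwards with x; simp

theorem integrableOn_kerSin {α θ κ ψ : ℝ} (hα' : α < 1) (hθ : 0 ≤ θ) (hψ : Real.cos ψ < 0)
    (x₀ : ℝ) : IntegrableOn (fun x => kerSin α θ κ x ψ) (Set.Ioi x₀) := by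
  refine (integrableOn_sectorBound hα' θ κ hψ x₀).mono' ?_ ?_
  · exact ((continuous_kerSin α θ κ).comp (by fun_prop : Continuous fun x : ℝ => (x, ψ))).aestronglyMeasurable
  · filter_upwards with x using abs_kerSin_le hθ le_rfl

/-- Integral of `exp (e^w − θ e^{αw} + κw)` (imaginary part) over the contour which runs from `0`
to `iψ` and then to `+∞ + iψ`. -/
def hankelInt (α θ κ ψ : ℝ) : ℝ :=
  (∫ η in (0:ℝ)..ψ, kerCos α θ κ 0 η) + ∫ x in Set.Ioi (0:ℝ), kerSin α θ κ x ψ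

section
variable {α θ κ : ℝ} {Y : ℝ → ℝ → ℝ}

theorem conj_eq_integral (hY0 : ∀ x, Y x 0 = 0)
    (hY : ∀ (a b : ℝ → ℝ) (a' b' s : ℝ), HasDerivAt a a' s → HasDerivAt b b' s →
        HasDerivAt (fun r => Y (a r) (b r))
          (kerSin α θ κ (a s) (b s) * a' + kerCos α θ κ (a s) (b s) * b') s) (x ψ : ℝ) :
    Y x ψ = ∫ η in (0:ℝ)..ψ, kerCos α θ κ x η := by
  rw [intervalIntegral.integral_eq_sub_of_hasDerivAt
    (fun η _ => hasDerivAt_conj_right hY x η)]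
  · simp [hY0]
  · exact ((continuous_kerCos α θ κ).comp
      (by fun_prop : Continuous fun η : ℝ => (x, η))).intervalIntegrable _ _

theorem tendsto_conj (hα' : α < 1) (hθ : 0 ≤ θ) (hY0 : ∀ x, Y x 0 = 0)
    (hY : ∀ (a b : ℝ → ℝ) (a' b' s : ℝ), HasDerivAt a a' s → HasDerivAt b b' s →
        HasDerivAt (fun r => Y (a r) (b r))
          (kerSin α θ κ (a s) (b s) * a' + kerCos α θ κ (a s) (b s) * b') s)
    {ψ : ℝ} (hψ : Real.cos ψ < 0) :
    Tendsto (fun x => Y x ψ) atTop (𝓝 (hankelInt α θ κ ψ)) := by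
  have hInt := integrableOn_kerSin (α := α) (κ := κ) hα' hθ hψ 0
  have h1 := tendsto_limUnder_of_hasDerivAt_of_integrableOn_Ioi
    (fun x _ => hasDerivAt_conj_left hY x ψ) hInt
  have h2 := integral_Ioi_of_hasDerivAt_of_tendsto
    (hasDerivAt_conj_left hY 0 ψ).continuousAt.continuousWithinAt
    (fun x _ => hasDerivAt_conj_left hY x ψ) hInt h1
  have h3 : limUnder atTop (fun x => Y x ψ) = hankelInt α θ κ ψ := by
    unfold hankelInt
    rw [h2, ← conj_eq_integral hY0 hY 0 ψ]; ring
  rwa [h3] at h1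

theorem abs_conj_sub_le (hθ : 0 ≤ θ)
    (hY : ∀ (a b : ℝ → ℝ) (a' b' s : ℝ), HasDerivAt a a' s → HasDerivAt b b' s →
        HasDerivAt (fun r => Y (a r) (b r))
          (kerSin α θ κ (a s) (b s) * a' + kerCos α θ κ (a s) (b s) * b') s)
    {c ψ ψ' : ℝ} (h : ψ ≤ ψ') (hc : ∀ η ∈ Set.Icc ψ ψ', Real.cos η ≤ c) (x : ℝ) :
    |Y x ψ' - Y x ψ| ≤ sectorBound α θ κ c x * (ψ' - ψ) := by
  have := Convex.norm_image_sub_le_of_norm_hasDerivWithin_le (s := Set.Icc ψ ψ')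
    (f := fun r => Y x r) (x := ψ) (y := ψ')
    (fun η _ => (hasDerivAt_conj_right hY x η).hasDerivWithinAt)
    (fun η hη => abs_kerCos_le (α := α) (κ := κ) (x := x) hθ (hc η hη)) (convex_Icc _ _)
    (Set.left_mem_Icc.2 h) (Set.right_mem_Icc.2 h)
  simpa [Real.norm_eq_abs, abs_of_nonneg (sub_nonneg.2 h)] using this

end

theorem cos_le_of_mem_sector {ψ η : ℝ} (h0 : 0 ≤ ψ) (hη : η ∈ Set.Icc ψ Real.pi) :
    Real.cos η ≤ Real.cos ψ :=
  Real.cos_le_cos_of_nonneg_of_le_pi h0 hη.2 hη.1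

theorem hankelInt_eq_pi {α θ κ ψ : ℝ} (hα' : α < 1) (hθ : 0 ≤ θ) (hψ : Real.pi / 2 < ψ)
    (hψ' : ψ ≤ Real.pi) : hankelInt α θ κ ψ = hankelInt α θ κ Real.pi := by
  obtain ⟨Y, hY0, hY⟩ := exists_conjugate_primitive α θ κ
  have hc : Real.cos ψ < 0 := Real.cos_neg_of_pi_div_two_lt_of_lt hψ
    (by linarith [Real.pi_pos])
  have h1 := tendsto_conj hα' hθ hY0 hY hc
  have h2 := tendsto_conj hα' hθ hY0 hY (ψ := Real.pi) (by simp)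
  have h3 : Tendsto (fun x => Y x Real.pi - Y x ψ) atTop (𝓝 0) := by
    refine squeeze_zero_norm (a := fun x => sectorBound α θ κ (Real.cos ψ) x * (Real.pi - ψ)) ?_ ?_
    · intro x
      exact abs_conj_sub_le hθ hY hψ' (fun η hη => cos_le_of_mem_sector
        (by linarith [Real.pi_pos]) hη) x
    · simpa using (tendsto_sectorBound hα' θ κ hc).mul_const (Real.pi - ψ)
  have h4 := tendsto_nhds_unique h3 (h2.sub h1)
  linarith

theorem sectorBound_one_tendsto_atBot {α : ℝ} (hα : 0 < α) (θ : ℝ) {κ : ℝ} (hκ : 0 < κ) :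
    Tendsto (sectorBound α θ κ 1) atBot (𝓝 0) := by
  unfold sectorBound
  refine Real.tendsto_exp_atBot.comp ?_
  have h1 : Tendsto (fun x : ℝ => Real.exp x * 1 + θ * Real.exp (α * x)) atBot (𝓝 (0 * 1 + θ * 0)) :=
    (Real.tendsto_exp_atBot.mul_const _).add
      ((Real.tendsto_exp_atBot.comp (tendsto_id.const_mul_atBot hα)).const_mul _)
  exact h1.add_atBot (tendsto_id.const_mul_atBot hκ)

theorem integrable_sectorBound {α θ κ c : ℝ} (hα : 0 < α) (hα' : α < 1) (hθ : 0 ≤ θ) (hκ : 0 < κ)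
    (hc : c < 0) : Integrable (sectorBound α θ κ c) := by
  have hm : Continuous (sectorBound α θ κ c) := by unfold sectorBound; fun_prop
  rw [← integrableOn_univ, ← Set.Iic_union_Ioi (a := (0:ℝ))]
  refine IntegrableOn.union ?_ (integrableOn_sectorBound hα' θ κ hc 0)
  have : IntegrableOn (fun x : ℝ => Real.exp θ * Real.exp (κ * x)) (Set.Iic 0) :=
    (integrableOn_exp_mul_Iic hκ 0).const_mul _
  refine this.mono' hm.aestronglyMeasurable ?_
  filter_upwards [ae_restrict_mem measurableSet_Iic] with x hx
  have hx : x ≤ 0 := hx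
  unfold sectorBound
  rw [← Real.exp_add, Real.norm_eq_abs, Real.abs_exp]
  have h1 : Real.exp x * c ≤ 0 := mul_nonpos_of_nonneg_of_nonpos (Real.exp_pos x).le hc.le
  have h2 : Real.exp (α * x) ≤ 1 := Real.exp_le_one_iff.2 (by nlinarith)
  have h3 : θ * Real.exp (α * x) ≤ θ * 1 := by gcongr
  apply Real.exp_le_exp.2
  linarith

theorem integrable_kerSin_pi {α θ κ : ℝ} (hα : 0 < α) (hα' : α < 1) (hθ : 0 ≤ θ) (hκ : 0 < κ) :
    Integrable (fun x => kerSin α θ κ x Real.pi) := by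
  refine (integrable_sectorBound hα hα' hθ hκ neg_one_lt_zero).mono' ?_ ?_
  · exact ((continuous_kerSin α θ κ).comp
      (by fun_prop : Continuous fun x : ℝ => (x, Real.pi))).aestronglyMeasurable
  · filter_upwards with x using abs_kerSin_le hθ (by simp)

/-- For `κ > 0` the contour can be collapsed onto the line `Im w = π`. -/
theorem hankelInt_pi_eq_integral {α θ κ : ℝ} (hα : 0 < α) (hα' : α < 1) (hθ : 0 ≤ θ)
    (hκ : 0 < κ) : hankelInt α θ κ Real.pi = ∫ x, kerSin α θ κ x Real.pi := by
  obtain ⟨Y, hY0, hY⟩ := exists_conjugate_primitive α θ κ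
  have h2 := tendsto_conj hα' hθ hY0 hY (ψ := Real.pi) (by simp)
  have h3 : Tendsto (fun x => Y x Real.pi) atBot (𝓝 0) := by
    refine squeeze_zero_norm (a := fun x => sectorBound α θ κ 1 x * Real.pi) ?_ ?_
    · intro x
      simpa [hY0] using abs_conj_sub_le hθ hY Real.pi_pos.le (fun η _ => Real.cos_le_one η) x
    · simpa using (sectorBound_one_tendsto_atBot hα θ hκ).mul_const Real.pi
  have := integral_of_hasDerivAt_of_tendsto (fun x => hasDerivAt_conj_left hY x Real.pi)
    (integrable_kerSin_pi hα hα' hθ hκ) h3 h2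
  rw [this, sub_zero]

theorem hankelInt_zero_zero {α : ℝ} (hα' : α < 1) : hankelInt α 0 0 Real.pi = Real.pi := by
  obtain ⟨Y, hY0, hY⟩ := exists_conjugate_primitive α 0 0
  have h2 := tendsto_conj hα' le_rfl hY0 hY (ψ := Real.pi) (by simp)
  have hd : ∀ x, HasDerivAt (fun x => Y x Real.pi) 0 x := by
    intro x
    simpa [kerSin, phaseIm] using hasDerivAt_conj_left hY x Real.pi
  have hcst : ∀ x, Y x Real.pi = Y 0 Real.pi := fun x =>
    is_const_of_deriv_eq_zero (fun x => (hd x).differentiableAt) (fun x => (hd x).deriv) x 0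
  have h3 : Tendsto (fun x => Y x Real.pi) atBot (𝓝 (∫ η in (0:ℝ)..Real.pi, (1:ℝ))) := by
    simp_rw [conj_eq_integral hY0 hY]
    refine intervalIntegral.tendsto_integral_filter_of_dominated_convergence
      (fun _ => Real.exp 1) ?_ ?_ ?_ ?_
    · filter_upwards with x
      exact ((continuous_kerCos α 0 0).comp
        (by fun_prop : Continuous fun η : ℝ => (x, η))).aestronglyMeasurable
    · filter_upwards [eventually_le_atBot 0] with x hx
      filter_upwards with η _
      refine (abs_kerCos_le le_rfl (Real.cos_le_one η)).trans ?_
      simpa [sectorBound] using hx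
    · simp
    · filter_upwards with η _
      have e1 : Tendsto (fun x => phaseRe α 0 0 x η) atBot (𝓝 0) := by
        simpa [phaseRe] using Real.tendsto_exp_atBot.mul_const (Real.cos η)
      have e2 : Tendsto (fun x => phaseIm α 0 0 x η) atBot (𝓝 0) := by
        simpa [phaseIm] using Real.tendsto_exp_atBot.mul_const (Real.sin η)
      have := ((Real.continuous_exp.tendsto 0).comp e1).mul ((Real.continuous_cos.tendsto 0).comp e2)
      simpa [kerCos, Function.comp_def] using this
  simp_rw [hcst] at h2 h3
  rw [← tendsto_nhds_unique tendsto_const_nhds h2, tendsto_nhds_unique tendsto_const_nhds h3]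
  simp

theorem integral_Ioi_eq_integral_exp (g : ℝ → ℝ) :
    ∫ r in Set.Ioi (0:ℝ), g r = ∫ x, Real.exp x * g (Real.exp x) := by
  have := integral_image_eq_integral_abs_deriv_smul MeasurableSet.univ
      (fun x _ ↦ (Real.hasDerivAt_exp x).hasDerivWithinAt) Real.exp_injective.injOn g
  rw [Set.image_univ, Real.range_exp] at this
  simpa [abs_of_pos (Real.exp_pos _)] using this

theorem Gamma_eq_integral_exp {κ : ℝ} (hκ : 0 < κ) :
    Real.Gamma κ = ∫ x, Real.exp (-Real.exp x + κ * x) := by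
  rw [Real.Gamma_eq_integral hκ, integral_Ioi_eq_integral_exp]
  refine integral_congr_ae (Eventually.of_forall fun x => ?_)
  simp only
  rw [← Real.exp_mul, ← Real.exp_add, ← Real.exp_add]
  ring_nf

/-- Reflection formula, valid at all `s > 0` with the usual conventions at the poles. -/
theorem sin_mul_Gamma_eq {s : ℝ} (hs : 0 < s) :
    Real.sin (Real.pi * s) * Real.Gamma s = Real.pi / Real.Gamma (1 - s) := by
  have h := Real.Gamma_mul_Gamma_one_sub s
  have hg := (Real.Gamma_pos_of_pos hs).ne'
  by_cases h0 : Real.sin (Real.pi * s) = 0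
  · rw [h0, div_zero] at h
    have : Real.Gamma (1 - s) = 0 := by simpa [hg] using h
    simp [h0, this]
  · have h1 : Real.Gamma (1 - s) ≠ 0 := by
      intro h1
      rw [h1, mul_zero] at h
      exact (div_ne_zero Real.pi_ne_zero h0) h.symm
    rw [eq_div_iff h1, mul_assoc, h]
    field_simp

theorem kerSin_zero_pi (α κ x : ℝ) :
    kerSin α 0 κ x Real.pi = Real.exp (-Real.exp x + κ * x) * Real.sin (Real.pi * κ) := by
  simp [kerSin, phaseRe, phaseIm, mul_comm κ Real.pi]

theorem hankelInt_zero_of_pos {α κ : ℝ} (hα : 0 < α) (hα' : α < 1) (hκ : 0 < κ) :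
    hankelInt α 0 κ Real.pi = Real.pi / Real.Gamma (1 - κ) := by
  rw [hankelInt_pi_eq_integral hα hα' le_rfl hκ]
  simp_rw [kerSin_zero_pi]
  rw [integral_mul_const, ← Gamma_eq_integral_exp hκ, ← sin_mul_Gamma_eq hκ, mul_comm]

theorem kerCos_add_one (α κ x η : ℝ) :
    kerCos α 0 (κ + 1) x η = Real.exp (phaseRe α 0 κ x η) *
      (Real.exp x * (Real.cos η * Real.cos (phaseIm α 0 κ x η)
        - Real.sin η * Real.sin (phaseIm α 0 κ x η))) := by
  have h1 : phaseRe α 0 (κ + 1) x η = phaseRe α 0 κ x η + x := by unfold phaseRe; ring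
  have h2 : phaseIm α 0 (κ + 1) x η = η + phaseIm α 0 κ x η := by unfold phaseIm; ring
  rw [kerCos, h1, h2, Real.exp_add, Real.cos_add]; ring

theorem kerSin_add_one (α κ x η : ℝ) :
    kerSin α 0 (κ + 1) x η = Real.exp (phaseRe α 0 κ x η) *
      (Real.exp x * (Real.sin η * Real.cos (phaseIm α 0 κ x η)
        + Real.cos η * Real.sin (phaseIm α 0 κ x η))) := by
  have h1 : phaseRe α 0 (κ + 1) x η = phaseRe α 0 κ x η + x := by unfold phaseRe; ring
  have h2 : phaseIm α 0 (κ + 1) x η = η + phaseIm α 0 κ x η := by unfold phaseIm; ring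
  rw [kerSin, h1, h2, Real.exp_add, Real.sin_add]; ring

theorem hasDerivAt_kerSin_right (α κ x η : ℝ) :
    HasDerivAt (fun η => kerSin α 0 κ x η) (kerCos α 0 (κ + 1) x η + κ * kerCos α 0 κ x η) η := by
  have h1 : HasDerivAt (fun η => phaseRe α 0 κ x η) (Real.exp x * (-Real.sin η)) η := by
    simpa [phaseRe] using ((Real.hasDerivAt_cos η).const_mul (Real.exp x)).add_const (κ * x)
  have h2 : HasDerivAt (fun η => phaseIm α 0 κ x η) (Real.exp x * Real.cos η + κ) η := by
    simpa [phaseIm] using ((Real.hasDerivAt_sin η).const_mul (Real.exp x)).fun_add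
      ((hasDerivAt_id η).const_mul κ)
  convert! h1.exp.mul h2.sin using 1
  rw [kerCos_add_one, kerCos]
  ring

theorem hasDerivAt_kerSin_left (α κ x η : ℝ) :
    HasDerivAt (fun x => kerSin α 0 κ x η) (kerSin α 0 (κ + 1) x η + κ * kerSin α 0 κ x η) x := by
  have h1 : HasDerivAt (fun x => phaseRe α 0 κ x η) (Real.exp x * Real.cos η + κ) x := by
    simpa [phaseRe] using ((Real.hasDerivAt_exp x).mul_const (Real.cos η)).fun_add
      ((hasDerivAt_id x).const_mul κ)
  have h2 : HasDerivAt (fun x => phaseIm α 0 κ x η) (Real.exp x * Real.sin η) x := by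
    simpa [phaseIm] using ((Real.hasDerivAt_exp x).mul_const (Real.sin η)).add_const (κ * η)
  convert! h1.exp.mul h2.sin using 1
  rw [kerSin_add_one, kerSin]
  ring

theorem hankelInt_recursion {α : ℝ} (hα' : α < 1) (κ : ℝ) :
    hankelInt α 0 (κ + 1) Real.pi + κ * hankelInt α 0 κ Real.pi = 0 := by
  have hcc : ∀ κ : ℝ, Continuous fun η => kerCos α 0 κ 0 η := fun κ =>
    (continuous_kerCos α 0 κ).comp (by fun_prop : Continuous fun η : ℝ => ((0:ℝ), η))
  have i1 := fun κ => integrableOn_kerSin (κ := κ) hα' le_rfl (ψ := Real.pi) (by simp) 0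
  have h1 := intervalIntegral.integral_eq_sub_of_hasDerivAt (a := 0) (b := Real.pi)
    (fun η _ => hasDerivAt_kerSin_right α κ 0 η)
    (((hcc (κ + 1)).add ((hcc κ).const_mul κ)).intervalIntegrable _ _)
  have hlim : Tendsto (fun x => kerSin α 0 κ x Real.pi) atTop (𝓝 0) :=
    squeeze_zero_norm (fun x => abs_kerSin_le le_rfl le_rfl)
      (tendsto_sectorBound hα' 0 κ (by simp))
  have h2 := integral_Ioi_of_hasDerivAt_of_tendsto (a := 0)
    (hasDerivAt_kerSin_left α κ 0 Real.pi).continuousAt.continuousWithinAt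
    (fun x _ => hasDerivAt_kerSin_left α κ x Real.pi) ((i1 (κ + 1)).add ((i1 κ).const_mul κ)) hlim
  rw [intervalIntegral.integral_add ((hcc _).intervalIntegrable _ _)
    (((hcc κ).const_mul κ).intervalIntegrable _ _), intervalIntegral.integral_const_mul] at h1
  rw [integral_add (i1 _) ((i1 κ).const_mul κ), integral_const_mul] at h2
  have h0 : kerSin α 0 κ 0 0 = 0 := by simp [kerSin, phaseIm]
  unfold hankelInt
  linarith

/-- Hankel's formula for the reciprocal Gamma function. -/
theorem hankelInt_zero {α : ℝ} (hα : 0 < α) (hα' : α < 1) (κ : ℝ) :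
    hankelInt α 0 κ Real.pi = Real.pi / Real.Gamma (1 - κ) := by
  obtain ⟨n, hn⟩ := exists_nat_gt (-κ)
  have : ∀ n : ℕ, ∀ κ : ℝ, -κ < n → hankelInt α 0 κ Real.pi = Real.pi / Real.Gamma (1 - κ) := by
    intro n
    induction n with
    | zero => intro κ hκ; exact hankelInt_zero_of_pos hα hα' (by simpa using hκ)
    | succ n ih =>
      intro κ hκ
      rcases eq_or_ne κ 0 with rfl | h0
      · simp [hankelInt_zero_zero hα']
      · have h1 := ih (κ + 1) (by push_cast at hκ; linarith)
        have h2 := hankelInt_recursion hα' κ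
        have h3 := Real.Gamma_add_one (s := -κ) (by simpa using h0)
        rw [show 1 - (κ + 1) = -κ by ring] at h1
        rw [h1] at h2
        rw [show 1 - κ = -κ + 1 by ring, h3]
        have h4 : hankelInt α 0 κ Real.pi = - (Real.pi / Real.Gamma (-κ)) / κ := by
          field_simp; linarith
        rw [h4]
        by_cases hG : Real.Gamma (-κ) = 0
        · simp [hG]
        · field_simp
  exact this n κ hn

theorem hasSum_kerSin_pi (α θ x : ℝ) :
    HasSum (fun k : ℕ => (-θ) ^ k / (k.factorial : ℝ) *
      (Real.exp (-Real.exp x + (α * (k + 1)) * x) * Real.sin (Real.pi * (α * (k + 1)))))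
      (kerSin α θ α x Real.pi) := by
  set z : ℂ := ((Real.exp (α * x) : ℝ) : ℂ) * Complex.exp ((α * Real.pi : ℝ) * Complex.I) with hz
  set b : ℂ := ((Real.exp (-Real.exp x + α * x) : ℝ) : ℂ) *
    Complex.exp ((α * Real.pi : ℝ) * Complex.I) with hb
  have h1 : HasSum (fun k : ℕ => (-(θ:ℂ) * z) ^ k / (k.factorial : ℂ)) (Complex.exp (-θ * z)) := by
    rw [Complex.exp_eq_exp_ℂ]; exact NormedSpace.expSeries_div_hasSum_exp _
  have h2 := Complex.hasSum_im (h1.mul_left b)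
  convert! h2 using 1
  · funext k
    have : b * ((-(θ:ℂ) * z) ^ k / (k.factorial : ℂ)) =
        (((-θ) ^ k / (k.factorial : ℝ) * Real.exp (-Real.exp x + (α * (k + 1)) * x) : ℝ) : ℂ) *
          Complex.exp ((Real.pi * (α * (k + 1)) : ℝ) * Complex.I) := by
      have e1 : Complex.exp ((Real.pi * (α * (k + 1)) : ℝ) * Complex.I) =
          Complex.exp ((α * Real.pi : ℝ) * Complex.I) *
            Complex.exp ((α * Real.pi : ℝ) * Complex.I) ^ k := by
        rw [← Complex.exp_nat_mul, ← Complex.exp_add]; push_cast; ring_nf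
      have e2 : Real.exp (-Real.exp x + (α * (k + 1)) * x) =
          Real.exp (-Real.exp x + α * x) * Real.exp (α * x) ^ k := by
        rw [← Real.exp_nat_mul, ← Real.exp_add]; ring_nf
      rw [e1, e2, hb, hz, mul_pow, mul_pow]
      push_cast
      ring
    rw [this, Complex.im_ofReal_mul, Complex.exp_ofReal_mul_I_im]
    ring
  · have : b * Complex.exp (-θ * z) =
        ((Real.exp (phaseRe α θ α x Real.pi) : ℝ) : ℂ) *
          Complex.exp ((phaseIm α θ α x Real.pi : ℝ) * Complex.I) := by
      have e3 : ((-Real.exp x + α * x : ℝ) : ℂ) + (α * Real.pi : ℝ) * Complex.I + -θ * z =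
          (phaseRe α θ α x Real.pi : ℝ) + (phaseIm α θ α x Real.pi : ℝ) * Complex.I := by
        rw [hz, Complex.exp_mul_I, ← Complex.ofReal_cos, ← Complex.ofReal_sin]
        simp only [phaseRe, phaseIm, Real.cos_pi, Real.sin_pi]
        push_cast
        ring
      rw [hb, Complex.ofReal_exp, Complex.ofReal_exp, ← Complex.exp_add, ← Complex.exp_add, e3,
        Complex.exp_add]
    rw [this, Complex.im_ofReal_mul, Complex.exp_ofReal_mul_I_im, kerSin]

theorem hasSum_wright {α θ : ℝ} (hα : 0 < α) (hα' : α < 1) (hθ : 0 ≤ θ) :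
    HasSum (fun k : ℕ => (-θ) ^ k / ((k.factorial : ℝ) * Real.Gamma (-α * (k : ℝ) + 1 - α)))
      (hankelInt α θ α Real.pi / Real.pi) := by
  rw [hankelInt_pi_eq_integral hα hα' hθ hα]
  have hb : ∀ x, HasSum (fun k : ℕ => θ ^ k / (k.factorial : ℝ) *
      Real.exp (-Real.exp x + (α * (k + 1)) * x)) (sectorBound α θ α (-1) x) := by
    intro x
    have h1 : HasSum (fun k : ℕ => (θ * Real.exp (α * x)) ^ k / (k.factorial : ℝ))
        (Real.exp (θ * Real.exp (α * x))) := by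
      rw [Real.exp_eq_exp_ℝ]; exact NormedSpace.expSeries_div_hasSum_exp _
    have h2 := h1.mul_left (Real.exp (-Real.exp x + α * x))
    convert! h2 using 1
    · funext k
      have e2 : Real.exp (-Real.exp x + (α * (k + 1)) * x) =
          Real.exp (-Real.exp x + α * x) * Real.exp (α * x) ^ k := by
        rw [← Real.exp_nat_mul, ← Real.exp_add]; ring_nf
      rw [e2, mul_pow]; ring
    · rw [sectorBound, ← Real.exp_add]; ring_nf
  have h := hasSum_integral_of_dominated_convergence (μ := volume)
    (F := fun (k : ℕ) (x : ℝ) => (-θ) ^ k / (k.factorial : ℝ) *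
      (Real.exp (-Real.exp x + (α * (k + 1)) * x) * Real.sin (Real.pi * (α * (k + 1)))))
    (fun (k : ℕ) (x : ℝ) => θ ^ k / (k.factorial : ℝ) *
      Real.exp (-Real.exp x + (α * (k + 1)) * x))
    (fun k => by fun_prop) ?_ ?_ ?_
    (Eventually.of_forall fun x => hasSum_kerSin_pi α θ x)
  · convert! h.div_const Real.pi using 1
    funext k
    have hk : 0 < α * (k + 1) := by positivity
    rw [integral_const_mul, integral_mul_const, ← Gamma_eq_integral_exp hk,
      mul_comm (Real.Gamma _), sin_mul_Gamma_eq hk,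
      show -α * (k:ℝ) + 1 - α = 1 - α * (k + 1) by ring, div_mul_div_comm, mul_div_assoc,
      mul_div_assoc, div_right_comm, div_self Real.pi_ne_zero, mul_one_div]
  · intro k
    filter_upwards with x
    rw [norm_mul, norm_mul, norm_div, norm_pow, norm_neg, Real.norm_of_nonneg hθ,
      Real.norm_of_nonneg (Real.exp_pos _).le, Real.norm_of_nonneg (Nat.cast_nonneg _)]
    have := Real.abs_sin_le_one (Real.pi * (α * (k + 1)))
    gcongr
    rw [Real.norm_eq_abs]
    exact mul_le_of_le_one_right (Real.exp_pos _).le this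
  · filter_upwards with x using (hb x).summable
  · simp_rw [(hb _).tsum_eq]
    exact integrable_sectorBound hα hα' hθ hα neg_one_lt_zero

theorem wrightFn_eq {α θ : ℝ} (hα : 0 < α) (hα' : α < 1) (hθ : 0 ≤ θ) :
    wrightFn α θ = hankelInt α θ α Real.pi / Real.pi :=
  (hasSum_wright hα hα' hθ).tsum_eq

theorem hasDerivAt_log_sin {ψ : ℝ} (h : 0 < Real.sin ψ) :
    HasDerivAt (fun r => Real.log (Real.sin r)) (Real.cos ψ / Real.sin ψ) ψ :=
  (Real.hasDerivAt_sin ψ).log h.ne'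

theorem tendsto_sin_mul_div_sin {α : ℝ} :
    Tendsto (fun ψ => Real.sin (α * ψ) / Real.sin ψ) (𝓝[>] 0) (𝓝 α) := by
  have h1 : HasDerivAt (fun ψ => Real.sin (α * ψ)) α 0 := by
    simpa using ((hasDerivAt_id (0:ℝ)).const_mul α).sin
  have h2 : HasDerivAt Real.sin 1 0 := by simpa using Real.hasDerivAt_sin 0
  have t1 := h1.tendsto_slope.mono_left (nhdsWithin_mono 0
    (fun x (hx : x ∈ Set.Ioi (0:ℝ)) => (Set.mem_Ioi.1 hx).ne'))
  have t2 := h2.tendsto_slope.mono_left (nhdsWithin_mono 0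
    (fun x (hx : x ∈ Set.Ioi (0:ℝ)) => (Set.mem_Ioi.1 hx).ne'))
  have t3 := t1.div t2 one_ne_zero
  rw [div_one] at t3
  refine t3.congr' ?_
  filter_upwards [self_mem_nhdsWithin] with x hx
  have hx : x ≠ 0 := (Set.mem_Ioi.1 hx).ne'
  simp only [slope_def_field, Real.sin_zero, mul_zero, sub_zero, Pi.div_apply]
  field_simp

/-- The Wright function is nonnegative: deform the contour onto the curve
`e^x sin η = θ e^{αx} sin (αη)` of steepest descent. -/
theorem wrightFn_nonneg {α θ : ℝ} (hα : 0 < α) (hα' : α < 1) (hθ : 0 < θ) :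
    0 ≤ wrightFn α θ := by
  rw [wrightFn_eq hα hα' hθ.le]
  refine div_nonneg ?_ Real.pi_pos.le
  obtain ⟨Y, hY0, hY⟩ := exists_conjugate_primitive α θ α
  have hpi := Real.pi_pos
  have h1α : 0 < 1 - α := by linarith
  set ℓ : ℝ → ℝ := fun ψ => (Real.log θ + Real.log (Real.sin (α * ψ)) - Real.log (Real.sin ψ)) /
    (1 - α) with hℓ
  have hs : ∀ ψ ∈ Set.Ioo 0 Real.pi, 0 < Real.sin ψ := fun ψ h => Real.sin_pos_of_mem_Ioo h
  have hsα : ∀ ψ ∈ Set.Ioo 0 Real.pi, 0 < Real.sin (α * ψ) := fun ψ h =>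
    Real.sin_pos_of_mem_Ioo ⟨mul_pos hα h.1, by nlinarith [h.1, h.2]⟩
  have hcurve : ∀ ψ ∈ Set.Ioo 0 Real.pi,
      Real.exp (ℓ ψ) * Real.sin ψ = θ * (Real.exp (α * ℓ ψ) * Real.sin (α * ψ)) := by
    intro ψ h
    have e1 : ℓ ψ + Real.log (Real.sin ψ) = Real.log θ + (α * ℓ ψ + Real.log (Real.sin (α * ψ))) := by
      have : (1 - α) * ℓ ψ =
          Real.log θ + Real.log (Real.sin (α * ψ)) - Real.log (Real.sin ψ) := by
        simp only [hℓ]; field_simp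
      linarith
    have e2 := congrArg Real.exp e1
    rwa [Real.exp_add, Real.exp_add, Real.exp_add, Real.exp_log (hs ψ h),
      Real.exp_log (hsα ψ h), Real.exp_log hθ] at e2
  have hdℓ : ∀ ψ ∈ Set.Ioo 0 Real.pi, HasDerivAt ℓ
      ((α * (Real.cos (α * ψ) / Real.sin (α * ψ)) - Real.cos ψ / Real.sin ψ) / (1 - α)) ψ := by
    intro ψ h
    have d1 : HasDerivAt (fun r => Real.log (Real.sin (α * r)))
        (α * (Real.cos (α * ψ) / Real.sin (α * ψ))) ψ := by
      have := (hasDerivAt_log_sin (hsα ψ h)).comp ψ ((hasDerivAt_id ψ).const_mul α)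
      simpa [Function.comp_def, mul_comm] using this
    have := ((d1.const_add (Real.log θ)).sub (hasDerivAt_log_sin (hs ψ h))).div_const (1 - α)
    exact this
  have hdY : ∀ ψ ∈ Set.Ioo 0 Real.pi, HasDerivAt (fun r => Y (ℓ r) r)
      (Real.exp (phaseRe α θ α (ℓ ψ) ψ) * (Real.sin ((1 - α) * ψ) / (Real.sin ψ * (1 - α)))) ψ := by
    intro ψ h
    have d := hY ℓ id _ 1 ψ (hdℓ ψ h) (hasDerivAt_id ψ)
    convert! d using 1
    have e3 : phaseIm α θ α (ℓ ψ) ψ = α * ψ := by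
      unfold phaseIm; rw [hcurve ψ h]; ring
    simp only [id, kerSin, kerCos, e3]
    rw [show (1 - α) * ψ = ψ - α * ψ by ring, Real.sin_sub]
    have := (hs ψ h).ne'
    have := (hsα ψ h).ne'
    field_simp
    ring
  have hmono : MonotoneOn (fun r => Y (ℓ r) r) (Set.Ioo 0 Real.pi) := by
    refine monotoneOn_of_deriv_nonneg (convex_Ioo _ _)
      (fun ψ h => (hdY ψ h).continuousAt.continuousWithinAt) ?_ ?_
    · rw [interior_Ioo]
      exact fun ψ h => (hdY ψ h).differentiableAt.differentiableWithinAt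
    · rw [interior_Ioo]
      intro ψ h
      rw [(hdY ψ h).deriv]
      have : 0 ≤ Real.sin ((1 - α) * ψ) :=
        Real.sin_nonneg_of_nonneg_of_le_pi (mul_nonneg h1α.le h.1.le) (by nlinarith [h.1, h.2])
      have := hs ψ h
      positivity
  -- behaviour at the real end of the curve
  have hℓ0 : Tendsto ℓ (𝓝[>] 0) (𝓝 ((Real.log θ + Real.log α) / (1 - α))) := by
    have t := ((tendsto_sin_mul_div_sin (α := α)).log hα.ne').const_add (Real.log θ)
    refine (t.div_const (1 - α)).congr' ?_
    filter_upwards [Ioo_mem_nhdsGT hpi] with ψ h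
    rw [Real.log_div (hsα ψ h).ne' (hs ψ h).ne']
    simp only [hℓ]; ring
  have hlim0 : Tendsto (fun r => Y (ℓ r) r) (𝓝[>] 0) (𝓝 0) := by
    have hb : Tendsto (fun r => sectorBound α θ α 1 (ℓ r) * r) (𝓝[>] 0)
        (𝓝 (sectorBound α θ α 1 ((Real.log θ + Real.log α) / (1 - α)) * 0)) := by
      have hc : Continuous (sectorBound α θ α 1) := by unfold sectorBound; fun_prop
      exact ((hc.tendsto _).comp hℓ0).mul (tendsto_nhdsWithin_of_tendsto_nhds tendsto_id)
    rw [mul_zero] at hb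
    refine squeeze_zero_norm' ?_ hb
    filter_upwards [self_mem_nhdsWithin] with r hr
    simpa [hY0] using abs_conj_sub_le hθ.le hY (Set.mem_Ioi.1 hr).le
      (fun η _ => Real.cos_le_one η) (ℓ r)
  have hnn : ∀ ψ ∈ Set.Ioo 0 Real.pi, 0 ≤ Y (ℓ ψ) ψ := by
    intro ψ h
    refine le_of_tendsto hlim0 ?_
    filter_upwards [Ioo_mem_nhdsGT h.1] with r hr
    exact hmono ⟨hr.1, hr.2.trans h.2⟩ h hr.2.le
  -- behaviour at the infinite end of the curve
  have hℓpi : Tendsto ℓ (𝓝[<] Real.pi) atTop := by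
    have t1 : Tendsto (fun ψ => Real.log (Real.sin ψ)) (𝓝[<] Real.pi) atBot := by
      refine Real.tendsto_log_nhdsGT_zero.comp ?_
      refine tendsto_nhdsWithin_iff.2 ⟨?_, ?_⟩
      · have := (Real.continuous_sin.tendsto Real.pi).mono_left
          (nhdsWithin_le_nhds (s := Set.Iio Real.pi))
        simpa using this
      · filter_upwards [Ioo_mem_nhdsLT hpi] with ψ h using hs ψ h
    have hsp : 0 < Real.sin (α * Real.pi) :=
      Real.sin_pos_of_mem_Ioo ⟨by positivity, by nlinarith⟩
    have t2 : Tendsto (fun ψ => Real.log θ + Real.log (Real.sin (α * ψ))) (𝓝[<] Real.pi)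
        (𝓝 (Real.log θ + Real.log (Real.sin (α * Real.pi)))) := by
      have hc : ContinuousAt (fun ψ => Real.log θ + Real.log (Real.sin (α * ψ))) Real.pi := by
        refine continuousAt_const.add (ContinuousAt.log ?_ hsp.ne')
        fun_prop
      exact hc.tendsto.mono_left nhdsWithin_le_nhds
    have t3 := (t2.add_atTop (tendsto_neg_atBot_atTop.comp t1)).atTop_div_const h1α
    exact t3.congr fun ψ => by simp only [hℓ, Function.comp]; ring
  have hfar := (tendsto_conj hα' hθ.le hY0 hY (ψ := Real.pi) (by simp)).comp hℓpi
  have hsec : Tendsto (fun ψ => Y (ℓ ψ) Real.pi - Y (ℓ ψ) ψ) (𝓝[<] Real.pi) (𝓝 0) := by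
    set ψ₀ := 2 * Real.pi / 3
    have hc0 : Real.cos ψ₀ < 0 := Real.cos_neg_of_pi_div_two_lt_of_lt
      (by simp only [ψ₀]; linarith) (by simp only [ψ₀]; linarith)
    have hb := (((tendsto_sectorBound hα' θ α hc0).comp hℓpi).mul_const Real.pi)
    rw [zero_mul] at hb
    refine squeeze_zero_norm' ?_ hb
    filter_upwards [Ioo_mem_nhdsLT (show ψ₀ < Real.pi by simp only [ψ₀]; linarith)] with ψ h
    have hψ0 : 0 ≤ ψ₀ := by positivity
    refine (abs_conj_sub_le hθ.le hY h.2.le (c := Real.cos ψ₀) (fun η hη =>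
      cos_le_of_mem_sector hψ0 ⟨h.1.le.trans hη.1, hη.2⟩) (ℓ ψ)).trans ?_
    have : 0 ≤ sectorBound α θ α (Real.cos ψ₀) (ℓ ψ) := (Real.exp_pos _).le
    simp only [Function.comp]
    gcongr
    linarith [h.1]
  have hcur := hfar.sub hsec
  simp only [Function.comp, sub_sub_cancel, sub_zero] at hcur
  refine ge_of_tendsto hcur ?_
  filter_upwards [Ioo_mem_nhdsLT hpi] with ψ h using hnn ψ h

theorem norm_pow_mul_cexp (z : ℂ) (n : ℕ) {θ : ℝ} (hθ : 0 < θ) :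
    ‖(θ:ℂ) ^ n * Complex.exp (-(θ * z))‖ = θ ^ n * Real.exp (-z.re * θ) := by
  rw [norm_mul, norm_pow, Complex.norm_real, Real.norm_of_nonneg hθ.le, Complex.norm_exp]
  simp [mul_comm]

theorem integrableOn_pow_mul_exp {c : ℝ} (hc : 0 < c) (n : ℕ) :
    IntegrableOn (fun θ : ℝ => θ ^ n * Real.exp (-c * θ)) (Set.Ioi 0) := by
  have := integrableOn_rpow_mul_exp_neg_mul_rpow (s := n) (p := 1) (b := c)
    (by have : (0:ℝ) ≤ n := n.cast_nonneg
        linarith) one_pos hc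
  simpa using this

theorem integrableOn_pow_mul_cexp {z : ℂ} (hz : 0 < z.re) (n : ℕ) :
    IntegrableOn (fun θ : ℝ => (θ:ℂ) ^ n * Complex.exp (-(θ * z))) (Set.Ioi 0) := by
  refine (integrableOn_pow_mul_exp hz n).mono' (by fun_prop) ?_
  filter_upwards [ae_restrict_mem measurableSet_Ioi] with θ hθ
  exact (norm_pow_mul_cexp z n hθ).le

theorem integral_pow_mul_cexp {z : ℂ} (hz : 0 < z.re) (n : ℕ) :
    ∫ θ in Set.Ioi (0:ℝ), (θ:ℂ) ^ n * Complex.exp (-(θ * z)) = n.factorial / z ^ (n + 1) := by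
  have hz0 : z ≠ 0 := by rintro rfl; simp at hz
  have hlim : ∀ m : ℕ, Tendsto (fun θ : ℝ => -((θ:ℂ) ^ m * Complex.exp (-(θ * z)) / z))
      atTop (𝓝 0) := by
    intro m
    have h0 : Tendsto (fun θ : ℝ => (θ:ℂ) ^ m * Complex.exp (-(θ * z))) atTop (𝓝 0) := by
      rw [tendsto_zero_iff_norm_tendsto_zero]
      have := tendsto_rpow_mul_exp_neg_mul_atTop_nhds_zero m z.re hz
      refine this.congr' ?_
      filter_upwards [eventually_gt_atTop 0] with θ hθ
      rw [norm_pow_mul_cexp z m hθ, Real.rpow_natCast]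
    simpa using (h0.div_const z).neg
  have hexp : ∀ θ : ℝ, HasDerivAt (fun r : ℝ => Complex.exp (-((r:ℂ) * z)))
      (-z * Complex.exp (-(θ * z))) θ := by
    intro θ
    have h1 : HasDerivAt (fun r : ℝ => -((r:ℂ) * z)) (-(1 * z)) θ :=
      ((Complex.ofRealCLM.hasDerivAt (x := θ)).mul_const z).neg
    simpa [mul_comm] using h1.cexp
  induction n with
  | zero =>
    have h := integral_Ioi_of_hasDerivAt_of_tendsto (a := 0)
      (f := fun θ : ℝ => -((θ:ℂ) ^ 0 * Complex.exp (-(θ * z)) / z))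
      (f' := fun θ : ℝ => (θ:ℂ) ^ 0 * Complex.exp (-(θ * z))) (m := 0)
      (by apply Continuous.continuousWithinAt; fun_prop)
      (fun θ _ => by
        have := ((hexp θ).div_const z).neg
        simp only [pow_zero, one_mul]
        convert! this using 1
        field_simp)
      (integrableOn_pow_mul_cexp hz 0) (hlim 0)
    rw [h]; simp
  | succ n ih =>
    have h := integral_Ioi_of_hasDerivAt_of_tendsto (a := 0)
      (f := fun θ : ℝ => -((θ:ℂ) ^ (n+1) * Complex.exp (-(θ * z)) / z))
      (f' := fun θ : ℝ => (θ:ℂ) ^ (n+1) * Complex.exp (-(θ * z)) -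
        ((n+1 : ℕ) : ℂ) / z * ((θ:ℂ) ^ n * Complex.exp (-(θ * z)))) (m := 0)
      (by apply Continuous.continuousWithinAt; fun_prop)
      (fun θ _ => by
        have hp : HasDerivAt (fun r : ℝ => (r:ℂ) ^ (n+1)) (((n+1 : ℕ) : ℂ) * (θ:ℂ) ^ n * 1) θ := by
          simpa using (Complex.ofRealCLM.hasDerivAt (x := θ)).fun_pow (n+1)
        have := ((hp.mul (hexp θ)).div_const z).neg
        convert! this using 1
        field_simp
        ring)
      ((integrableOn_pow_mul_cexp hz (n+1)).sub ((integrableOn_pow_mul_cexp hz n).const_mul _))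
      (hlim (n+1))
    rw [integral_sub (integrableOn_pow_mul_cexp hz (n+1))
      ((integrableOn_pow_mul_cexp hz n).const_mul _), integral_const_mul, ih, sub_eq_iff_eq_add] at h
    rw [h, Nat.factorial_succ]
    push_cast
    field_simp
    simp
    ring

theorem integral_pow_mul_cker {α x η : ℝ} (hη : 0 < Real.cos (α * η)) (κ : ℝ) (n : ℕ) :
    IntegrableOn (fun θ : ℝ => ((θ ^ n : ℝ) : ℂ) * (⟨kerCos α θ κ x η, kerSin α θ κ x η⟩ : ℂ))
      (Set.Ioi 0) ∧
    ∫ θ in Set.Ioi (0:ℝ), ((θ ^ n : ℝ) : ℂ) * (⟨kerCos α θ κ x η, kerSin α θ κ x η⟩ : ℂ) =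
      n.factorial * ⟨kerCos α 0 (κ - α * (n + 1)) x η, kerSin α 0 (κ - α * (n + 1)) x η⟩ := by
  set w : ℂ := x + η * Complex.I with hw
  set z : ℂ := Complex.exp (α * w) with hz
  have hzre : 0 < z.re := by
    rw [hz, Complex.exp_re]
    simp only [hw]
    have e1 : ((α:ℂ) * (x + η * Complex.I)).im = α * η := by simp
    rw [e1]
    positivity
  have e : ∀ θ : ℝ, ((θ ^ n : ℝ) : ℂ) * (⟨kerCos α θ κ x η, kerSin α θ κ x η⟩ : ℂ) =
      Complex.exp (Complex.exp w + κ * w) * ((θ:ℂ) ^ n * Complex.exp (-(θ * z))) := by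
    intro θ
    rw [← cexp_phase_eq, ← hw, ← hz, show Complex.exp w - θ * z + κ * w =
      (Complex.exp w + κ * w) + -(θ * z) by ring, Complex.exp_add]
    push_cast; ring
  simp_rw [e]
  refine ⟨(integrableOn_pow_mul_cexp hzre n).const_mul _, ?_⟩
  rw [integral_const_mul, integral_pow_mul_cexp hzre, ← cexp_phase_eq, ← hw, hz, ← Complex.exp_nat_mul,
    mul_div_assoc', mul_comm _ (n.factorial : ℂ), mul_div_assoc, ← Complex.exp_sub]
  congr 2
  push_cast; ring

theorem integral_pow_mul_kerCos {α x η : ℝ} (hη : 0 < Real.cos (α * η)) (κ : ℝ) (n : ℕ) :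
    ∫ θ in Set.Ioi (0:ℝ), θ ^ n * kerCos α θ κ x η =
      n.factorial * kerCos α 0 (κ - α * (n + 1)) x η := by
  obtain ⟨hi, h⟩ := integral_pow_mul_cker (x := x) hη κ n
  have := congrArg Complex.re h
  rw [← RCLike.re_eq_complex_re, ← integral_re hi] at this
  simpa [-Complex.ofReal_pow] using this

theorem integral_pow_mul_kerSin {α x η : ℝ} (hη : 0 < Real.cos (α * η)) (κ : ℝ) (n : ℕ) :
    ∫ θ in Set.Ioi (0:ℝ), θ ^ n * kerSin α θ κ x η =
      n.factorial * kerSin α 0 (κ - α * (n + 1)) x η := by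
  obtain ⟨hi, h⟩ := integral_pow_mul_cker (x := x) hη κ n
  have := congrArg Complex.im h
  rw [← RCLike.im_eq_complex_im, ← integral_im hi] at this
  simpa [-Complex.ofReal_pow] using this


theorem integral_pow_mul_integral {ν : Measure ℝ} [SFinite ν] {F : ℝ → ℝ → ℝ} {b : ℝ → ℝ} {c : ℝ}
    (hc : 0 < c) (hF : Continuous fun q : ℝ × ℝ => F q.1 q.2) (hb : Integrable b ν)
    (hFb : ∀ᵐ y ∂ν, ∀ θ > 0, |F θ y| ≤ Real.exp (-c * θ) * b y) (n : ℕ) :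
    IntegrableOn (fun θ => θ ^ n * ∫ y, F θ y ∂ν) (Set.Ioi 0) ∧
    ∫ θ in Set.Ioi (0:ℝ), θ ^ n * ∫ y, F θ y ∂ν =
      ∫ y, (∫ θ in Set.Ioi (0:ℝ), θ ^ n * F θ y) ∂ν := by
  have hInt : Integrable (Function.uncurry fun θ y => θ ^ n * F θ y)
      ((volume.restrict (Set.Ioi (0:ℝ))).prod ν) := by
    refine ((integrableOn_pow_mul_exp hc n).mul_prod hb).mono' ?_ ?_
    · have : Continuous (Function.uncurry fun θ y => θ ^ n * F θ y) := by
        unfold Function.uncurry; fun_prop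
      exact this.aestronglyMeasurable
    · have h1 := Measure.quasiMeasurePreserving_fst (μ := volume.restrict (Set.Ioi (0:ℝ))) (ν := ν)
        |>.ae (ae_restrict_mem measurableSet_Ioi)
      have h2 := Measure.quasiMeasurePreserving_snd (μ := volume.restrict (Set.Ioi (0:ℝ))) (ν := ν)
        |>.ae hFb
      filter_upwards [h1, h2] with q hq1 hq2
      have hq1 : 0 < q.1 := hq1
      simp only [Function.uncurry, Real.norm_eq_abs, abs_mul, abs_pow, abs_of_pos hq1, mul_assoc]
      gcongr
      exact hq2 _ hq1
  refine ⟨?_, ?_⟩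
  · have := hInt.integral_prod_left
    simpa [Function.uncurry, integral_const_mul, IntegrableOn] using this
  · rw [← integral_integral_swap hInt]
    simp_rw [integral_const_mul]

theorem exists_sector_angle {α : ℝ} (hα : 0 < α) (hα' : α < 1) :
    ∃ ψ, Real.pi / 2 < ψ ∧ ψ ≤ Real.pi ∧ Real.cos ψ < 0 ∧ 0 < Real.cos (α * ψ) := by
  have hpi := Real.pi_pos
  obtain ⟨ψ, h1, h2⟩ := exists_between (show Real.pi / 2 < min Real.pi (Real.pi / 2 / α) by
    refine lt_min (by linarith) ?_
    rw [lt_div_iff₀ hα]; nlinarith)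
  have h3 := (lt_min_iff.1 h2).1
  have h4 := (lt_div_iff₀ hα).1 (lt_min_iff.1 h2).2
  refine ⟨ψ, h1, h3.le, Real.cos_neg_of_pi_div_two_lt_of_lt h1 (by linarith), ?_⟩
  exact Real.cos_pos_of_mem_Ioo ⟨by nlinarith, by linarith⟩

/-- Moments of the Wright function. -/
theorem wrightFn_moment {α : ℝ} (hα : 0 < α) (hα' : α < 1) (n : ℕ) :
    IntegrableOn (fun θ => θ ^ n * wrightFn α θ) (Set.Ioi 0) ∧
    ∫ θ in Set.Ioi (0:ℝ), θ ^ n * wrightFn α θ = n.factorial / Real.Gamma (α * n + 1) := by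
  obtain ⟨ψ, hψ1, hψ2, hψ3, hψ4⟩ := exists_sector_angle hα hα'
  have hpi := Real.pi_pos
  have hψ0 : 0 < ψ := by linarith
  have hcos : ∀ η ∈ Set.Icc 0 ψ, Real.cos (α * ψ) ≤ Real.cos (α * η) := by
    intro η hη
    refine Real.cos_le_cos_of_nonneg_of_le_pi (by nlinarith [hη.1]) (by nlinarith) ?_
    nlinarith [hη.2]
  have hphase : ∀ θ > 0, ∀ x ≥ 0, ∀ η ∈ Set.Icc 0 ψ, Real.exp (phaseRe α θ α x η) ≤
      Real.exp (-Real.cos (α * ψ) * θ) * sectorBound α 0 α (Real.cos η) x := by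
    intro θ hθ x hx η hη
    unfold sectorBound phaseRe
    rw [← Real.exp_add, Real.exp_le_exp]
    have h1 : 1 ≤ Real.exp (α * x) := Real.one_le_exp (by positivity)
    have h2 : 1 * Real.cos (α * ψ) ≤ Real.exp (α * x) * Real.cos (α * η) := by
      gcongr
      exact hcos η hη
    nlinarith
  have hC : Continuous fun q : ℝ × ℝ => kerCos α q.1 α 0 q.2 := by
    unfold kerCos phaseRe phaseIm; fun_prop
  have hS : Continuous fun q : ℝ × ℝ => kerSin α q.1 α q.2 ψ := by
    unfold kerSin phaseRe phaseIm; fun_prop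
  obtain ⟨iA, eA⟩ := integral_pow_mul_integral (ν := volume.restrict (Set.Ioc 0 ψ))
    (F := fun θ η => kerCos α θ α 0 η) (b := fun _ => Real.exp 1) hψ4 hC
    (by exact integrableOn_const (by simp)) (by
      filter_upwards [ae_restrict_mem measurableSet_Ioc] with η hη θ hθ
      have h := hphase θ hθ 0 le_rfl η ⟨hη.1.le, hη.2⟩
      unfold kerCos
      rw [abs_mul, Real.abs_exp]
      calc _ ≤ Real.exp (phaseRe α θ α 0 η) * 1 := by gcongr; exact Real.abs_cos_le_one _
        _ ≤ Real.exp (-Real.cos (α * ψ) * θ) * sectorBound α 0 α (Real.cos η) 0 := by simpa using h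
        _ ≤ _ := by
          gcongr
          simp [sectorBound, Real.cos_le_one]) n
  obtain ⟨iB, eB⟩ := integral_pow_mul_integral (ν := volume.restrict (Set.Ioi 0))
    (F := fun θ x => kerSin α θ α x ψ) (b := sectorBound α 0 α (Real.cos ψ)) hψ4 hS
    (integrableOn_sectorBound hα' 0 α hψ3 0) (by
      filter_upwards [ae_restrict_mem measurableSet_Ioi] with x hx θ hθ
      have h := hphase θ hθ x (le_of_lt hx) ψ ⟨hψ0.le, le_rfl⟩
      unfold kerSin
      rw [abs_mul, Real.abs_exp]
      calc _ ≤ Real.exp (phaseRe α θ α x ψ) * 1 := by gcongr; exact Real.abs_sin_le_one _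
        _ ≤ _ := by simpa using h) n
  have hw : ∀ θ ∈ Set.Ioi (0:ℝ), θ ^ n * wrightFn α θ =
      (θ ^ n * (∫ η in Set.Ioc 0 ψ, kerCos α θ α 0 η) +
        θ ^ n * ∫ x in Set.Ioi 0, kerSin α θ α x ψ) / Real.pi := by
    intro θ hθ
    have hθ : 0 < θ := hθ
    rw [wrightFn_eq hα hα' hθ.le, ← hankelInt_eq_pi hα' hθ.le hψ1 hψ2, hankelInt,
      intervalIntegral.integral_of_le hψ0.le]
    ring
  have hκ : α - α * ((n:ℝ) + 1) = -(α * n) := by ring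
  refine ⟨IntegrableOn.congr_fun ((iA.add iB).div_const Real.pi) (fun θ hθ => (hw θ hθ).symm)
    measurableSet_Ioi, ?_⟩
  rw [setIntegral_congr_fun measurableSet_Ioi hw, integral_div, integral_add iA iB, eA, eB,
    setIntegral_congr_fun measurableSet_Ioc (fun η hη => integral_pow_mul_kerCos
      (hψ4.trans_le (hcos η ⟨hη.1.le, hη.2⟩)) α n), integral_const_mul,
    setIntegral_congr_fun measurableSet_Ioi (fun x _ => integral_pow_mul_kerSin hψ4 α n),
    integral_const_mul, ← mul_add, ← intervalIntegral.integral_of_le hψ0.le]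
  change n.factorial * hankelInt α 0 (α - α * (n + 1)) ψ / Real.pi = _
  rw [hankelInt_eq_pi hα' le_rfl hψ1 hψ2, hankelInt_zero hα hα', hκ, sub_neg_eq_add, add_comm 1]
  field_simp

theorem pow_mul_exp_le_Gamma {M x : ℝ} (hM : 0 < M) (hx : 0 ≤ x) :
    M ^ x * Real.exp (-M) ≤ Real.Gamma (x + 1) := by
  have hx1 : 0 < x + 1 := by linarith
  rw [Real.Gamma_eq_integral hx1, ← integral_exp_neg_Ioi M, ← integral_const_mul]
  have hi := Real.GammaIntegral_convergent hx1
  have hsub : Set.Ioi M ⊆ Set.Ioi (0:ℝ) := Set.Ioi_subset_Ioi hM.le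
  calc _ ≤ ∫ t in Set.Ioi M, Real.exp (-t) * t ^ (x + 1 - 1) := by
        refine setIntegral_mono_on ?_ (hi.mono_set hsub) measurableSet_Ioi ?_
        · exact (integrableOn_exp_neg_Ioi M).const_mul _
        · intro t ht
          rw [add_sub_cancel_right, mul_comm]
          gcongr
          exact le_of_lt ht
    _ ≤ _ := setIntegral_mono_set hi (by
        filter_upwards [ae_restrict_mem measurableSet_Ioi] with t ht
        have : 0 < t := ht
        positivity) hsub.eventuallyLE

theorem summable_pow_div_Gamma {α s : ℝ} (hα : 0 < α) (hs : 0 ≤ s) :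
    Summable fun n : ℕ => s ^ n / Real.Gamma (α * n + 1) := by
  set M : ℝ := (2 * s + 1) ^ (1 / α) with hM
  have hM0 : 0 < M := by positivity
  have hr : s / (2 * s + 1) < 1 := by rw [div_lt_one (by positivity)]; linarith
  refine Summable.of_nonneg_of_le (fun n => by positivity) (fun n => ?_)
    ((summable_geometric_of_lt_one (by positivity) hr).mul_left (Real.exp M))
  have h := pow_mul_exp_le_Gamma hM0 (show 0 ≤ α * n by positivity)
  have hMn : M ^ (α * n) = (2 * s + 1) ^ n := by
    rw [hM, ← Real.rpow_mul (by positivity), ← Real.rpow_natCast]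
    congr 1; field_simp
  rw [hMn] at h
  calc s ^ n / Real.Gamma (α * n + 1) ≤ s ^ n / ((2 * s + 1) ^ n * Real.exp (-M)) := by gcongr
    _ = _ := by rw [div_pow, Real.exp_neg]; field_simp

/-- Laplace transform of the Wright function, a Mittag-Leffler function. -/
def wrightLaplace (α s : ℝ) : ℝ := ∫ θ in Set.Ioi (0:ℝ), wrightFn α θ * Real.exp (-s * θ)

/-- Laplace transform of `θ φ_α(θ)`. -/
def wrightLaplaceD (α s : ℝ) : ℝ :=
  ∫ θ in Set.Ioi (0:ℝ), θ * wrightFn α θ * Real.exp (-s * θ)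

section
variable {α : ℝ}

theorem integrableOn_wrightFn (hα : 0 < α) (hα' : α < 1) :
    IntegrableOn (wrightFn α) (Set.Ioi 0) := by
  simpa using (wrightFn_moment hα hα' 0).1

theorem integral_wrightFn (hα : 0 < α) (hα' : α < 1) :
    ∫ θ in Set.Ioi (0:ℝ), wrightFn α θ = 1 := by
  simpa using (wrightFn_moment hα hα' 0).2

theorem integrableOn_mul_wrightFn (hα : 0 < α) (hα' : α < 1) :
    IntegrableOn (fun θ => θ * wrightFn α θ) (Set.Ioi 0) := by
  simpa using (wrightFn_moment hα hα' 1).1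

theorem integrableOn_wrightFn_mul_exp (hα : 0 < α) (hα' : α < 1) {s : ℝ} (hs : 0 ≤ s) :
    IntegrableOn (fun θ => wrightFn α θ * Real.exp (-s * θ)) (Set.Ioi 0) := by
  refine (integrableOn_wrightFn hα hα').mul_bdd (c := 1) (by fun_prop) ?_
  filter_upwards [ae_restrict_mem measurableSet_Ioi] with θ hθ
  have : 0 < θ := hθ
  rw [Real.norm_eq_abs, Real.abs_exp, Real.exp_le_one_iff]
  nlinarith

theorem integrableOn_mul_wrightFn_mul_exp (hα : 0 < α) (hα' : α < 1) {s : ℝ} (hs : 0 ≤ s) :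
    IntegrableOn (fun θ => θ * wrightFn α θ * Real.exp (-s * θ)) (Set.Ioi 0) := by
  refine (integrableOn_mul_wrightFn hα hα').mul_bdd (c := 1) (by fun_prop) ?_
  filter_upwards [ae_restrict_mem measurableSet_Ioi] with θ hθ
  have : 0 < θ := hθ
  rw [Real.norm_eq_abs, Real.abs_exp, Real.exp_le_one_iff]
  nlinarith

theorem wrightLaplace_zero (hα : 0 < α) (hα' : α < 1) : wrightLaplace α 0 = 1 := by
  simpa [wrightLaplace] using integral_wrightFn hα hα'

theorem wrightLaplace_pos (hα : 0 < α) (hα' : α < 1) {s : ℝ} (hs : 0 ≤ s) :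
    0 < wrightLaplace α s := by
  have hnn : 0 ≤ᵐ[volume.restrict (Set.Ioi 0)] fun θ => wrightFn α θ * Real.exp (-s * θ) := by
    filter_upwards [ae_restrict_mem measurableSet_Ioi] with θ hθ
    exact mul_nonneg (wrightFn_nonneg hα hα' hθ) (Real.exp_pos _).le
  refine lt_of_le_of_ne (integral_nonneg_of_ae hnn) fun h => ?_
  have h0 := (integral_eq_zero_iff_of_nonneg_ae hnn
    (integrableOn_wrightFn_mul_exp hα hα' hs)).1 h.symm
  have h1 : wrightFn α =ᵐ[volume.restrict (Set.Ioi 0)] 0 := by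
    filter_upwards [h0] with θ hθ
    simpa [(Real.exp_pos _).ne'] using hθ
  have h2 := integral_wrightFn hα hα'
  rw [integral_congr_ae h1] at h2
  simp at h2

theorem wrightLaplaceD_nonneg (hα : 0 < α) (hα' : α < 1) (s : ℝ) : 0 ≤ wrightLaplaceD α s := by
  refine setIntegral_nonneg measurableSet_Ioi fun θ hθ => ?_
  have : 0 < θ := hθ
  exact mul_nonneg (mul_nonneg this.le (wrightFn_nonneg hα hα' hθ)) (Real.exp_pos _).le

theorem continuousOn_wrightLaplace (hα : 0 < α) (hα' : α < 1) :
    ContinuousOn (wrightLaplace α) (Set.Ici 0) := by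
  refine continuousOn_of_dominated (bound := fun θ => |wrightFn α θ|)
    (fun s hs => (integrableOn_wrightFn_mul_exp hα hα' hs).1) (fun s hs => ?_)
    (integrableOn_wrightFn hα hα').abs ?_
  · filter_upwards [ae_restrict_mem measurableSet_Ioi] with θ hθ
    have : 0 < θ := hθ
    have hs : 0 ≤ s := hs
    rw [norm_mul, Real.norm_eq_abs, Real.norm_eq_abs, Real.abs_exp]
    refine mul_le_of_le_one_right (abs_nonneg _) (Real.exp_le_one_iff.2 ?_)
    nlinarith
  · filter_upwards with θ
    fun_prop

theorem hasDerivAt_wrightLaplace (hα : 0 < α) (hα' : α < 1) {s : ℝ} (hs : 0 < s) :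
    HasDerivAt (wrightLaplace α) (-wrightLaplaceD α s) s := by
  have h := hasDerivAt_integral_of_dominated_loc_of_deriv_le (μ := volume.restrict (Set.Ioi (0:ℝ)))
    (F := fun s θ => wrightFn α θ * Real.exp (-s * θ))
    (F' := fun s θ => -(θ * wrightFn α θ * Real.exp (-s * θ))) (x₀ := s)
    (s := Set.Ioi 0) (bound := fun θ => |θ * wrightFn α θ|) (Ioi_mem_nhds hs) (by
      filter_upwards [Ioi_mem_nhds hs] with r hr
      exact (integrableOn_wrightFn_mul_exp hα hα' (le_of_lt hr)).1)
    (integrableOn_wrightFn_mul_exp hα hα' hs.le)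
    (integrableOn_mul_wrightFn_mul_exp hα hα' hs.le).1.neg (by
      filter_upwards [ae_restrict_mem measurableSet_Ioi] with θ hθ r hr
      have : 0 < θ := hθ
      have hr : 0 < r := hr
      rw [norm_neg, norm_mul, Real.norm_eq_abs, Real.norm_eq_abs, Real.abs_exp]
      refine mul_le_of_le_one_right (abs_nonneg _) (Real.exp_le_one_iff.2 ?_)
      nlinarith)
    (integrableOn_mul_wrightFn hα hα').abs (by
      filter_upwards with θ r hr
      have h1 : HasDerivAt (fun r : ℝ => -r * θ) (-1 * θ) r := ((hasDerivAt_id r).neg).mul_const θ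
      convert! h1.exp.const_mul (wrightFn α θ) using 1
      ring)
  rw [wrightLaplaceD, ← integral_neg]
  exact h.2

theorem hasSum_wrightLaplace (hα : 0 < α) (hα' : α < 1) {s : ℝ} (hs : 0 ≤ s) :
    HasSum (fun n : ℕ => (-s) ^ n / Real.Gamma (α * n + 1)) (wrightLaplace α s) := by
  have hF : ∀ n : ℕ, ∀ θ : ℝ, wrightFn α θ * ((-s * θ) ^ n / n.factorial) =
      (-s) ^ n / n.factorial * (θ ^ n * wrightFn α θ) := by
    intro n θ; rw [mul_pow]; ring
  have h := hasSum_integral_of_summable_integral_norm (μ := volume.restrict (Set.Ioi (0:ℝ)))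
    (F := fun (n : ℕ) θ => wrightFn α θ * ((-s * θ) ^ n / n.factorial)) (fun n => by
      simp_rw [hF]
      exact (wrightFn_moment hα hα' n).1.const_mul _) (by
      convert! summable_pow_div_Gamma hα hs using 2 with n
      rw [setIntegral_congr_fun (g := fun θ => s ^ n / n.factorial * (θ ^ n * wrightFn α θ))
        measurableSet_Ioi, integral_const_mul, (wrightFn_moment hα hα' n).2]
      · field_simp
      · intro θ hθ
        have hθ : 0 < θ := hθ
        simp only [hF, norm_mul, norm_div, norm_pow, norm_neg, Real.norm_of_nonneg hs,
          Real.norm_of_nonneg hθ.le, Real.norm_of_nonneg (wrightFn_nonneg hα hα' hθ)]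
        simp)
  convert! h using 1
  · funext n
    simp_rw [hF]
    rw [integral_const_mul, (wrightFn_moment hα hα' n).2]
    field_simp
  · refine integral_congr_ae ?_
    filter_upwards with θ
    rw [tsum_mul_left, Real.exp_eq_exp_ℝ, NormedSpace.exp_eq_tsum_div]

theorem intervalIntegrable_rpow_mul_sub_rpow {β : ℝ} (hβ : 0 < β) {s : ℝ} (hs : 0 ≤ s) (a : ℝ) :
    IntervalIntegrable (fun r : ℝ => r ^ s * (a - r) ^ (β - 1)) volume 0 a := by
  have h1 : IntervalIntegrable (fun r : ℝ => r ^ (β - 1)) volume 0 a :=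
    intervalIntegral.intervalIntegrable_rpow' (by linarith)
  have h2 := (h1.comp_sub_left a).symm
  simp only [sub_zero, sub_self] at h2
  refine h2.continuousOn_mul (Continuous.continuousOn ?_)
  exact Real.continuous_rpow_const hs

theorem integral_rpow_mul_sub_rpow {β : ℝ} (hβ : 0 < β) {s : ℝ} (hs : 0 ≤ s) {a : ℝ} (ha : 0 < a) :
    ∫ r in (0:ℝ)..a, r ^ s * (a - r) ^ (β - 1) =
      a ^ (s + β) * (Real.Gamma (s + 1) * Real.Gamma β / Real.Gamma (s + 1 + β)) := by
  have h := Complex.betaIntegral_scaled ((s + 1 : ℝ) : ℂ) ((β : ℝ) : ℂ) ha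
  rw [Complex.betaIntegral_eq_Gamma_mul_div _ _ (by simp; linarith) (by simpa using hβ),
    ← Complex.ofReal_add, Complex.Gamma_ofReal, Complex.Gamma_ofReal, Complex.Gamma_ofReal,
    show ((s + 1 + β : ℝ) : ℂ) - 1 = ((s + β : ℝ) : ℂ) by push_cast; ring,
    ← Complex.ofReal_cpow ha.le] at h
  rw [← Complex.ofReal_inj, ← intervalIntegral.integral_ofReal]
  push_cast
  push_cast at h
  rw [← h]
  refine intervalIntegral.integral_congr fun r hr => ?_
  rw [Set.uIcc_of_le ha.le] at hr
  have e1 : ((a:ℂ) - r) = ((a - r : ℝ) : ℂ) := by push_cast; rfl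
  simp only [e1, add_sub_cancel_right]
  rw [Complex.ofReal_cpow hr.1, Complex.ofReal_cpow (by linarith [hr.2])]
  push_cast; rfl

/-- `K(t) = E(t^α)` solves the Volterra equation `1 - K = J^α K`. -/
theorem integral_wrightLaplace_mul (hα : 0 < α) (hα' : α < 1) {a : ℝ} (ha : 0 < a) :
    IntervalIntegrable (fun r => wrightLaplace α (r ^ α) * (a - r) ^ (α - 1)) volume 0 a ∧
    ∫ r in (0:ℝ)..a, wrightLaplace α (r ^ α) * (a - r) ^ (α - 1) =
      Real.Gamma α * (1 - wrightLaplace α (a ^ α)) := by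
  have hnn : 0 ≤ a ^ α := by positivity
  have hΓ : ∀ n : ℕ, α * n + 1 + α = α * ((n + 1 : ℕ) : ℝ) + 1 := by intro n; push_cast; ring
  have hpow : ∀ n : ℕ, a ^ (α * n + α) = (a ^ α) ^ (n + 1) := by
    intro n
    rw [← Real.rpow_natCast, ← Real.rpow_mul ha.le]; push_cast; ring_nf
  have hterm : ∀ n : ℕ, ∫ r in Set.Ioc 0 a, r ^ (α * n) * (a - r) ^ (α - 1) =
      Real.Gamma α * Real.Gamma (α * n + 1) * ((a ^ α) ^ (n + 1) / Real.Gamma (α * ((n + 1 : ℕ) : ℝ) + 1)) := by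
    intro n
    rw [← intervalIntegral.integral_of_le ha.le,
      integral_rpow_mul_sub_rpow hα (by positivity) ha, hpow, hΓ]
    ring
  have hInt : ∀ n : ℕ, IntegrableOn (fun r : ℝ => r ^ (α * n) * (a - r) ^ (α - 1)) (Set.Ioc 0 a) := by
    intro n
    exact (intervalIntegrable_iff_integrableOn_Ioc_of_le ha.le).1
      (intervalIntegrable_rpow_mul_sub_rpow hα (by positivity) a)
  have hK : ∀ r ∈ Set.Ioc 0 a, HasSum (fun n : ℕ => (-1) ^ n / Real.Gamma (α * n + 1) *
      (r ^ (α * n) * (a - r) ^ (α - 1))) (wrightLaplace α (r ^ α) * (a - r) ^ (α - 1)) := by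
    intro r hr
    have := (hasSum_wrightLaplace hα hα' (s := r ^ α) (Real.rpow_nonneg hr.1.le _)).mul_right
      ((a - r) ^ (α - 1))
    convert! this using 2 with n
    rw [neg_pow (r ^ α), ← Real.rpow_natCast (r ^ α), ← Real.rpow_mul hr.1.le]
    ring
  have h := hasSum_integral_of_summable_integral_norm (μ := volume.restrict (Set.Ioc 0 a))
    (F := fun (n : ℕ) (r : ℝ) => (-1) ^ n / Real.Gamma (α * n + 1) *
      (r ^ (α * n) * (a - r) ^ (α - 1))) (fun n => (hInt n).const_mul _) (by
      have := ((summable_nat_add_iff 1).2 (summable_pow_div_Gamma hα hnn)).mul_left (Real.Gamma α)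
      convert! this using 2 with n
      have hG : 0 < Real.Gamma (α * n + 1) := by positivity
      rw [setIntegral_congr_fun (g := fun r => 1 / Real.Gamma (α * n + 1) *
        (r ^ (α * n) * (a - r) ^ (α - 1))) measurableSet_Ioc, integral_const_mul, hterm]
      · field_simp
      · intro r hr
        have h1 : 0 ≤ r ^ (α * n) := Real.rpow_nonneg hr.1.le _
        have h2 : 0 ≤ (a - r) ^ (α - 1) := Real.rpow_nonneg (by linarith [hr.2]) _
        simp only [norm_mul, norm_div, norm_pow, norm_neg, norm_one, one_pow,
          Real.norm_of_nonneg h1, Real.norm_of_nonneg h2, Real.norm_of_nonneg hG.le])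
  constructor
  · have h2 := intervalIntegrable_rpow_mul_sub_rpow hα le_rfl a
    simp only [Real.rpow_zero, one_mul] at h2
    refine h2.continuousOn_mul ?_
    refine (continuousOn_wrightLaplace hα hα').comp
      (Real.continuous_rpow_const hα.le).continuousOn ?_
    intro r hr
    rw [Set.uIcc_of_le ha.le] at hr
    exact Real.rpow_nonneg hr.1 _
  · rw [intervalIntegral.integral_of_le ha.le,
      setIntegral_congr_fun measurableSet_Ioc (fun r hr => (hK r hr).tsum_eq.symm)]
    refine h.unique ?_
    have h3 := ((hasSum_nat_add_iff' 1).2 (hasSum_wrightLaplace hα hα' hnn)).mul_left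
      (-Real.Gamma α)
    convert! h3 using 1
    · funext n
      rw [integral_const_mul, hterm]
      have hG : 0 < Real.Gamma (α * n + 1) := by positivity
      rw [neg_pow (a ^ α), pow_succ (-1 : ℝ)]
      field_simp
    · simp; ring

end

section
variable (N : ℕ)

theorem integral_gaussian_euc {b : ℝ} (hb : 0 < b) :
    ∫ z : Euc N, Real.exp (-b * ‖z‖ ^ 2) = (Real.pi / b) ^ ((N : ℝ) / 2) := by
  simpa using GaussianFourier.integral_rexp_neg_mul_sq_norm (V := Euc N) hb

theorem integrable_gaussian_euc {b : ℝ} (hb : 0 < b) :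
    Integrable fun z : Euc N => Real.exp (-b * ‖z‖ ^ 2) := by
  by_contra h
  have h1 := integral_undef h
  rw [integral_gaussian_euc N hb] at h1
  have : 0 < (Real.pi / b) ^ ((N : ℝ) / 2) := by positivity
  linarith

theorem gaussian_sq_le (b h r : ℝ) :
    h * (r ^ 2 * Real.exp (-b * r ^ 2)) ≤ Real.exp (-(b - h) * r ^ 2) - Real.exp (-b * r ^ 2) := by
  have h1 : Real.exp (-(b - h) * r ^ 2) = Real.exp (-b * r ^ 2) * Real.exp (h * r ^ 2) := by
    rw [← Real.exp_add]; ring_nf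
  have h2 := Real.add_one_le_exp (h * r ^ 2)
  have h3 := Real.exp_pos (-b * r ^ 2)
  rw [h1]
  nlinarith

theorem integrable_sq_mul_gaussian {b : ℝ} (hb : 0 < b) :
    Integrable fun z : Euc N => ‖z‖ ^ 2 * Real.exp (-b * ‖z‖ ^ 2) := by
  have hd : Integrable fun z : Euc N => (2 / b) * (Real.exp (-(b - b / 2) * ‖z‖ ^ 2) -
      Real.exp (-b * ‖z‖ ^ 2)) :=
    ((integrable_gaussian_euc N (by linarith)).sub (integrable_gaussian_euc N hb)).const_mul _
  refine hd.mono' (by fun_prop) ?_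
  filter_upwards with z
  have h := gaussian_sq_le b (b / 2) ‖z‖
  rw [Real.norm_of_nonneg (by positivity), div_mul_eq_mul_div, le_div_iff₀ hb]
  linarith

theorem integral_sq_mul_gaussian_le {b : ℝ} (hb : 0 < b) :
    ∫ z : Euc N, ‖z‖ ^ 2 * Real.exp (-b * ‖z‖ ^ 2) ≤
      (N : ℝ) / (2 * b) * (Real.pi / b) ^ ((N : ℝ) / 2) := by
  have hder : HasDerivAt (fun c : ℝ => (Real.pi / c) ^ ((N : ℝ) / 2))
      (-((N : ℝ) / (2 * b) * (Real.pi / b) ^ ((N : ℝ) / 2))) b := by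
    have h1 : HasDerivAt (fun c : ℝ => Real.pi / c) (-Real.pi / b ^ 2) b := by
      have := (hasDerivAt_inv hb.ne').const_mul Real.pi
      simpa [div_eq_mul_inv] using this
    have h2 := h1.rpow_const (p := (N : ℝ) / 2) (Or.inl (by positivity))
    convert! h2 using 1
    rw [Real.rpow_sub_one (by positivity)]
    field_simp
  have hslope := hder.tendsto_slope.mono_left (nhdsWithin_mono b
    (fun x (hx : x ∈ Set.Iio b) => (Set.mem_Iio.1 hx).ne))
  have hb' := hslope.neg
  rw [neg_neg] at hb'
  refine ge_of_tendsto hb' ?_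
  filter_upwards [self_mem_nhdsWithin, mem_nhdsWithin_of_mem_nhds (Ioi_mem_nhds hb)] with c hc hc0
  have hc : c < b := hc
  have hc0 : 0 < c := hc0
  have hle : (b - c) * ∫ z : Euc N, ‖z‖ ^ 2 * Real.exp (-b * ‖z‖ ^ 2) ≤
      (Real.pi / c) ^ ((N : ℝ) / 2) - (Real.pi / b) ^ ((N : ℝ) / 2) := by
    rw [← integral_gaussian_euc N hb, ← integral_gaussian_euc N hc0,
      ← integral_sub (integrable_gaussian_euc N hc0) (integrable_gaussian_euc N hb),
      ← integral_const_mul]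
    refine integral_mono ((integrable_sq_mul_gaussian N hb).const_mul _)
      ((integrable_gaussian_euc N hc0).sub (integrable_gaussian_euc N hb)) fun z => ?_
    have := gaussian_sq_le b (b - c) ‖z‖
    rwa [sub_sub_cancel] at this
  rw [slope_def_field, ← div_neg, neg_sub, le_div_iff₀ (by linarith)]
  linarith

theorem heatKernel_eq {s : ℝ} (hs : 0 < s) (z : Euc N) :
    heatKernel N s z = (Real.pi / (1 / (4 * s))) ^ (-((N : ℝ) / 2)) *
      Real.exp (-(1 / (4 * s)) * ‖z‖ ^ 2) := by
  unfold heatKernel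
  congr 2
  · field_simp
  · ring
  · field_simp

theorem heatKernel_nonneg {s : ℝ} (hs : 0 ≤ s) (z : Euc N) : 0 ≤ heatKernel N s z := by
  unfold heatKernel; positivity

theorem heatKernel_neg (s : ℝ) (z : Euc N) : heatKernel N s (-z) = heatKernel N s z := by
  simp [heatKernel]

theorem integrable_heatKernel {s : ℝ} (hs : 0 < s) : Integrable (heatKernel N s) := by
  have := (integrable_gaussian_euc N (b := 1 / (4 * s)) (by positivity)).const_mul
    ((Real.pi / (1 / (4 * s))) ^ (-((N : ℝ) / 2)))
  exact this.congr (by filter_upwards with z using (heatKernel_eq N hs z).symm)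

theorem integral_heatKernel {s : ℝ} (hs : 0 < s) : ∫ z, heatKernel N s z = 1 := by
  simp_rw [heatKernel_eq N hs]
  rw [integral_const_mul, integral_gaussian_euc N (by positivity), ← Real.rpow_add (by positivity)]
  simp

theorem integrable_heatKernel_mul_sq {s : ℝ} (hs : 0 < s) :
    Integrable fun z => heatKernel N s z * ‖z‖ ^ 2 := by
  have := (integrable_sq_mul_gaussian N (b := 1 / (4 * s)) (by positivity)).const_mul
    ((Real.pi / (1 / (4 * s))) ^ (-((N : ℝ) / 2)))
  refine this.congr ?_
  filter_upwards with z
  rw [heatKernel_eq N hs z]; ring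

theorem integral_heatKernel_mul_sq_le {s : ℝ} (hs : 0 < s) :
    ∫ z, heatKernel N s z * ‖z‖ ^ 2 ≤ 2 * N * s := by
  have e : ∀ z : Euc N, heatKernel N s z * ‖z‖ ^ 2 = (Real.pi / (1 / (4 * s))) ^ (-((N : ℝ) / 2)) *
      (‖z‖ ^ 2 * Real.exp (-(1 / (4 * s)) * ‖z‖ ^ 2)) := by
    intro z; rw [heatKernel_eq N hs z]; ring
  simp_rw [e]
  rw [integral_const_mul]
  calc _ ≤ (Real.pi / (1 / (4 * s))) ^ (-((N : ℝ) / 2)) *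
        ((N : ℝ) / (2 * (1 / (4 * s))) * (Real.pi / (1 / (4 * s))) ^ ((N : ℝ) / 2)) := by
        gcongr
        exact integral_sq_mul_gaussian_le N (by positivity)
    _ = (N : ℝ) / (2 * (1 / (4 * s))) := by
        rw [Real.rpow_neg (by positivity)]
        field_simp
    _ = _ := by field_simp; ring

theorem integrable_heatKernel_mul_inner {s : ℝ} (hs : 0 < s) (x : Euc N) :
    Integrable fun z => heatKernel N s z * inner ℝ x z := by
  have hd := ((integrable_heatKernel N hs).add (integrable_heatKernel_mul_sq N hs)).const_mul ‖x‖
  refine hd.mono' ?_ ?_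
  · exact (integrable_heatKernel N hs).1.mul (by fun_prop)
  · filter_upwards with z
    have h0 := heatKernel_nonneg N hs.le z
    rw [norm_mul, Real.norm_of_nonneg h0]
    calc _ ≤ heatKernel N s z * (‖x‖ * ‖z‖) := by gcongr; exact norm_inner_le_norm x z
      _ ≤ heatKernel N s z * (‖x‖ * (1 + ‖z‖ ^ 2)) := by gcongr; nlinarith [sq_nonneg (‖z‖ - 1)]
      _ = _ := by simp only [Pi.add_apply]; ring

theorem integral_heatKernel_mul_inner (s : ℝ) (x : Euc N) :
    ∫ z, heatKernel N s z * inner ℝ x z = 0 := by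
  have h := integral_neg_eq_self (fun z => heatKernel N s z * inner ℝ x z) volume
  simp only [heatKernel_neg, inner_neg_right, mul_neg, integral_neg] at h
  linarith

/-- The profile `e^{-√(N²+|x|²)}`. -/
def expProfile (x : Euc N) : ℝ := Real.exp (-Real.sqrt ((N : ℝ) ^ 2 + ‖x‖ ^ 2))

theorem continuous_expProfile : Continuous (expProfile N) := by
  unfold expProfile; fun_prop

theorem expProfile_pos (x : Euc N) : 0 < expProfile N x := Real.exp_pos _

theorem expProfile_le_one (x : Euc N) : expProfile N x ≤ 1 :=
  Real.exp_le_one_iff.2 (neg_nonpos.2 (Real.sqrt_nonneg _))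

theorem integrable_expProfile : Integrable (expProfile N) := by
  have hd := (integrable_one_add_norm (E := Euc N) (μ := volume) (r := N + 1) (by simp)).const_mul
    (Real.exp 1 * (N + 1).factorial)
  refine hd.mono' (continuous_expProfile N).aestronglyMeasurable ?_
  filter_upwards with x
  rw [Real.norm_of_nonneg (expProfile_pos N x).le]
  have h1 : expProfile N x ≤ Real.exp (-‖x‖) := by
    refine Real.exp_le_exp.2 (neg_le_neg (Real.le_sqrt_of_sq_le ?_))
    nlinarith [sq_nonneg (N : ℝ)]
  have h2 := Real.pow_div_factorial_le_exp (1 + ‖x‖) (by positivity) (N + 1)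
  rw [div_le_iff₀ (by positivity), Real.exp_add] at h2
  refine h1.trans ?_
  have e : (1 + ‖x‖) ^ (-((N : ℝ) + 1)) = ((1 + ‖x‖) ^ (N + 1))⁻¹ := by
    rw [Real.rpow_neg (by positivity)]
    congr 1
    exact_mod_cast Real.rpow_natCast (1 + ‖x‖) (N + 1)
  rw [e, Real.exp_neg, ← div_eq_mul_inv, inv_le_comm₀ (by positivity) (by positivity), inv_div,
    div_le_iff₀ (by positivity)]
  linarith

theorem expProfile_sub_ge {s : ℝ} (x z : Euc N) :
    expProfile N x * Real.exp (-s) *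
      (1 + s - (‖z‖ ^ 2 - 2 * inner ℝ x z) / (2 * Real.sqrt ((N : ℝ) ^ 2 + ‖x‖ ^ 2))) ≤
      expProfile N (x - z) := by
  set ρ : Euc N → ℝ := fun y => Real.sqrt ((N : ℝ) ^ 2 + ‖y‖ ^ 2) with hρ
  have hρ0 : ∀ y, 0 ≤ ρ y := fun y => Real.sqrt_nonneg _
  have hsq : ∀ y, ρ y ^ 2 = (N : ℝ) ^ 2 + ‖y‖ ^ 2 := fun y => Real.sq_sqrt (by positivity)
  have hn : ‖x - z‖ ^ 2 = ‖x‖ ^ 2 - 2 * inner ℝ x z + ‖z‖ ^ 2 := norm_sub_sq_real x z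
  have hk : ρ (x - z) - ρ x ≤ (‖z‖ ^ 2 - 2 * inner ℝ x z) / (2 * ρ x) := by
    rcases (hρ0 x).eq_or_lt with h | h
    · have h1 := hsq x
      rw [← h] at h1
      have hN : (N : ℝ) = 0 := by nlinarith [sq_nonneg (N : ℝ), sq_nonneg ‖x‖]
      have hN' : N = 0 := by exact_mod_cast hN
      subst hN'
      rw [Subsingleton.elim (x - z) x, Subsingleton.elim z 0]
      simp
    · rw [le_div_iff₀ (by positivity)]
      nlinarith [hsq x, hsq (x - z), sq_nonneg (ρ (x - z) - ρ x)]
  have h1 : expProfile N (x - z) = expProfile N x * Real.exp (-s) *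
      Real.exp (s + ρ x - ρ (x - z)) := by
    unfold expProfile
    rw [← Real.exp_add, ← Real.exp_add]
    congr 1
    simp only [hρ]; ring
  rw [h1]
  have h2 := Real.add_one_le_exp (s + ρ x - ρ (x - z))
  have h3 : 0 < expProfile N x * Real.exp (-s) := mul_pos (expProfile_pos N x) (Real.exp_pos _)
  refine mul_le_mul_of_nonneg_left ?_ h3.le
  linarith

/-- `T(s)χ ≥ e^{-s}χ`. -/
theorem heatOp_expProfile_ge {s : ℝ} (hs : 0 < s) (x : Euc N) :
    Real.exp (-s) * expProfile N x ≤ heatOp N s (expProfile N) x := by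
  set ρ := Real.sqrt ((N : ℝ) ^ 2 + ‖x‖ ^ 2) with hρ
  have e1 : heatOp N s (expProfile N) x = ∫ z, heatKernel N s z * expProfile N (x - z) := by
    unfold heatOp
    rw [← integral_sub_left_eq_self (fun y => heatKernel N s (x - y) * expProfile N y) volume x]
    simp
  have hNρ : (N : ℝ) / ρ ≤ 1 := by
    refine div_le_one_of_le₀ (Real.le_sqrt_of_sq_le ?_) (Real.sqrt_nonneg _)
    nlinarith [sq_nonneg ‖x‖]
  have hi1 := (integrable_heatKernel N hs).const_mul (1 + s)
  have hi2 : Integrable fun z => (heatKernel N s z * ‖z‖ ^ 2 -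
      2 * (heatKernel N s z * inner ℝ x z)) / (2 * ρ) := ((integrable_heatKernel_mul_sq N hs).sub
    ((integrable_heatKernel_mul_inner N hs x).const_mul 2)).div_const (2 * ρ)
  have hi := (hi1.sub hi2).const_mul (expProfile N x * Real.exp (-s))
  have hval : ∫ z, expProfile N x * Real.exp (-s) * ((1 + s) * heatKernel N s z -
      (heatKernel N s z * ‖z‖ ^ 2 - 2 * (heatKernel N s z * inner ℝ x z)) / (2 * ρ)) =
      expProfile N x * Real.exp (-s) * ((1 + s) -
        (∫ z, heatKernel N s z * ‖z‖ ^ 2) / (2 * ρ)) := by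
    rw [integral_const_mul, integral_sub hi1 hi2, integral_const_mul, integral_heatKernel N hs,
      integral_div, integral_sub (integrable_heatKernel_mul_sq N hs)
      ((integrable_heatKernel_mul_inner N hs x).const_mul 2), integral_const_mul,
      integral_heatKernel_mul_inner]
    ring
  have hpos := expProfile_pos N x
  calc Real.exp (-s) * expProfile N x
      ≤ expProfile N x * Real.exp (-s) * ((1 + s) -
        (∫ z, heatKernel N s z * ‖z‖ ^ 2) / (2 * ρ)) := by
        have h1 : (∫ z, heatKernel N s z * ‖z‖ ^ 2) / (2 * ρ) ≤ s := by
          calc _ ≤ 2 * N * s / (2 * ρ) := by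
                gcongr; exact integral_heatKernel_mul_sq_le N hs
            _ = N / ρ * s := by rw [mul_assoc, mul_div_mul_left _ _ two_ne_zero]; ring
            _ ≤ 1 * s := by gcongr
            _ = s := one_mul s
        have h2 : 0 < expProfile N x * Real.exp (-s) := mul_pos hpos (Real.exp_pos _)
        nlinarith
    _ = _ := hval.symm
    _ ≤ ∫ z, heatKernel N s z * expProfile N (x - z) := by
        refine integral_mono hi ?_ fun z => ?_
        · refine (integrable_heatKernel N hs).mul_bdd (c := 1)
            ((continuous_expProfile N).comp (by fun_prop)).aestronglyMeasurable ?_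
          filter_upwards with z
          rw [Real.norm_of_nonneg (expProfile_pos N _).le]
          exact expProfile_le_one N _
        · have h := mul_le_mul_of_nonneg_left (expProfile_sub_ge N (s := s) x z)
            (heatKernel_nonneg N hs.le z)
          refine le_trans (le_of_eq ?_) h
          ring
    _ = _ := e1.symm

end

section
variable (N : ℕ)

theorem chiFn_eq (x : Euc N) : chiFn N x = (∫ y, expProfile N y)⁻¹ * expProfile N x := rfl

theorem integral_expProfile_pos : 0 < ∫ y, expProfile N y :=
  integral_pos_of_integrable_nonneg_nonzero (x := 0) (continuous_expProfile N)
    (integrable_expProfile N) (fun x => (expProfile_pos N x).le) (expProfile_pos N 0).ne'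

theorem chiFn_pos (x : Euc N) : 0 < chiFn N x :=
  mul_pos (inv_pos.2 (integral_expProfile_pos N)) (expProfile_pos N x)

theorem continuous_chiFn : Continuous (chiFn N) :=
  continuous_const.mul (continuous_expProfile N)

theorem integrable_chiFn : Integrable (chiFn N) := (integrable_expProfile N).const_mul _

theorem integral_chiFn : ∫ x, chiFn N x = 1 := by
  simp_rw [chiFn_eq]
  rw [integral_const_mul, inv_mul_cancel₀ (integral_expProfile_pos N).ne']

theorem measurable_ofReal_chiFn : Measurable fun x => ENNReal.ofReal (chiFn N x) :=
  (continuous_chiFn N).measurable.ennreal_ofReal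

theorem heatOp_chiFn_ge {s : ℝ} (hs : 0 < s) (x : Euc N) :
    Real.exp (-s) * chiFn N x ≤ heatOp N s (chiFn N) x := by
  have h := mul_le_mul_of_nonneg_left (heatOp_expProfile_ge N hs x)
    (inv_pos.2 (integral_expProfile_pos N)).le
  refine le_of_eq_of_le (by rw [chiFn_eq]; ring) (h.trans_eq ?_)
  unfold heatOp
  rw [← integral_const_mul]
  congr 1
  funext y
  rw [chiFn_eq]; ring

/-- The probability measure with density `χ`. -/
def chiMeas : Measure (Euc N) := volume.withDensity fun x => ENNReal.ofReal (chiFn N x)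

instance : IsProbabilityMeasure (chiMeas N) := ⟨by
  rw [chiMeas, withDensity_apply _ MeasurableSet.univ, Measure.restrict_univ,
    ← ofReal_integral_eq_lintegral_ofReal (integrable_chiFn N)
      (Eventually.of_forall fun x => (chiFn_pos N x).le), integral_chiFn, ENNReal.ofReal_one]⟩

theorem integral_chiMeas (w : Euc N → ℝ) : ∫ x, w x ∂(chiMeas N) = ∫ x, w x * chiFn N x := by
  rw [chiMeas, integral_withDensity_eq_integral_toReal_smul (measurable_ofReal_chiFn N)
    (by filter_upwards with x using ENNReal.ofReal_lt_top)]
  congr 1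
  funext x
  rw [ENNReal.toReal_ofReal (chiFn_pos N x).le, smul_eq_mul, mul_comm]

theorem lintegral_chiMeas {W : Euc N → ENNReal} (hW : Measurable W) :
    ∫⁻ x, W x ∂(chiMeas N) = ∫⁻ x, ENNReal.ofReal (chiFn N x) * W x := by
  rw [chiMeas, lintegral_withDensity_eq_lintegral_mul _ (measurable_ofReal_chiFn N) hW]
  rfl

theorem measurable_heatKernel : Measurable fun q : ℝ × Euc N => heatKernel N q.1 q.2 := by
  unfold heatKernel; fun_prop

/-- The heat semigroup on `[0,∞]`-valued functions. -/
def heatL (s : ℝ) (W : Euc N → ENNReal) (x : Euc N) : ENNReal :=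
  ∫⁻ y, ENNReal.ofReal (heatKernel N s (x - y)) * W y

theorem measurable_heatL {Y : Type*} [MeasurableSpace Y] {s : Y → ℝ} {W : Y → Euc N → ENNReal}
    {x : Y → Euc N} (hs : Measurable s) (hW : Measurable fun q : Y × Euc N => W q.1 q.2)
    (hx : Measurable x) : Measurable fun q => heatL N (s q) (W q) (x q) := by
  unfold heatL
  refine Measurable.lintegral_prod_right' (f := fun r : Y × Euc N =>
    ENNReal.ofReal (heatKernel N (s r.1) (x r.1 - r.2)) * W r.1 r.2) ?_
  refine Measurable.mul ?_ hW
  exact ((measurable_heatKernel N).comp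
      ((hs.comp measurable_fst).prodMk (by fun_prop))).ennreal_ofReal

theorem measurable_heatL_const (s : ℝ) {W : Euc N → ENNReal} (hW : Measurable W) :
    Measurable fun x => heatL N s W x :=
  measurable_heatL N (Y := Euc N) (s := fun _ => s) (W := fun _ => W) (x := fun x => x)
    measurable_const (hW.comp measurable_snd) measurable_id

theorem lintegral_heatKernel {s : ℝ} (hs : 0 < s) (x : Euc N) :
    ∫⁻ y, ENNReal.ofReal (heatKernel N s (x - y)) = 1 := by
  rw [lintegral_sub_left_eq_self (fun y => ENNReal.ofReal (heatKernel N s y)) x,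
    ← ofReal_integral_eq_lintegral_ofReal (integrable_heatKernel N hs)
      (Eventually.of_forall fun z => heatKernel_nonneg N hs.le z),
    integral_heatKernel N hs, ENNReal.ofReal_one]

theorem heatL_le {s : ℝ} (hs : 0 < s) {W : Euc N → ENNReal} {M : ENNReal} (hM : ∀ y, W y ≤ M)
    (x : Euc N) : heatL N s W x ≤ M := by
  have hk : Measurable fun y => ENNReal.ofReal (heatKernel N s (x - y)) :=
    ((measurable_heatKernel N).comp (by fun_prop :
      Measurable fun y : Euc N => (s, x - y))).ennreal_ofReal
  calc heatL N s W x ≤ ∫⁻ y, ENNReal.ofReal (heatKernel N s (x - y)) * M := by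
        unfold heatL; gcongr with y; exact hM y
    _ = M := by rw [lintegral_mul_const _ hk, lintegral_heatKernel N hs, one_mul]

theorem heatOp_eq_toReal {s : ℝ} (hs : 0 < s) {w : Euc N → ℝ} (hw : Measurable w)
    (h0 : ∀ y, 0 ≤ w y) (x : Euc N) :
    heatOp N s w x = (heatL N s (fun y => ENNReal.ofReal (w y)) x).toReal := by
  have hk : Measurable fun y => heatKernel N s (x - y) :=
    (measurable_heatKernel N).comp (by fun_prop : Measurable fun y : Euc N => (s, x - y))
  unfold heatOp heatL
  rw [integral_eq_lintegral_of_nonneg_ae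
    (Eventually.of_forall fun y => mul_nonneg (heatKernel_nonneg N hs.le _) (h0 y))
    (hk.mul hw).aestronglyMeasurable]
  congr 2
  funext y
  rw [ENNReal.ofReal_mul (heatKernel_nonneg N hs.le _)]

theorem lintegral_heatL_ge {s : ℝ} (hs : 0 < s) {W : Euc N → ENNReal} (hW : Measurable W) :
    ENNReal.ofReal (Real.exp (-s)) * ∫⁻ x, W x ∂(chiMeas N) ≤ ∫⁻ x, heatL N s W x ∂(chiMeas N) := by
  have hk : Measurable fun q : Euc N × Euc N => ENNReal.ofReal (heatKernel N s (q.1 - q.2)) :=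
    ((measurable_heatKernel N).comp (by fun_prop :
      Measurable fun q : Euc N × Euc N => (s, q.1 - q.2))).ennreal_ofReal
  have hχ := measurable_ofReal_chiFn N
  have hm := measurable_heatL_const N s hW
  have hcomm : ∀ x y : Euc N, heatKernel N s (x - y) = heatKernel N s (y - x) := by
    intro x y; rw [← heatKernel_neg, neg_sub]
  have hχW : Measurable fun x => ENNReal.ofReal (chiFn N x) * W x := hχ.mul hW
  rw [lintegral_chiMeas N hW, lintegral_chiMeas N hm, ← lintegral_const_mul _ hχW]
  have e : ∫⁻ x, ENNReal.ofReal (chiFn N x) * heatL N s W x =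
      ∫⁻ y, heatL N s (fun x => ENNReal.ofReal (chiFn N x)) y * W y := by
    unfold heatL
    have h1 : ∀ x, ENNReal.ofReal (chiFn N x) *
        ∫⁻ y, ENNReal.ofReal (heatKernel N s (x - y)) * W y =
        ∫⁻ y, ENNReal.ofReal (chiFn N x) * (ENNReal.ofReal (heatKernel N s (x - y)) * W y) := by
      intro x
      rw [lintegral_const_mul]
      exact (hk.comp (by fun_prop : Measurable fun y : Euc N => (x, y))).mul hW
    simp_rw [h1]
    rw [lintegral_lintegral_swap]
    · congr 1
      funext y
      rw [← lintegral_mul_const]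
      · congr 1
        funext x
        rw [hcomm x y]; ring
      · exact (hk.comp (by fun_prop : Measurable fun x : Euc N => (y, x))).mul hχ
    · exact ((hχ.comp measurable_fst).mul (hk.mul (hW.comp measurable_snd))).aemeasurable
  rw [e]
  refine lintegral_mono fun y => ?_
  rw [← mul_assoc]
  refine mul_le_mul_left ?_ _
  rw [← ENNReal.ofReal_mul (Real.exp_pos _).le]
  refine (ENNReal.ofReal_le_ofReal (heatOp_chiFn_ge N hs y)).trans ?_
  rw [heatOp_eq_toReal N hs (continuous_chiFn N).measurable (fun x => (chiFn_pos N x).le)]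
  exact ENNReal.ofReal_toReal_le

/-- Subordination of the heat semigroup to a measure on the half-line. -/
def subL (ν : Measure ℝ) (c : ℝ) (W : Euc N → ENNReal) (x : Euc N) : ENNReal :=
  ∫⁻ θ, heatL N (c * θ) W x ∂ν

theorem measurable_subL {Y : Type*} [MeasurableSpace Y] {ν : Measure ℝ} [SFinite ν]
    {c : Y → ℝ} {W : Y → Euc N → ENNReal} {x : Y → Euc N}
    (hc : Measurable c) (hW : Measurable fun q : Y × Euc N => W q.1 q.2) (hx : Measurable x) :
    Measurable fun q => subL N ν (c q) (W q) (x q) := by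
  unfold subL
  refine Measurable.lintegral_prod_right' (f := fun r : Y × ℝ =>
    heatL N (c r.1 * r.2) (W r.1) (x r.1)) ?_
  exact measurable_heatL N (Y := Y × ℝ) (s := fun q => c q.1 * q.2) (W := fun q => W q.1)
    (x := fun q => x q.1) (by fun_prop)
    (hW.comp (show Measurable fun r : (Y × ℝ) × Euc N => (r.1.1, r.2) by fun_prop)) (by fun_prop)

theorem measurable_subL_const (ν : Measure ℝ) [SFinite ν] (c : ℝ) {W : Euc N → ENNReal}
    (hW : Measurable W) : Measurable fun x => subL N ν c W x :=
  measurable_subL N (Y := Euc N) (c := fun _ => c) (W := fun _ => W) (x := fun x => x)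
    measurable_const (hW.comp measurable_snd) measurable_id

theorem subL_le {ν : Measure ℝ} (hν : ∀ᵐ θ ∂ν, 0 < θ) {c : ℝ} (hc : 0 < c) {W : Euc N → ENNReal}
    {M : ENNReal} (hM : ∀ y, W y ≤ M) (x : Euc N) : subL N ν c W x ≤ M * ν Set.univ := by
  rw [← lintegral_const]
  refine lintegral_mono_ae ?_
  filter_upwards [hν] with θ hθ
  exact heatL_le N (mul_pos hc hθ) hM x

theorem lintegral_subL_ge {ν : Measure ℝ} [SFinite ν] (hν : ∀ᵐ θ ∂ν, 0 < θ) {c : ℝ} (hc : 0 < c)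
    {W : Euc N → ENNReal} (hW : Measurable W) :
    (∫⁻ θ, ENNReal.ofReal (Real.exp (-c * θ)) ∂ν) * ∫⁻ x, W x ∂(chiMeas N) ≤
      ∫⁻ x, subL N ν c W x ∂(chiMeas N) := by
  unfold subL
  have h : Measurable (Function.uncurry fun (x : Euc N) (θ : ℝ) => heatL N (c * θ) W x) :=
    measurable_heatL N (Y := Euc N × ℝ) (s := fun q => c * q.2) (W := fun _ => W)
      (x := fun q => q.1) (by fun_prop) (hW.comp measurable_snd) measurable_fst
  rw [lintegral_lintegral_swap h.aemeasurable, ← lintegral_mul_const _ (by fun_prop)]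
  refine lintegral_mono_ae ?_
  filter_upwards [hν] with θ hθ
  rw [neg_mul]
  exact lintegral_heatL_ge N (mul_pos hc hθ) hW

end

/-- The measure `m(θ) dθ` on the half-line. -/
def densMeas (m : ℝ → ℝ) : Measure ℝ :=
  (volume.restrict (Set.Ioi 0)).withDensity fun θ => ENNReal.ofReal (m θ)

section
variable {m : ℝ → ℝ}

theorem densMeas_ae_pos (m : ℝ → ℝ) : ∀ᵐ θ ∂(densMeas m), 0 < θ :=
  (withDensity_absolutelyContinuous _ _).ae_le (ae_restrict_mem measurableSet_Ioi)

theorem lintegral_densMeas (hm : IntegrableOn m (Set.Ioi 0)) {F : ℝ → ENNReal} (hF : Measurable F) :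
    ∫⁻ θ, F θ ∂(densMeas m) = ∫⁻ θ in Set.Ioi 0, ENNReal.ofReal (m θ) * F θ := by
  rw [densMeas, lintegral_withDensity_eq_lintegral_mul₀ hm.1.aemeasurable.ennreal_ofReal
    hF.aemeasurable]
  rfl

theorem isFiniteMeasure_densMeas (hm : IntegrableOn m (Set.Ioi 0)) :
    IsFiniteMeasure (densMeas m) :=
  isFiniteMeasure_withDensity_ofReal hm.2

theorem integral_mul_toReal (hm : IntegrableOn m (Set.Ioi 0)) (h0 : ∀ θ > 0, 0 ≤ m θ)
    {F : ℝ → ENNReal} (hF : Measurable F) (hF' : ∀ θ > 0, F θ < ⊤) :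
    ∫ θ in Set.Ioi (0:ℝ), m θ * (F θ).toReal = (∫⁻ θ, F θ ∂(densMeas m)).toReal := by
  have hmF : AEMeasurable (fun θ => ENNReal.ofReal (m θ) * F θ) (volume.restrict (Set.Ioi 0)) :=
    hm.1.aemeasurable.ennreal_ofReal.mul hF.aemeasurable
  rw [lintegral_densMeas hm hF, ← integral_toReal hmF]
  · refine setIntegral_congr_fun measurableSet_Ioi fun θ hθ => ?_
    simp only [ENNReal.toReal_mul, ENNReal.toReal_ofReal (h0 θ hθ)]
  · filter_upwards [ae_restrict_mem measurableSet_Ioi] with θ hθ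
    exact ENNReal.mul_lt_top ENNReal.ofReal_lt_top (hF' θ hθ)

theorem lintegral_exp_densMeas (hm : IntegrableOn m (Set.Ioi 0)) (h0 : ∀ θ > 0, 0 ≤ m θ) {c : ℝ}
    (hc : 0 ≤ c) : ∫⁻ θ, ENNReal.ofReal (Real.exp (-c * θ)) ∂(densMeas m) =
      ENNReal.ofReal (∫ θ in Set.Ioi (0:ℝ), m θ * Real.exp (-c * θ)) := by
  have hi : IntegrableOn (fun θ => m θ * Real.exp (-c * θ)) (Set.Ioi 0) := by
    refine hm.mul_bdd (c := 1) (by fun_prop) ?_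
    filter_upwards [ae_restrict_mem measurableSet_Ioi] with θ hθ
    have : 0 < θ := hθ
    rw [Real.norm_eq_abs, Real.abs_exp, Real.exp_le_one_iff]
    nlinarith
  rw [lintegral_densMeas hm (by fun_prop), ofReal_integral_eq_lintegral_ofReal hi]
  · refine setLIntegral_congr_fun measurableSet_Ioi fun θ hθ => ?_
    simp only [ENNReal.ofReal_mul (h0 θ hθ)]
  · filter_upwards [ae_restrict_mem measurableSet_Ioi] with θ hθ
    exact mul_nonneg (h0 θ hθ) (Real.exp_pos _).le

theorem integral_mul_heatOp (N : ℕ) (hm : IntegrableOn m (Set.Ioi 0)) (h0 : ∀ θ > 0, 0 ≤ m θ)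
    {c : ℝ} (hc : 0 < c) {w : Euc N → ℝ} (hw : Measurable w) (hw0 : ∀ y, 0 ≤ w y) {M : ℝ}
    (hM : ∀ y, w y ≤ M) (x : Euc N) :
    ∫ θ in Set.Ioi (0:ℝ), m θ * heatOp N (c * θ) w x =
      (subL N (densMeas m) c (fun y => ENNReal.ofReal (w y)) x).toReal := by
  unfold subL
  have h : Measurable fun θ => heatL N (c * θ) (fun y => ENNReal.ofReal (w y)) x :=
    measurable_heatL N (Y := ℝ) (s := fun θ => c * θ) (W := fun _ y => ENNReal.ofReal (w y))
      (x := fun _ => x) (by fun_prop) (hw.ennreal_ofReal.comp measurable_snd) measurable_const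
  rw [← integral_mul_toReal hm h0 h]
  · refine setIntegral_congr_fun measurableSet_Ioi fun θ hθ => ?_
    simp only [heatOp_eq_toReal N (mul_pos hc hθ) hw hw0 x]
  · intro θ hθ
    exact (heatL_le N (mul_pos hc hθ) (M := ENNReal.ofReal M)
      (fun y => ENNReal.ofReal_le_ofReal (hM y)) x).trans_lt ENNReal.ofReal_lt_top

end

/-- Testing the Duhamel formula against `χ`. -/
theorem duhamel_test_ge (N : ℕ) {γ : ℝ} (hγ : 0 < γ) (hγ' : γ < 1) {t : ℝ} (ht : 0 < t)
    {w₀ : Euc N → ℝ} {w : ℝ → Euc N → ℝ} {M : ℝ}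
    (hw₀ : Measurable w₀) (hw₀0 : ∀ y, 0 ≤ w₀ y) (hw₀M : ∀ y, w₀ y ≤ M)
    (hw : Measurable fun q : ℝ × Euc N => w q.1 q.2) (hw0 : ∀ τ y, 0 ≤ w τ y) (hwM : ∀ τ y, w τ y ≤ M) :
    ENNReal.ofReal (wrightLaplace γ (t ^ γ)) * (∫⁻ x, ENNReal.ofReal (w₀ x) ∂(chiMeas N)) +
      ∫⁻ τ in Set.Ioo 0 t, ENNReal.ofReal (γ * (t - τ) ^ (γ - 1) * wrightLaplaceD γ ((t - τ) ^ γ)) *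
        ∫⁻ x, ENNReal.ofReal (w τ x) ∂(chiMeas N) ≤
    ∫⁻ x, ENNReal.ofReal (Pop N γ t w₀ x +
      ∫ τ in (0:ℝ)..t, (t - τ) ^ (γ - 1) * Sop N γ (t - τ) (w τ) x) ∂(chiMeas N) := by
  have hm0 := integrableOn_wrightFn hγ hγ'
  have hm1 := integrableOn_mul_wrightFn hγ hγ'
  have hn0 : ∀ θ > 0, 0 ≤ wrightFn γ θ := fun θ hθ => wrightFn_nonneg hγ hγ' hθ
  have hn1 : ∀ θ > 0, 0 ≤ θ * wrightFn γ θ := fun θ hθ => mul_nonneg hθ.le (hn0 θ hθ)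
  have := isFiniteMeasure_densMeas hm0
  have := isFiniteMeasure_densMeas hm1
  set ν₀ := densMeas (wrightFn γ)
  set ν₁ := densMeas fun θ => θ * wrightFn γ θ
  set W₀ : Euc N → ENNReal := fun y => ENNReal.ofReal (w₀ y) with hW₀
  set W : ℝ → Euc N → ENNReal := fun τ y => ENNReal.ofReal (w τ y) with hWdef
  set a : ℝ → ENNReal := fun τ => ENNReal.ofReal (γ * (t - τ) ^ (γ - 1)) with ha
  have ham : Measurable a := by rw [ha]; fun_prop
  have hW : Measurable fun q : ℝ × Euc N => W q.1 q.2 := hw.ennreal_ofReal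
  have hWτ : ∀ τ, Measurable (W τ) := fun τ => hW.comp measurable_prodMk_left
  have hwτ : ∀ τ, Measurable (w τ) := fun τ => hw.comp measurable_prodMk_left
  have hWfst : Measurable fun q : (ℝ × Euc N) × Euc N => W q.1.1 q.2 :=
    hW.comp (show Measurable fun q : (ℝ × Euc N) × Euc N => (q.1.1, q.2) by fun_prop)
  have hsub : Measurable fun q : ℝ × Euc N => subL N ν₁ ((t - q.1) ^ γ) (W q.1) q.2 :=
    measurable_subL N (Y := ℝ × Euc N) (c := fun q => (t - q.1) ^ γ) (W := fun q => W q.1)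
      (x := fun q => q.2) (by fun_prop) hWfst measurable_snd
  have hWsnd : Measurable fun q : (Euc N × ℝ) × Euc N => W q.1.2 q.2 :=
    hW.comp (show Measurable fun q : (Euc N × ℝ) × Euc N => (q.1.2, q.2) by fun_prop)
  have hsub' : Measurable fun q : Euc N × ℝ => subL N ν₁ ((t - q.2) ^ γ) (W q.2) q.1 :=
    measurable_subL N (Y := Euc N × ℝ) (c := fun q => (t - q.2) ^ γ) (W := fun q => W q.2)
      (x := fun q => q.1) (by fun_prop) hWsnd measurable_fst
  set A : Euc N → ENNReal := fun x => subL N ν₀ (t ^ γ) W₀ x with hA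
  set B : Euc N → ENNReal := fun x => ∫⁻ τ in Set.Ioo 0 t, a τ * subL N ν₁ ((t - τ) ^ γ) (W τ) x
    with hB
  have hAm : Measurable A := measurable_subL_const N ν₀ (t ^ γ) hw₀.ennreal_ofReal
  have hbd : ∀ τ ∈ Set.Ioo 0 t, ∀ x, subL N ν₁ ((t - τ) ^ γ) (W τ) x ≤
      ENNReal.ofReal M * ν₁ Set.univ := fun τ hτ x =>
    subL_le N (densMeas_ae_pos _) (Real.rpow_pos_of_pos (sub_pos.2 hτ.2) _)
      (fun y => ENNReal.ofReal_le_ofReal (hwM τ y)) x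
  have hfin : ENNReal.ofReal M * ν₁ Set.univ < ⊤ :=
    ENNReal.mul_lt_top ENNReal.ofReal_lt_top (measure_lt_top _ _)
  have hAfin : ∀ x, A x ≠ ⊤ := fun x => ((subL_le N (densMeas_ae_pos _)
    (Real.rpow_pos_of_pos ht _) (fun y => ENNReal.ofReal_le_ofReal (hw₀M y)) x).trans_lt
      (ENNReal.mul_lt_top ENNReal.ofReal_lt_top (measure_lt_top _ _))).ne
  have hBfin : ∀ x, B x ≠ ⊤ := by
    intro x
    refine ne_of_lt ?_
    have hi : IntegrableOn (fun τ : ℝ => γ * (t - τ) ^ (γ - 1)) (Set.Ioo 0 t) := by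
      have h2 := intervalIntegrable_rpow_mul_sub_rpow hγ le_rfl t
      simp only [Real.rpow_zero, one_mul] at h2
      exact (((intervalIntegrable_iff_integrableOn_Ioc_of_le ht.le).1 h2).mono_set
        Set.Ioo_subset_Ioc_self).const_mul γ
    calc B x ≤ ∫⁻ τ in Set.Ioo 0 t, a τ * (ENNReal.ofReal M * ν₁ Set.univ) :=
          setLIntegral_mono_ae (ham.mul_const _).aemeasurable
            (Eventually.of_forall fun τ hτ => mul_le_mul_right (hbd τ hτ x) _)
      _ = (∫⁻ τ in Set.Ioo 0 t, a τ) * (ENNReal.ofReal M * ν₁ Set.univ) :=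
          lintegral_mul_const _ ham
      _ < ⊤ := ENNReal.mul_lt_top hi.lintegral_lt_top hfin
  have hPop : ∀ x, Pop N γ t w₀ x = (A x).toReal := fun x =>
    integral_mul_heatOp N hm0 hn0 (Real.rpow_pos_of_pos ht _) hw₀ hw₀0 hw₀M x
  have hDuh : ∀ x, ∫ τ in (0:ℝ)..t, (t - τ) ^ (γ - 1) * Sop N γ (t - τ) (w τ) x = (B x).toReal := by
    intro x
    rw [intervalIntegral.integral_of_le ht.le, integral_Ioc_eq_integral_Ioo, hB]
    simp only
    have hmx : Measurable fun τ => a τ * subL N ν₁ ((t - τ) ^ γ) (W τ) x :=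
      ham.mul (measurable_subL N (Y := ℝ) (c := fun τ => (t - τ) ^ γ) (W := W)
        (x := fun _ => x) (by fun_prop) hW measurable_const)
    rw [← integral_toReal hmx.aemeasurable]
    · refine setIntegral_congr_fun measurableSet_Ioo fun τ hτ => ?_
      have hp : 0 < t - τ := sub_pos.2 hτ.2
      simp only [Sop, ENNReal.toReal_mul]
      rw [integral_mul_heatOp N hm1 hn1 (Real.rpow_pos_of_pos hp _) (hwτ τ) (hw0 τ) (hwM τ) x, ha,
        ENNReal.toReal_ofReal (by positivity)]
      ring
    · filter_upwards [ae_restrict_mem measurableSet_Ioo] with τ hτ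
      exact ENNReal.mul_lt_top ENNReal.ofReal_lt_top ((hbd τ hτ x).trans_lt hfin)
  have hsum : ∀ x, ENNReal.ofReal (Pop N γ t w₀ x +
      ∫ τ in (0:ℝ)..t, (t - τ) ^ (γ - 1) * Sop N γ (t - τ) (w τ) x) = A x + B x := by
    intro x
    rw [hPop, hDuh, ENNReal.ofReal_add ENNReal.toReal_nonneg ENNReal.toReal_nonneg,
      ENNReal.ofReal_toReal (hAfin x), ENNReal.ofReal_toReal (hBfin x)]
  simp_rw [hsum]
  rw [lintegral_add_left hAm]
  refine add_le_add ?_ ?_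
  · have h := lintegral_subL_ge N (ν := ν₀) (densMeas_ae_pos _) (Real.rpow_pos_of_pos ht γ)
      hw₀.ennreal_ofReal
    rwa [lintegral_exp_densMeas hm0 hn0 (by positivity)] at h
  · rw [hB, lintegral_lintegral_swap]
    · refine setLIntegral_mono_ae ?_ (Eventually.of_forall fun τ hτ => ?_)
      · refine Measurable.aemeasurable ?_
        refine Measurable.lintegral_prod_right' (f := fun q : ℝ × Euc N =>
          a q.1 * subL N ν₁ ((t - q.1) ^ γ) (W q.1) q.2) ?_
        exact (ham.comp measurable_fst).mul hsub
      · have hp : 0 < t - τ := sub_pos.2 hτ.2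
        have h := lintegral_subL_ge N (ν := ν₁) (densMeas_ae_pos _) (Real.rpow_pos_of_pos hp γ)
          (hWτ τ)
        rw [lintegral_exp_densMeas hm1 hn1 (by positivity)] at h
        rw [lintegral_const_mul _ (measurable_subL_const N ν₁ _ (hWτ τ)),
          ENNReal.ofReal_mul (by positivity), mul_assoc]
        exact mul_le_mul_right h _
    · exact ((ham.comp measurable_snd).mul hsub').aemeasurable

theorem hasDerivAt_wrightLaplace_rpow {γ t : ℝ} (hγ : 0 < γ) (hγ' : γ < 1) (ht : 0 < t) :
    HasDerivAt (fun r => wrightLaplace γ (r ^ γ))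
      (-(γ * t ^ (γ - 1) * wrightLaplaceD γ (t ^ γ))) t := by
  convert! (hasDerivAt_wrightLaplace hγ hγ' (Real.rpow_pos_of_pos ht γ)).comp t
    (Real.hasDerivAt_rpow_const (p := γ) (Or.inl ht.ne')) using 1
  ring

theorem continuousOn_wrightLaplace_rpow {γ : ℝ} (hγ : 0 < γ) (hγ' : γ < 1) :
    ContinuousOn (fun r => wrightLaplace γ (r ^ γ)) (Set.Ici 0) :=
  (continuousOn_wrightLaplace hγ hγ').comp
    (Real.continuous_rpow_const hγ.le).continuousOn fun _ hr => Real.rpow_nonneg hr γ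

/-- Integrability of the relaxation kernel `-d/dr` of `wrightLaplace γ (r ^ γ)` at `r = t - τ`. -/
theorem intervalIntegrable_relaxation {γ t : ℝ} (hγ : 0 < γ) (hγ' : γ < 1) (ht : 0 ≤ t) :
    IntervalIntegrable
      (fun τ => γ * (t - τ) ^ (γ - 1) * wrightLaplaceD γ ((t - τ) ^ γ)) volume 0 t := by
  refine intervalIntegral.intervalIntegrable_deriv_of_nonneg
    (g := fun τ => wrightLaplace γ ((t - τ) ^ γ)) ?_ ?_ ?_
  · rw [Set.uIcc_of_le ht]
    exact (continuousOn_wrightLaplace_rpow hγ hγ').comp (f := fun τ => t - τ) (by fun_prop)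
      fun τ hτ => sub_nonneg.2 hτ.2
  · intro τ hτ
    rw [min_eq_left ht, max_eq_right ht] at hτ
    convert! (hasDerivAt_wrightLaplace_rpow hγ hγ' (sub_pos.2 hτ.2)).comp τ
      ((hasDerivAt_id τ).const_sub t) using 1
    ring
  · intro τ hτ
    rw [min_eq_left ht, max_eq_right ht] at hτ
    have : 0 < t - τ := sub_pos.2 hτ.2
    exact mul_nonneg (by positivity) (wrightLaplaceD_nonneg hγ hγ' _)

/-- The `χ`-average of `|w|`. -/
def chiMean (N : ℕ) (w : ZeroAtInftyContinuousMap (Euc N) ℝ) : ℝ := ∫ x, |w x| ∂(chiMeas N)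

section
variable {N : ℕ}

theorem abs_le_norm_C₀ (w : ZeroAtInftyContinuousMap (Euc N) ℝ) (x : Euc N) : |w x| ≤ ‖w‖ := by
  rw [← ZeroAtInftyContinuousMap.norm_toBCF_eq_norm]
  exact w.toBCF.norm_coe_le_norm x

theorem integrable_abs_C₀ (w : ZeroAtInftyContinuousMap (Euc N) ℝ) :
    Integrable (fun x => |w x|) (chiMeas N) :=
  Integrable.of_bound (w.continuous.abs.aestronglyMeasurable) ‖w‖
    (Eventually.of_forall fun x => by simpa using abs_le_norm_C₀ w x)

theorem integrable_abs_rpow_C₀ (w : ZeroAtInftyContinuousMap (Euc N) ℝ) {r : ℝ} (hr : 0 ≤ r) :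
    Integrable (fun x => |w x| ^ r) (chiMeas N) :=
  Integrable.of_bound ((w.continuous.abs.rpow_const fun _ => Or.inr hr).aestronglyMeasurable)
    (‖w‖ ^ r) (Eventually.of_forall fun x => by
      rw [Real.norm_of_nonneg (by positivity)]
      exact Real.rpow_le_rpow (abs_nonneg _) (abs_le_norm_C₀ w x) hr)

theorem chiMean_nonneg (w : ZeroAtInftyContinuousMap (Euc N) ℝ) : 0 ≤ chiMean N w :=
  integral_nonneg fun _ => abs_nonneg _

theorem continuous_chiMean : Continuous (chiMean N) := by
  refine LipschitzWith.continuous (K := 1) (LipschitzWith.of_dist_le_mul fun w w' => ?_)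
  rw [NNReal.coe_one, one_mul, dist_eq_norm, dist_eq_norm, chiMean, chiMean,
    ← integral_sub (integrable_abs_C₀ w) (integrable_abs_C₀ w')]
  refine (norm_integral_le_of_norm_le_const (C := ‖w - w'‖) ?_).trans (by simp)
  refine Eventually.of_forall fun x => ?_
  exact (abs_abs_sub_abs_le_abs_sub _ _).trans (abs_le_norm_C₀ (w - w') x)

theorem chiMean_rpow_le (w : ZeroAtInftyContinuousMap (Euc N) ℝ) {r : ℝ} (hr : 1 ≤ r) :
    chiMean N w ^ r ≤ ∫ x, |w x| ^ r ∂(chiMeas N) :=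
  (convexOn_rpow hr).map_integral_le (Real.continuous_rpow_const (by linarith)).continuousOn
    isClosed_Ici (Eventually.of_forall fun x => abs_nonneg (w x)) (integrable_abs_C₀ w)
    (integrable_abs_rpow_C₀ w (by linarith))

theorem continuous_eval_C₀ {Y : Type*} [TopologicalSpace Y]
    {w : Y → ZeroAtInftyContinuousMap (Euc N) ℝ} (hw : Continuous w) :
    Continuous fun q : Y × Euc N => w q.1 q.2 := by
  have h : Continuous fun y => (w y).toBCF :=
    (ZeroAtInftyContinuousMap.isometry_toBCF (α := Euc N) (β := ℝ)).continuous.comp hw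
  exact (h.comp continuous_fst).eval continuous_snd

theorem chiMean_ge_of_duhamel {γ r t : ℝ} (hγ : 0 < γ) (hγ' : γ < 1) (hr : 1 ≤ r) (ht : 0 < t)
    {a a₀ : ZeroAtInftyContinuousMap (Euc N) ℝ} {b : ℝ → ZeroAtInftyContinuousMap (Euc N) ℝ}
    (ha₀ : ∀ x, 0 ≤ a₀ x) (hb : ContinuousOn b (Set.Icc 0 t))
    (h : ∀ x, a x = Pop N γ t (⇑a₀) x +
      ∫ τ in (0:ℝ)..t, (t - τ) ^ (γ - 1) * Sop N γ (t - τ) (fun y => |b τ y| ^ r) x) :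
    ENNReal.ofReal (wrightLaplace γ (t ^ γ) * chiMean N a₀) +
      ∫⁻ τ in Set.Ioo 0 t, ENNReal.ofReal (γ * (t - τ) ^ (γ - 1) * wrightLaplaceD γ ((t - τ) ^ γ) *
        chiMean N (b τ) ^ r) ≤ ENNReal.ofReal (chiMean N a) := by
  have hr0 : 0 ≤ r := by linarith
  set b' : ℝ → ZeroAtInftyContinuousMap (Euc N) ℝ := fun τ => b (max 0 (min τ t)) with hb'
  have hcl : ∀ τ, max 0 (min τ t) ∈ Set.Icc 0 t := fun τ =>
    ⟨le_max_left _ _, max_le ht.le (min_le_right _ _)⟩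
  have hbb : ∀ τ ∈ Set.Icc 0 t, b' τ = b τ := by
    intro τ hτ
    simp only [hb', min_eq_left hτ.2, max_eq_right hτ.1]
  have hb'c : Continuous b' := hb.comp_continuous (by fun_prop) hcl
  obtain ⟨C, hC⟩ := (isCompact_Icc.image_of_continuousOn hb.norm).bddAbove
  have hCb : ∀ τ, ‖b' τ‖ ≤ C := fun τ => hC ⟨_, hcl τ, rfl⟩
  have hev : Continuous fun q : ℝ × Euc N => |b' q.1 q.2| ^ r :=
    (continuous_eval_C₀ hb'c).abs.rpow_const fun _ => Or.inr hr0
  have key := duhamel_test_ge N hγ hγ' ht (w₀ := ⇑a₀) (w := fun τ y => |b' τ y| ^ r)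
    (M := max ‖a₀‖ (C ^ r)) a₀.continuous.measurable ha₀
    (fun y => ((le_abs_self _).trans (abs_le_norm_C₀ a₀ y)).trans (le_max_left _ _))
    hev.measurable (fun τ y => by positivity)
    (fun τ y => (Real.rpow_le_rpow (abs_nonneg _) ((abs_le_norm_C₀ _ y).trans (hCb τ)) hr0).trans
      (le_max_right _ _))
  have e1 : ∀ x, Pop N γ t (⇑a₀) x + (∫ τ in (0:ℝ)..t, (t - τ) ^ (γ - 1) *
      Sop N γ (t - τ) (fun y => |b' τ y| ^ r) x) = a x := by
    intro x
    rw [h x]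
    congr 1
    refine intervalIntegral.integral_congr fun τ hτ => ?_
    rw [Set.uIcc_of_le ht.le] at hτ
    simp only [hbb τ hτ]
  simp only [e1] at key
  have e2 : ∫⁻ x, ENNReal.ofReal (a₀ x) ∂(chiMeas N) = ENNReal.ofReal (chiMean N a₀) := by
    rw [chiMean, ofReal_integral_eq_lintegral_ofReal (integrable_abs_C₀ a₀)
      (Eventually.of_forall fun _ => abs_nonneg _)]
    simp only [abs_of_nonneg (ha₀ _)]
  have e3 : ∫⁻ x, ENNReal.ofReal (a x) ∂(chiMeas N) ≤ ENNReal.ofReal (chiMean N a) := by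
    rw [chiMean, ofReal_integral_eq_lintegral_ofReal (integrable_abs_C₀ a)
      (Eventually.of_forall fun _ => abs_nonneg _)]
    exact lintegral_mono fun x => ENNReal.ofReal_le_ofReal (le_abs_self _)
  refine le_trans (add_le_add ?_ ?_) (key.trans e3)
  · rw [e2, ENNReal.ofReal_mul (wrightLaplace_pos hγ hγ' (by positivity)).le]
  · refine lintegral_mono_ae ?_
    filter_upwards [ae_restrict_mem measurableSet_Ioo] with τ hτ
    have hp : 0 < t - τ := sub_pos.2 hτ.2
    rw [ENNReal.ofReal_mul (mul_nonneg (by positivity) (wrightLaplaceD_nonneg hγ hγ' _))]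
    refine mul_le_mul_right ?_ _
    rw [hbb τ ⟨hτ.1.le, hτ.2.le⟩, ← ofReal_integral_eq_lintegral_ofReal
      (integrable_abs_rpow_C₀ _ hr0) (Eventually.of_forall fun _ => by positivity)]
    exact ENNReal.ofReal_le_ofReal (chiMean_rpow_le _ hr)

theorem rpow_sum_lower_bound {p q x y : ℝ} (hp : 1 ≤ p) (hpq : p ≤ q) (hx : 0 ≤ x) (hy : 0 ≤ y) :
    2 ^ (1 - p) * (x + y) ^ p - 1 ≤ y ^ p + x ^ q := by
  have h1 : (x + y) ^ p ≤ 2 ^ (p - 1) * (x ^ p + y ^ p) := by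
    lift x to NNReal using hx
    lift y to NNReal using hy
    exact_mod_cast NNReal.rpow_add_le_mul_rpow_add_rpow x y hp
  have h2 : x ^ p ≤ x ^ q + 1 := by
    rcases le_total 1 x with h | h
    · have := Real.rpow_le_rpow_of_exponent_le h hpq; linarith
    · have := Real.rpow_le_one hx h (by linarith : 0 ≤ p)
      have := Real.rpow_nonneg hx q
      linarith
  have h3 : (2:ℝ) ^ (1 - p) * 2 ^ (p - 1) = 1 := by
    rw [← Real.rpow_add two_pos]; simp
  have h4 := mul_le_mul_of_nonneg_left h1 (by positivity : (0:ℝ) ≤ 2 ^ (1 - p))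
  rw [← mul_assoc, h3, one_mul] at h4
  linarith

theorem chiMean_add_ge {γ p q T : ℝ} (hγ : 0 < γ) (hγ' : γ < 1) (hp : 1 < p) (hpq : p ≤ q)
    {u₀ v₀ : ZeroAtInftyContinuousMap (Euc N) ℝ} (hu₀ : ∀ x, 0 ≤ u₀ x) (hv₀ : ∀ x, 0 ≤ v₀ x)
    {u v : ℝ → ZeroAtInftyContinuousMap (Euc N) ℝ}
    (h : IsMildSolution N γ γ (fun w => |w| ^ p) (fun w => |w| ^ q) u₀ v₀ (Set.Ico 0 T) u v)
    {t : ℝ} (ht : 0 < t) (htT : t < T) :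
    ENNReal.ofReal (wrightLaplace γ (t ^ γ) * (chiMean N u₀ + chiMean N v₀)) +
      ∫⁻ τ in Set.Ioo 0 t, ENNReal.ofReal (γ * (t - τ) ^ (γ - 1) * wrightLaplaceD γ ((t - τ) ^ γ) *
        (2 ^ (1 - p) * (chiMean N (u τ) + chiMean N (v τ)) ^ p - 1)) ≤
      ENNReal.ofReal (chiMean N (u t) + chiMean N (v t)) := by
  obtain ⟨hu, hv, -, -, h⟩ := h
  have hs : Set.Icc 0 t ⊆ Set.Ico 0 T := Set.Icc_subset_Ico_right htT
  have hK := (wrightLaplace_pos hγ hγ' (by positivity : 0 ≤ t ^ γ)).le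
  have h1 := chiMean_ge_of_duhamel hγ hγ' hp.le ht hu₀ (hv.mono hs) fun x => (h t ⟨ht.le, htT⟩ ht x).1
  have h2 := chiMean_ge_of_duhamel hγ hγ' (hp.le.trans hpq) ht hv₀ (hu.mono hs)
    fun x => (h t ⟨ht.le, htT⟩ ht x).2
  rw [ENNReal.ofReal_add (chiMean_nonneg _) (chiMean_nonneg _), mul_add,
    ENNReal.ofReal_add (mul_nonneg hK (chiMean_nonneg _)) (mul_nonneg hK (chiMean_nonneg _))]
  refine le_trans ?_ (add_le_add h1 h2)
  rw [add_add_add_comm]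
  gcongr
  have hmeas : AEMeasurable (fun τ => ENNReal.ofReal (γ * (t - τ) ^ (γ - 1) *
      wrightLaplaceD γ ((t - τ) ^ γ) * chiMean N (v τ) ^ p)) (volume.restrict (Set.Ioo 0 t)) := by
    have hk : AEMeasurable (fun τ => γ * (t - τ) ^ (γ - 1) * wrightLaplaceD γ ((t - τ) ^ γ))
        (volume.restrict (Set.Ioo 0 t)) :=
      (((intervalIntegrable_iff_integrableOn_Ioc_of_le ht.le).1
        (intervalIntegrable_relaxation hγ hγ' ht.le)).mono_set
          Set.Ioo_subset_Ioc_self).aestronglyMeasurable.aemeasurable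
    refine (hk.mul (ContinuousOn.aemeasurable ?_ measurableSet_Ioo)).ennreal_ofReal
    exact (continuous_chiMean.comp_continuousOn
      (hv.mono (Set.Ioo_subset_Icc_self.trans hs))).rpow_const
        fun _ _ => Or.inr (by linarith)
  rw [← lintegral_add_left' hmeas]
  refine lintegral_mono_ae ?_
  filter_upwards [ae_restrict_mem measurableSet_Ioo] with τ hτ
  have hp' : 0 < t - τ := sub_pos.2 hτ.2
  have hk : 0 ≤ γ * (t - τ) ^ (γ - 1) * wrightLaplaceD γ ((t - τ) ^ γ) :=
    mul_nonneg (by positivity) (wrightLaplaceD_nonneg hγ hγ' _)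
  have hU := chiMean_nonneg (u τ)
  have hV := chiMean_nonneg (v τ)
  rw [← ENNReal.ofReal_add (by positivity) (by positivity), ← mul_add]
  exact ENNReal.ofReal_le_ofReal
    (mul_le_mul_of_nonneg_left (rpow_sum_lower_bound hp.le hpq hU hV) hk)

end

theorem rpow_one_sub_lt_of_lt {p z : ℝ} (hp : 1 < p) (hz : (2:ℝ) ^ (p / (p - 1)) < z) :
    z ^ (1 - p) < 2 ^ (-p) := by
  have h := Real.rpow_lt_rpow_of_neg (by positivity) hz (by linarith : 1 - p < 0)
  rwa [← Real.rpow_mul two_pos.le, show p / (p - 1) * (1 - p) = -p by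
    have : p - 1 ≠ 0 := by linarith
    field_simp; ring] at h

theorem two_le_mul_rpow_sub_one {p z : ℝ} (hp : 1 < p) (hz : (2:ℝ) ^ (p / (p - 1)) ≤ z) :
    2 ≤ 2 ^ (1 - p) * z ^ (p - 1) := by
  have h1 := Real.rpow_le_rpow (by positivity) hz (by linarith : 0 ≤ p - 1)
  rw [← Real.rpow_mul two_pos.le, div_mul_cancel₀ _ (by linarith : p - 1 ≠ 0)] at h1
  have h2 := mul_le_mul_of_nonneg_left h1 (by positivity : (0:ℝ) ≤ 2 ^ (1 - p))
  rw [← Real.rpow_add two_pos] at h2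
  simpa using h2

section
variable {γ : ℝ}

theorem relaxation_integral_le (hγ : 0 < γ) (hγ' : γ < 1) {s t : ℝ} (hs : 0 ≤ s) (hst : s ≤ t) :
    ∫ σ in s..t, wrightLaplace γ ((t - σ) ^ γ) * (σ ^ (γ - 1) / Real.Gamma γ) ≤
      1 - wrightLaplace γ ((t - s) ^ γ) := by
  rcases hst.eq_or_lt with rfl | hlt
  · simp [Real.zero_rpow hγ.ne', wrightLaplace_zero hγ hγ']
  have hG := Real.Gamma_pos_of_pos hγ
  have hb : 0 < t - s := sub_pos.2 hlt
  obtain ⟨hi, he⟩ := integral_wrightLaplace_mul hγ hγ' hb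
  have e : ∫ σ in s..t, wrightLaplace γ ((t - σ) ^ γ) * (σ ^ (γ - 1) / Real.Gamma γ) =
      (Real.Gamma γ)⁻¹ * ∫ r in (0:ℝ)..(t - s), wrightLaplace γ (r ^ γ) * (t - r) ^ (γ - 1) := by
    rw [← intervalIntegral.integral_const_mul]
    have h := intervalIntegral.integral_comp_sub_left (a := s) (b := t)
      (fun r => (Real.Gamma γ)⁻¹ * (wrightLaplace γ (r ^ γ) * (t - r) ^ (γ - 1))) t
    rw [sub_self] at h
    rw [← h]
    congr 1
    funext σ
    rw [sub_sub_cancel]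
    ring
  rw [e, inv_mul_le_iff₀ hG, ← he]
  have hK : ∀ r, 0 ≤ r → 0 ≤ wrightLaplace γ (r ^ γ) := fun r hr =>
    (wrightLaplace_pos hγ hγ' (Real.rpow_nonneg hr γ)).le
  have hle : ∀ r ∈ Set.Ioo 0 (t - s), wrightLaplace γ (r ^ γ) * (t - r) ^ (γ - 1) ≤
      wrightLaplace γ (r ^ γ) * (t - s - r) ^ (γ - 1) := fun r hr =>
    mul_le_mul_of_nonneg_left (Real.rpow_le_rpow_of_nonpos (sub_pos.2 hr.2) (by linarith)
      (by linarith)) (hK r hr.1.le)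
  refine intervalIntegral.integral_mono_on_of_le_Ioo hb.le ?_ hi hle
  refine IntervalIntegrable.continuousOn_mul ?_
    ((continuousOn_wrightLaplace_rpow hγ hγ').mono ?_)
  · have h2 : IntervalIntegrable (fun x : ℝ => x ^ (γ - 1)) volume t s :=
      intervalIntegral.intervalIntegrable_rpow' (by linarith)
    have h3 := h2.comp_sub_left t
    simpa using h3
  · rw [Set.uIcc_of_le hb.le]
    exact fun r hr => hr.1

/-- A solution of `w' = t^{γ-1}/Γ(γ) (2^{1-p} w^p - 2 w)` is a subsolution of the relaxation
integral equation. -/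
theorem relaxation_subsolution (hγ : 0 < γ) (hγ' : γ < 1) {p t : ℝ} (hp : 1 < p) (ht : 0 < t)
    {w : ℝ → ℝ} (hwc : ContinuousOn w (Set.Icc 0 t))
    (hwd : ∀ τ ∈ Set.Ioo 0 t, HasDerivAt w
      (τ ^ (γ - 1) / Real.Gamma γ * (2 ^ (1 - p) * w τ ^ p - 2 * w τ)) τ)
    (hw : ∀ τ ∈ Set.Icc 0 t, (2:ℝ) ^ (p / (p - 1)) ≤ w τ) :
    w t ≤ wrightLaplace γ (t ^ γ) * w 0 + ∫ τ in (0:ℝ)..t,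
      γ * (t - τ) ^ (γ - 1) * wrightLaplaceD γ ((t - τ) ^ γ) * (2 ^ (1 - p) * w τ ^ p - 1) := by
  have hG := Real.Gamma_pos_of_pos hγ
  have hone : ∀ τ ∈ Set.Icc 0 t, 1 ≤ w τ := fun τ hτ =>
    (Real.one_le_rpow one_le_two (div_nonneg (by linarith) (by linarith))).trans (hw τ hτ)
  have hpow : ∀ τ ∈ Set.Icc 0 t, 2 ≤ 2 ^ (1 - p) * w τ ^ (p - 1) := fun τ hτ =>
    two_le_mul_rpow_sub_one hp (hw τ hτ)
  set k : ℝ → ℝ := fun τ => γ * (t - τ) ^ (γ - 1) * wrightLaplaceD γ ((t - τ) ^ γ) with hk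
  set κ : ℝ → ℝ := fun τ => wrightLaplace γ ((t - τ) ^ γ) with hκ
  set ρ : ℝ → ℝ := fun τ => τ ^ (γ - 1) / Real.Gamma γ with hρ
  set G : ℝ → ℝ := fun τ => 2 ^ (1 - p) * w τ ^ p - 2 * w τ with hGdef
  set H : ℝ → ℝ := fun τ => 2 ^ (1 - p) * (p * w τ ^ (p - 1)) - 2 with hH
  have hk0 : ∀ τ ∈ Set.Icc 0 t, 0 ≤ k τ := fun τ hτ =>
    mul_nonneg (mul_nonneg hγ.le (Real.rpow_nonneg (sub_nonneg.2 hτ.2) _))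
      (wrightLaplaceD_nonneg hγ hγ' _)
  have hG0 : ∀ τ ∈ Set.Icc 0 t, 0 ≤ G τ := by
    intro τ hτ
    have h1 := hpow τ hτ
    have h2 := hone τ hτ
    have h3 : w τ ^ p = w τ ^ (p - 1) * w τ := by
      rw [← Real.rpow_add_one (by linarith)]; simp
    simp only [hGdef, h3]
    nlinarith
  have hH0 : ∀ τ ∈ Set.Icc 0 t, 0 ≤ H τ := by
    intro τ hτ
    have h1 := hpow τ hτ
    simp only [hH]
    nlinarith
  have hρ0 : ∀ τ ∈ Set.Icc 0 t, 0 ≤ ρ τ := fun τ hτ =>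
    div_nonneg (Real.rpow_nonneg hτ.1 _) hG.le
  have hki : IntervalIntegrable k volume 0 t := intervalIntegrable_relaxation hγ hγ' ht.le
  have hκc : ContinuousOn κ (Set.Icc 0 t) :=
    (continuousOn_wrightLaplace_rpow hγ hγ').comp (f := fun τ => t - τ) (by fun_prop)
      fun τ hτ => sub_nonneg.2 hτ.2
  have hκd : ∀ τ ∈ Set.Ioo 0 t, HasDerivAt κ (k τ) τ := by
    intro τ hτ
    convert! (hasDerivAt_wrightLaplace_rpow hγ hγ' (sub_pos.2 hτ.2)).comp τ
      ((hasDerivAt_id τ).const_sub t) using 1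
    simp only [hk]
    ring
  have hρi : IntervalIntegrable ρ volume 0 t :=
    (intervalIntegral.intervalIntegrable_rpow' (by linarith)).div_const _
  have hu : Set.uIcc 0 t = Set.Icc 0 t := Set.uIcc_of_le ht.le
  have hwp : ∀ r : ℝ, ContinuousOn (fun τ => w τ ^ r) (Set.Icc 0 t) := fun r =>
    hwc.rpow_const fun τ hτ => Or.inl (by linarith [hone τ hτ])
  have hGc : ContinuousOn G (Set.Icc 0 t) :=
    (continuousOn_const.mul (hwp p)).sub (continuousOn_const.mul hwc)
  have hHc : ContinuousOn H (Set.Icc 0 t) :=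
    (continuousOn_const.mul (continuousOn_const.mul (hwp _))).sub continuousOn_const
  have hκρi : IntervalIntegrable (fun τ => κ τ * ρ τ) volume 0 t :=
    hρi.continuousOn_mul (hu ▸ hκc)
  have hw'i : IntervalIntegrable (fun τ => ρ τ * G τ) volume 0 t :=
    hρi.mul_continuousOn (hu ▸ hGc)
  have hκ0 : κ 0 = wrightLaplace γ (t ^ γ) := by simp [hκ]
  have hκt : κ t = 1 := by simp [hκ, Real.zero_rpow hγ.ne', wrightLaplace_zero hγ hγ']
  have hmin : Set.Ioo (min 0 t) (max 0 t) = Set.Ioo 0 t := by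
    rw [min_eq_left ht.le, max_eq_right ht.le]
  -- the fundamental theorem for `κ * w`
  have hI1 := intervalIntegral.integral_mul_deriv_eq_deriv_mul_of_hasDerivAt (a := 0) (b := t)
    (u := κ) (v := w) (u' := k) (v' := fun τ => ρ τ * G τ) (hu ▸ hκc) (hu ▸ hwc)
    (by rwa [hmin]) (by rwa [hmin]) hki hw'i
  -- the primitive of `k - κ * ρ`, normalized to vanish at `t`
  set Φ : ℝ → ℝ := fun s => κ s - κ t + ∫ σ in s..t, κ σ * ρ σ with hΦ
  have hΦt : Φ t = 0 := by simp [hΦ]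
  have hΦ0 : ∀ s ∈ Set.Icc 0 t, Φ s ≤ 0 := by
    intro s hs
    have := relaxation_integral_le hγ hγ' hs.1 hs.2
    simp only [hΦ, hκt]
    simp only [hκ, hρ]
    linarith
  have hκρc : ContinuousOn (fun σ => κ σ * ρ σ) (Set.Ioo 0 t) := by
    refine (hκc.mono Set.Ioo_subset_Icc_self).mul (ContinuousOn.div_const ?_ _)
    exact continuousOn_id.rpow_const fun x hx => Or.inl hx.1.ne'
  have hΦc : ContinuousOn Φ (Set.Icc 0 t) := by
    refine (hκc.sub continuousOn_const).add ?_
    have := intervalIntegral.continuousOn_primitive_interval_left (μ := volume)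
      (f := fun σ => κ σ * ρ σ) (a := 0) (b := t)
      (by rw [hu]; exact (intervalIntegrable_iff_integrableOn_Icc_of_le ht.le).1 hκρi)
    rwa [hu] at this
  have hΦd : ∀ s ∈ Set.Ioo 0 t, HasDerivAt Φ (k s - κ s * ρ s) s := by
    intro s hs
    have h1 : IntervalIntegrable (fun σ => κ σ * ρ σ) volume s t := hκρi.mono_set (by
      rw [Set.uIcc_of_le hs.2.le, hu]; exact Set.Icc_subset_Icc_left hs.1.le)
    have h2 := intervalIntegral.integral_hasDerivAt_left h1
      (hκρc.stronglyMeasurableAtFilter isOpen_Ioo s hs) (hκρc.continuousAt (Ioo_mem_nhds hs.1 hs.2))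
    convert! ((hκd s hs).sub_const (κ t)).add h2 using 1
  have hGd : ∀ τ ∈ Set.Ioo 0 t, HasDerivAt G (H τ * (ρ τ * G τ)) τ := by
    intro τ hτ
    have hw1 := hone τ (Set.Ioo_subset_Icc_self hτ)
    have h1 := ((hwd τ hτ).rpow_const (p := p) (Or.inl (by linarith))).const_mul ((2:ℝ) ^ (1 - p))
    convert! h1.sub ((hwd τ hτ).const_mul 2) using 1
    simp only [hH, hρ, hGdef]
    ring
  have hGi : IntervalIntegrable (fun τ => H τ * (ρ τ * G τ)) volume 0 t :=
    hw'i.continuousOn_mul (hu ▸ hHc)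
  have hI2 := intervalIntegral.integral_mul_deriv_eq_deriv_mul_of_hasDerivAt (a := 0) (b := t)
    (u := G) (v := Φ) (u' := fun τ => H τ * (ρ τ * G τ)) (v' := fun τ => k τ - κ τ * ρ τ)
    (hu ▸ hGc) (hu ▸ hΦc) (by rwa [hmin]) (by rwa [hmin]) hGi (hki.sub hκρi)
  have hI3 : ∫ τ in (0:ℝ)..t, H τ * (ρ τ * G τ) * Φ τ ≤ 0 := by
    rw [← neg_nonneg, ← intervalIntegral.integral_neg]
    refine intervalIntegral.integral_nonneg ht.le fun τ hτ => ?_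
    exact neg_nonneg.2 <| mul_nonpos_of_nonneg_of_nonpos
      (mul_nonneg (hH0 τ hτ) (mul_nonneg (hρ0 τ hτ) (hG0 τ hτ))) (hΦ0 τ hτ)
  have hI4 : 0 ≤ ∫ τ in (0:ℝ)..t, G τ * (k τ - κ τ * ρ τ) := by
    rw [hI2, hΦt]
    have := mul_nonpos_of_nonneg_of_nonpos (hG0 0 ⟨le_rfl, ht.le⟩) (hΦ0 0 ⟨le_rfl, ht.le⟩)
    linarith
  have hkw : IntervalIntegrable (fun τ => k τ * w τ) volume 0 t :=
    hki.mul_continuousOn (hu ▸ hwc)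
  have hkG : IntervalIntegrable (fun τ => k τ * G τ) volume 0 t :=
    hki.mul_continuousOn (hu ▸ hGc)
  have hκw : IntervalIntegrable (fun τ => κ τ * (ρ τ * G τ)) volume 0 t :=
    hw'i.continuousOn_mul (hu ▸ hκc)
  have hI5 : ∫ τ in (0:ℝ)..t, G τ * (k τ - κ τ * ρ τ) =
      (∫ τ in (0:ℝ)..t, k τ * G τ) - ∫ τ in (0:ℝ)..t, κ τ * (ρ τ * G τ) := by
    rw [← intervalIntegral.integral_sub hkG hκw]
    congr 1
    funext τ
    ring
  have hI6 : (∫ τ in (0:ℝ)..t, k τ * G τ) + ∫ τ in (0:ℝ)..t, k τ * w τ ≤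
      ∫ τ in (0:ℝ)..t, k τ * (2 ^ (1 - p) * w τ ^ p - 1) := by
    rw [← intervalIntegral.integral_add hkG hkw]
    refine intervalIntegral.integral_mono_on ht.le (hkG.add hkw)
      (hki.mul_continuousOn (hu ▸ (continuousOn_const.mul (hwp p)).sub continuousOn_const)) ?_
    intro τ hτ
    rw [← mul_add]
    refine mul_le_mul_of_nonneg_left ?_ (hk0 τ hτ)
    have := hone τ hτ
    simp only [hGdef]
    linarith
  rw [hκt, hκ0] at hI1
  linarith

end

section
variable {γ : ℝ}

theorem relaxation_comparison (hγ : 0 < γ) (hγ' : γ < 1) {p t₁ : ℝ} (hp : 1 < p)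
    {Z w : ℝ → ℝ} (hZc : ContinuousOn Z (Set.Ico 0 t₁)) (hZ0 : ∀ t, 0 ≤ Z t)
    (hZ : ∀ t ∈ Set.Ioo 0 t₁, ENNReal.ofReal (wrightLaplace γ (t ^ γ) * Z 0) +
      ∫⁻ τ in Set.Ioo 0 t, ENNReal.ofReal (γ * (t - τ) ^ (γ - 1) * wrightLaplaceD γ ((t - τ) ^ γ) *
        (2 ^ (1 - p) * Z τ ^ p - 1)) ≤ ENNReal.ofReal (Z t))
    (hwc : ContinuousOn w (Set.Ico 0 t₁))
    (hwd : ∀ τ ∈ Set.Ioo 0 t₁, HasDerivAt w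
      (τ ^ (γ - 1) / Real.Gamma γ * (2 ^ (1 - p) * w τ ^ p - 2 * w τ)) τ)
    (hw : ∀ τ ∈ Set.Ico 0 t₁, (2:ℝ) ^ (p / (p - 1)) ≤ w τ) (h0 : w 0 < Z 0) :
    ∀ t ∈ Set.Ico 0 t₁, w t < Z t := by
  intro t₂ ht₂
  by_contra! hbad
  have hsub2 : Set.Icc 0 t₂ ⊆ Set.Ico 0 t₁ := Set.Icc_subset_Ico_right ht₂.2
  set S : Set ℝ := {t ∈ Set.Icc 0 t₂ | Z t ≤ w t} with hS
  have hScl : IsClosed S :=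
    isClosed_Icc.isClosed_le (hZc.mono hsub2) (hwc.mono hsub2)
  have hSne : S.Nonempty := ⟨t₂, ⟨ht₂.1, le_rfl⟩, hbad⟩
  have hSbd : BddBelow S := ⟨0, fun t ht => ht.1.1⟩
  obtain ⟨⟨ht0, ht02⟩, hle⟩ : sInf S ∈ S := hScl.csInf_mem hSne hSbd
  set t := sInf S with htdef
  have htpos : 0 < t := by
    rcases ht0.eq_or_lt with h | h
    · rw [← h] at hle; exact absurd hle (not_le.2 h0)
    · exact h
  have hlt : ∀ τ ∈ Set.Ico 0 t, w τ < Z τ := by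
    intro τ hτ
    by_contra! hcon
    exact absurd (csInf_le hSbd (show τ ∈ S from ⟨⟨hτ.1, hτ.2.le.trans ht02⟩, hcon⟩))
      (not_le.2 hτ.2)
  have htt1 : t < t₁ := ht02.trans_lt ht₂.2
  have hsub : Set.Icc 0 t ⊆ Set.Ico 0 t₁ := Set.Icc_subset_Ico_right htt1
  have hone : ∀ τ ∈ Set.Icc 0 t, 1 ≤ w τ := fun τ hτ =>
    (Real.one_le_rpow one_le_two (div_nonneg (by linarith) (by linarith))).trans (hw τ (hsub hτ))
  have hsubsol := relaxation_subsolution hγ hγ' hp htpos (hwc.mono hsub)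
    (fun τ hτ => hwd τ ⟨hτ.1, hτ.2.trans htt1⟩) fun τ hτ => hw τ (hsub hτ)
  have hK := wrightLaplace_pos hγ hγ' (Real.rpow_nonneg htpos.le γ)
  have hpow : ∀ τ ∈ Set.Icc 0 t, 0 ≤ 2 ^ (1 - p) * w τ ^ p - 1 := by
    intro τ hτ
    have h2 := two_le_mul_rpow_sub_one hp (hw τ (hsub hτ))
    have h3 : w τ ^ p = w τ ^ (p - 1) * w τ := by
      rw [← Real.rpow_add_one (by linarith [hone τ hτ])]; simp
    rw [h3]
    nlinarith [hone τ hτ]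
  set k : ℝ → ℝ := fun τ => γ * (t - τ) ^ (γ - 1) * wrightLaplaceD γ ((t - τ) ^ γ) with hk
  have hk0 : ∀ τ ∈ Set.Icc 0 t, 0 ≤ k τ := fun τ hτ =>
    mul_nonneg (mul_nonneg hγ.le (Real.rpow_nonneg (sub_nonneg.2 hτ.2) _))
      (wrightLaplaceD_nonneg hγ hγ' _)
  have hki : IntervalIntegrable k volume 0 t := intervalIntegrable_relaxation hγ hγ' htpos.le
  have hInt : IntervalIntegrable (fun τ => k τ * (2 ^ (1 - p) * w τ ^ p - 1)) volume 0 t := by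
    refine hki.mul_continuousOn ?_
    rw [Set.uIcc_of_le htpos.le]
    exact (continuousOn_const.mul ((hwc.mono hsub).rpow_const fun τ hτ =>
      Or.inl (by linarith [hone τ hτ]))).sub continuousOn_const
  have hI : ENNReal.ofReal (∫ τ in (0:ℝ)..t, k τ * (2 ^ (1 - p) * w τ ^ p - 1)) ≤
      ∫⁻ τ in Set.Ioo 0 t, ENNReal.ofReal (k τ * (2 ^ (1 - p) * Z τ ^ p - 1)) := by
    rw [intervalIntegral.integral_of_le htpos.le, integral_Ioc_eq_integral_Ioo,
      ofReal_integral_eq_lintegral_ofReal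
        (((intervalIntegrable_iff_integrableOn_Ioc_of_le htpos.le).1 hInt).mono_set
          Set.Ioo_subset_Ioc_self)]
    · refine lintegral_mono_ae ?_
      filter_upwards [ae_restrict_mem measurableSet_Ioo] with τ hτ
      have hτ' := Set.Ioo_subset_Icc_self hτ
      refine ENNReal.ofReal_le_ofReal (mul_le_mul_of_nonneg_left ?_ (hk0 τ hτ'))
      have := Real.rpow_le_rpow (by linarith [hone τ hτ']) (hlt τ ⟨hτ.1.le, hτ.2⟩).le
        (by linarith : 0 ≤ p)
      gcongr
    · filter_upwards [ae_restrict_mem measurableSet_Ioo] with τ hτ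
      have hτ' := Set.Ioo_subset_Icc_self hτ
      exact mul_nonneg (hk0 τ hτ') (hpow τ hτ')
  have hI0 : 0 ≤ ∫ τ in (0:ℝ)..t, k τ * (2 ^ (1 - p) * w τ ^ p - 1) :=
    intervalIntegral.integral_nonneg htpos.le fun τ hτ => mul_nonneg (hk0 τ hτ) (hpow τ hτ)
  have hfin := (add_le_add_right hI _).trans (hZ t ⟨htpos, htt1⟩)
  rw [← ENNReal.ofReal_add (mul_nonneg hK.le (hZ0 0)) hI0,
    ENNReal.ofReal_le_ofReal_iff (hZ0 t)] at hfin
  have := mul_lt_mul_of_pos_left h0 hK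
  linarith

/-- The comparison function: the Bernoulli equation `y' = 2^{1-p} y^p - 2 y` solved at
time `t^γ / Γ(γ+1)`. -/
theorem exists_blowup_profile (hγ : 0 < γ) {p w₀ : ℝ} (hp : 1 < p)
    (hw₀ : (2:ℝ) ^ (p / (p - 1)) < w₀) {t₁ : ℝ}
    (ht₁ : t₁ = (Real.Gamma (γ + 1) * Real.log (1 - (2 : ℝ) ^ p * w₀ ^ (1 - p)) / (2 * (1 - p)))
        ^ (1 / γ)) :
    0 < t₁ ∧ ∃ w : ℝ → ℝ, ContinuousOn w (Set.Ico 0 t₁) ∧ w 0 = w₀ ∧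
      (∀ τ ∈ Set.Ioo 0 t₁, HasDerivAt w
        (τ ^ (γ - 1) / Real.Gamma γ * (2 ^ (1 - p) * w τ ^ p - 2 * w τ)) τ) ∧
      (∀ τ ∈ Set.Ico 0 t₁, (2:ℝ) ^ (p / (p - 1)) ≤ w τ) ∧ Tendsto w (𝓝[<] t₁) atTop := by
  have hp1 : 0 < p - 1 := by linarith
  have hG := Real.Gamma_pos_of_pos hγ
  have hG1 := Real.Gamma_pos_of_pos (by linarith : 0 < γ + 1)
  have hw₀pos : 0 < w₀ := lt_trans (by positivity) hw₀
  set δ : ℝ := 1 - (2:ℝ) ^ p * w₀ ^ (1 - p) with hδ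
  have h2p : (0:ℝ) < 2 ^ p := by positivity
  have hlow : w₀ ^ (1 - p) < 2 ^ (-p) := rpow_one_sub_lt_of_lt hp hw₀
  have hA : (2:ℝ) ^ p * 2 ^ (-p) = 1 := by rw [← Real.rpow_add two_pos]; simp
  have hδ0 : 0 < δ := by
    have := mul_lt_mul_of_pos_left hlow h2p
    rw [hδ]; linarith
  have hδ1 : δ < 1 := by
    have : 0 < (2:ℝ) ^ p * w₀ ^ (1 - p) := by positivity
    rw [hδ]; linarith
  have hlog : Real.log δ < 0 := Real.log_neg hδ0 hδ1
  set B : ℝ := 2 ^ (-p) - w₀ ^ (1 - p) with hB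
  have hBδ : B = 2 ^ (-p) * δ := by
    rw [hB, hδ, mul_sub, mul_one, ← mul_assoc, mul_comm ((2:ℝ) ^ (-p)), hA, one_mul]
  have hB0 : 0 < B := sub_pos.2 hlow
  set X : ℝ := Real.Gamma (γ + 1) * Real.log δ / (2 * (1 - p)) with hX
  have hX0 : 0 < X := div_pos_of_neg_of_neg (mul_neg_of_pos_of_neg hG1 hlog) (by linarith)
  have ht₁0 : 0 < t₁ := by rw [ht₁]; positivity
  have ht₁X : t₁ ^ γ = X := by
    rw [ht₁, ← Real.rpow_mul hX0.le, one_div, inv_mul_cancel₀ hγ.ne', Real.rpow_one]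
  set E : ℝ → ℝ := fun t => 2 ^ (-p) - B * Real.exp (2 * (p - 1) * (t ^ γ / Real.Gamma (γ + 1)))
    with hE
  have hEc : Continuous E := by
    have := Real.continuous_rpow_const (q := γ) hγ.le
    rw [hE]; fun_prop
  have hEt₁ : E t₁ = 0 := by
    have : 2 * (p - 1) * (t₁ ^ γ / Real.Gamma (γ + 1)) = - Real.log δ := by
      rw [ht₁X, hX]
      have : 1 - p ≠ 0 := by linarith
      field_simp
      ring
    simp only [hE, this, Real.exp_neg, Real.exp_log hδ0, hBδ]
    field_simp
    ring
  have hEpos : ∀ t ∈ Set.Ico 0 t₁, 0 < E t := by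
    intro t ht
    rw [← hEt₁]
    have := Real.rpow_lt_rpow ht.1 ht.2 hγ
    simp only [hE]
    gcongr
  have hElt : ∀ t, E t ≤ 2 ^ (-p) := by
    intro t
    have : 0 < B * Real.exp (2 * (p - 1) * (t ^ γ / Real.Gamma (γ + 1))) := by positivity
    simp only [hE]; linarith
  refine ⟨ht₁0, fun t => E t ^ (-1 / (p - 1)), ?_, ?_, ?_, ?_, ?_⟩
  · exact hEc.continuousOn.rpow_const fun t ht => Or.inl (hEpos t ht).ne'
  · have : E 0 = w₀ ^ (1 - p) := by simp [hE, hB, Real.zero_rpow hγ.ne']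
    simp only [this]
    rw [← Real.rpow_mul hw₀pos.le, show (1 - p) * (-1 / (p - 1)) = 1 by field_simp; ring,
      Real.rpow_one]
  · intro τ hτ
    have hpos := hEpos τ ⟨hτ.1.le, hτ.2⟩
    have hEd : HasDerivAt E (-(B * (Real.exp (2 * (p - 1) * (τ ^ γ / Real.Gamma (γ + 1))) *
        (2 * (p - 1) * (γ * τ ^ (γ - 1) / Real.Gamma (γ + 1)))))) τ :=
      (((((Real.hasDerivAt_rpow_const (p := γ) (Or.inl hτ.1.ne')).div_const _).const_mul
        (2 * (p - 1))).exp).const_mul B).const_sub _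
    convert! hEd.rpow_const (p := -1 / (p - 1)) (Or.inl hpos.ne') using 1
    have e1 : (E τ ^ (-1 / (p - 1))) ^ p = E τ ^ (-1 / (p - 1) - 1) := by
      rw [← Real.rpow_mul hpos.le]; congr 1; field_simp; ring
    have e2 : E τ ^ (-1 / (p - 1)) = E τ ^ (-1 / (p - 1) - 1) * E τ := by
      rw [← Real.rpow_add_one hpos.ne']; simp
    have e3 : (2:ℝ) ^ (1 - p) = 2 * 2 ^ (-p) := by
      rw [sub_eq_add_neg, Real.rpow_add two_pos, Real.rpow_one]
    have e4 : B * Real.exp (2 * (p - 1) * (τ ^ γ / Real.Gamma (γ + 1))) = 2 ^ (-p) - E τ := by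
      simp only [hE]; ring
    beta_reduce
    rw [e1, e2, e3, ← mul_assoc B, e4, Real.Gamma_add_one hγ.ne']
    generalize E τ ^ (-1 / (p - 1) - 1) = P
    field_simp
  · intro τ hτ
    have h := Real.rpow_le_rpow_of_nonpos (hEpos τ hτ) (hElt τ)
      (div_nonpos_of_nonpos_of_nonneg (by norm_num) hp1.le : -1 / (p - 1) ≤ 0)
    rwa [← Real.rpow_mul two_pos.le, show -p * (-1 / (p - 1)) = p / (p - 1) by ring] at h
  · refine (tendsto_rpow_neg_nhdsGT_zero (div_neg_of_neg_of_pos (by norm_num) hp1)).comp ?_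
    refine tendsto_nhdsWithin_iff.2 ⟨?_, ?_⟩
    · rw [← hEt₁]; exact hEc.continuousAt.tendsto.mono_left nhdsWithin_le_nhds
    · filter_upwards [Ioo_mem_nhdsLT ht₁0] with t ht using hEpos t ⟨ht.1.le, ht.2⟩

end

/-- Large-data blow-up: if `Z₀ = ∫ (u₀ + v₀) χ > 2^{p/(p−1)}`, then no mild solution
of the system exists on `[0,T)` for any
`T > [Γ(γ+1)·ln(1 − 2^p Z₀^{1−p})/(2(1−p))]^{1/γ}`. -/
theorem large_data_blow_up
    (N : ℕ) (γ p q : ℝ) (hγ : 0 < γ) (hγ' : γ < 1)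
    (hp : 1 < p) (hq : 1 < q) (hpq : p ≤ q)
    (u₀ v₀ : ZeroAtInftyContinuousMap (Euc N) ℝ)
    (hu₀nn : ∀ x, 0 ≤ u₀ x) (hv₀nn : ∀ x, 0 ≤ v₀ x)
    (Z₀ : ℝ) (hZ₀def : Z₀ = ∫ x : Euc N, (u₀ x + v₀ x) * chiFn N x)
    (hZ₀ : (2 : ℝ) ^ (p / (p - 1)) < Z₀)
    (T : ℝ)
    (hT : (Real.Gamma (γ + 1) * Real.log (1 - (2 : ℝ) ^ p * Z₀ ^ (1 - p)) / (2 * (1 - p)))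
        ^ (1 / γ) < T) :
    ¬ ∃ u v : ℝ → ZeroAtInftyContinuousMap (Euc N) ℝ,
        IsMildSolution N γ γ (fun w => |w| ^ p) (fun w => |w| ^ q) u₀ v₀
          (Set.Ico 0 T) u v := by
  rintro ⟨u, v, h⟩
  have hZ₀pos : 0 < Z₀ := lt_trans (by positivity) hZ₀
  have hlow : Z₀ ^ (1 - p) < 2 ^ (-p) := rpow_one_sub_lt_of_lt hp hZ₀
  have hδ : 1 - (2:ℝ) ^ p * Z₀ ^ (1 - p) ≠ 0 := by
    have := mul_lt_mul_of_pos_left hlow (by positivity : (0:ℝ) < 2 ^ p)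
    rw [← Real.rpow_add two_pos, add_neg_cancel, Real.rpow_zero] at this
    linarith
  have hcont : ContinuousAt (fun z : ℝ => (Real.Gamma (γ + 1) *
      Real.log (1 - (2 : ℝ) ^ p * z ^ (1 - p)) / (2 * (1 - p))) ^ (1 / γ)) Z₀ := by
    refine ContinuousAt.rpow_const (ContinuousAt.div_const (continuousAt_const.mul
      (ContinuousAt.log (continuousAt_const.sub (continuousAt_const.mul
        (continuousAt_id.rpow_const (Or.inl hZ₀pos.ne')))) hδ)) _) (Or.inr (by positivity))
  obtain ⟨w₀, ⟨hw₀T, hw₀⟩, hw₀Z⟩ := (((hcont.eventually_lt continuousAt_const hT).and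
    (lt_mem_nhds hZ₀)).filter_mono nhdsWithin_le_nhds |>.and
      (self_mem_nhdsWithin (s := Set.Iio Z₀))).exists
  obtain ⟨ht₁, w, hwc, hw0, hwd, hw, hwtop⟩ := exists_blowup_profile hγ hp hw₀ rfl
  set t₁ := (Real.Gamma (γ + 1) * Real.log (1 - (2 : ℝ) ^ p * w₀ ^ (1 - p)) / (2 * (1 - p)))
    ^ (1 / γ)
  set Z : ℝ → ℝ := fun t => chiMean N (u t) + chiMean N (v t) with hZdef
  have hZc : ContinuousOn Z (Set.Ico 0 T) :=
    (continuous_chiMean.comp_continuousOn h.1).add (continuous_chiMean.comp_continuousOn h.2.1)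
  have hZ0 : Z 0 = Z₀ := by
    simp only [hZdef, h.2.2.1, h.2.2.2.1, chiMean]
    rw [← integral_add (integrable_abs_C₀ u₀) (integrable_abs_C₀ v₀), integral_chiMeas, hZ₀def]
    simp only [abs_of_nonneg (hu₀nn _), abs_of_nonneg (hv₀nn _)]
  have hcmp := relaxation_comparison hγ hγ' hp
    (hZc.mono (Set.Ico_subset_Ico_right hw₀T.le))
    (fun t => add_nonneg (chiMean_nonneg _) (chiMean_nonneg _))
    (fun t ht => by
      have := chiMean_add_ge hγ hγ' hp hpq hu₀nn hv₀nn h ht.1 (ht.2.trans hw₀T)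
      simpa only [hZdef, h.2.2.1, h.2.2.2.1] using this)
    hwc hwd hw (by rw [hw0, hZ0]; exact hw₀Z)
  obtain ⟨C, hC⟩ := (isCompact_Icc.image_of_continuousOn
    (hZc.mono (Set.Icc_subset_Ico_right hw₀T))).bddAbove
  obtain ⟨t, htC, ht⟩ := ((hwtop.eventually_gt_atTop C).and (Ioo_mem_nhdsLT ht₁)).exists
  have h1 := hcmp t ⟨ht.1.le, ht.2⟩
  have h2 := hC ⟨t, ⟨ht.1.le, ht.2.le⟩, rfl⟩
  linarith

end
end

section
/- Let 0 < α < 1 and let φ_α be the Wright type function φ_α(z) = Σ_{k=0}^∞ (−z)^k/(k! Γ(−αk + 1 − α)). Then φ_α(θ) ≥ 0 for every θ ≥ 0, and ∫_0^{+∞} φ_α(θ) dθ = 1. -/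
noncomputable section

open MeasureTheory Filter Topology

/-- `wrightAux α n c t` is `(-d/dz)^n (z ^ (-c) * exp (-t * z ^ α))` at `z = 1`. -/
def wrightAux (α : ℝ) : ℕ → ℝ → ℝ → ℝ
  | 0, _, t => Real.exp (-t)
  | n + 1, c, t => c * wrightAux α n (c + 1) t + α * t * wrightAux α n (c + 1 - α) t

lemma wrightAux_nonneg {α : ℝ} (hα : 0 ≤ α) (hα' : α ≤ 1) (n : ℕ) {c t : ℝ} (hc : 0 ≤ c)
    (ht : 0 ≤ t) : 0 ≤ wrightAux α n c t := by
  induction n generalizing c with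
  | zero => exact (Real.exp_pos _).le
  | succ n ih =>
    have h₁ := ih (c := c + 1) (by linarith)
    have h₂ := ih (c := c + 1 - α) (by linarith)
    unfold wrightAux
    positivity

lemma continuous_wrightAux (α : ℝ) (n : ℕ) (c : ℝ) : Continuous (wrightAux α n c) := by
  induction n generalizing c with
  | zero => exact Real.continuous_exp.comp continuous_neg
  | succ n ih =>
    have h₁ := ih (c + 1)
    have h₂ := ih (c + 1 - α)
    exact (continuous_const.mul h₁).add ((continuous_const.mul continuous_id).mul h₂)

lemma hasSum_wrightAux (α : ℝ) (n : ℕ) (c t : ℝ) :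
    HasSum (fun k : ℕ ↦ (-t) ^ k / (k.factorial : ℝ) * ∏ j ∈ Finset.range n, (c - α * k + j))
      (wrightAux α n c t) := by
  induction n generalizing c with
  | zero =>
    simpa [wrightAux, Real.exp_eq_exp_ℝ] using NormedSpace.expSeries_div_hasSum_exp (-t)
  | succ n ih =>
    have h₁ := (ih (c + 1)).mul_left c
    have h₂ : HasSum (fun k : ℕ ↦ -(α * k) * ((-t) ^ k / (k.factorial : ℝ) *
        ∏ j ∈ Finset.range n, (c + 1 - α * k + j))) (α * t * wrightAux α n (c + 1 - α) t) := by
      rw [← hasSum_nat_add_iff' 1]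
      simp only [Finset.range_one, Finset.sum_singleton, Nat.cast_zero, mul_zero, neg_zero,
        zero_mul, sub_zero]
      refine ((ih (c + 1 - α)).mul_left (α * t)).congr_fun fun k ↦ ?_
      have hp : ∏ j ∈ Finset.range n, (c + 1 - α * ((k + 1 : ℕ) : ℝ) + j) =
          ∏ j ∈ Finset.range n, (c + 1 - α - α * k + j) :=
        Finset.prod_congr rfl fun j _ ↦ by push_cast; ring
      rw [hp, Nat.factorial_succ, pow_succ]
      push_cast
      field_simp
    refine (h₁.add h₂).congr_fun fun k ↦ ?_
    have hp : ∏ j ∈ Finset.range n, (c - α * k + ((j + 1 : ℕ) : ℝ)) =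
        ∏ j ∈ Finset.range n, (c + 1 - α * k + j) :=
      Finset.prod_congr rfl fun j _ ↦ by push_cast; ring
    rw [Finset.prod_range_succ', hp]
    push_cast
    ring

lemma integral_pow_mul_wrightAux (α : ℝ) (n m : ℕ) (c : ℝ) :
    IntegrableOn (fun t ↦ t ^ m * wrightAux α n c t) (Set.Ioi 0) ∧
      ∫ t in Set.Ioi (0 : ℝ), t ^ m * wrightAux α n c t =
        m.factorial * ∏ j ∈ Finset.range n, (c + α * (m + 1) + j) := by
  induction n generalizing c m with
  | zero =>
    have hm : (0 : ℝ) < m + 1 := by positivity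
    have h₁ := Real.GammaIntegral_convergent hm
    have h₂ := Real.Gamma_eq_integral hm
    rw [Real.Gamma_nat_eq_factorial] at h₂
    simp only [add_sub_cancel_right, Real.rpow_natCast] at h₁ h₂
    simp only [wrightAux, Finset.range_zero, Finset.prod_empty, mul_one, h₂,
      mul_comm _ (Real.exp _)]
    exact ⟨h₁, trivial⟩
  | succ n ih =>
    obtain ⟨i₁, e₁⟩ := ih m (c + 1)
    obtain ⟨i₂, e₂⟩ := ih (m + 1) (c + 1 - α)
    have hf : (fun t ↦ t ^ m * wrightAux α (n + 1) c t) = fun t ↦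
        c * (t ^ m * wrightAux α n (c + 1) t) +
          α * (t ^ (m + 1) * wrightAux α n (c + 1 - α) t) := by
      funext t
      rw [wrightAux]
      ring
    have hp₁ : ∏ j ∈ Finset.range n, (c + α * (m + 1) + ((j + 1 : ℕ) : ℝ)) =
        ∏ j ∈ Finset.range n, (c + 1 + α * (m + 1) + j) :=
      Finset.prod_congr rfl fun j _ ↦ by push_cast; ring
    have hp₂ : ∏ j ∈ Finset.range n, (c + 1 - α + α * (((m + 1 : ℕ) : ℝ) + 1) + j) =
        ∏ j ∈ Finset.range n, (c + 1 + α * (m + 1) + j) :=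
      Finset.prod_congr rfl fun j _ ↦ by push_cast; ring
    rw [hf]
    refine ⟨(i₁.const_mul c).add (i₂.const_mul α), ?_⟩
    rw [integral_add (i₁.const_mul c) (i₂.const_mul α), integral_const_mul, integral_const_mul,
      e₁, e₂, Finset.prod_range_succ', hp₁, hp₂, Nat.factorial_succ]
    push_cast
    ring

lemma tendsto_inv_GammaSeq (s : ℝ) :
    Tendsto (fun n ↦ (Real.GammaSeq s n)⁻¹) atTop (𝓝 (Real.Gamma s)⁻¹) := by
  by_cases hs : Real.Gamma s = 0
  · obtain ⟨m, rfl⟩ := (Real.Gamma_eq_zero_iff s).1 hs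
    rw [hs, inv_zero]
    refine tendsto_const_nhds.congr' ?_
    filter_upwards [eventually_ge_atTop m] with n hn
    rw [Real.GammaSeq, Finset.prod_eq_zero (Finset.mem_range.2 (Nat.lt_succ_of_le hn)) (by simp)]
    simp
  · exact (Real.GammaSeq_tendsto_Gamma s).inv₀ hs

lemma inv_GammaSeq (s : ℝ) (n : ℕ) :
    (Real.GammaSeq s n)⁻¹ =
      (n : ℝ) ^ (-s) / n.factorial * ∏ j ∈ Finset.range (n + 1), (s + j) := by
  rw [Real.GammaSeq, inv_div, Real.rpow_neg n.cast_nonneg]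
  field_simp

lemma prod_abs_one_sub_div_le {m : ℝ} (hm : 0 ≤ m) (N : ℕ) :
    ∏ j ∈ Finset.range N, |1 - m / (j + 1)| ≤
      ((N : ℝ) + 1) ^ (-m) * Real.exp (2 * m + m * Real.log (m + 1)) := by
  have hsum (p : ℕ) : ∑ j ∈ Finset.range p, m / ((j : ℝ) + 1) = m * (harmonic p : ℝ) := by
    simp [harmonic, Finset.mul_sum, div_eq_mul_inv]
  have hterm (j : ℕ) : |1 - m / ((j : ℝ) + 1)| ≤ Real.exp (-(m / (j + 1))) *
      (if j < ⌊m⌋₊ then m / (j + 1) * Real.exp (m / (j + 1)) else 1) := by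
    split_ifs with h
    · have h1 : ((j : ℝ) + 1) ≤ m := by
        have := (Nat.le_floor_iff hm).1 (Nat.succ_le_of_lt h)
        exact_mod_cast this
      have h2 : 1 ≤ m / ((j : ℝ) + 1) := (one_le_div (by positivity)).2 h1
      rw [mul_left_comm, ← Real.exp_add, neg_add_cancel, Real.exp_zero, mul_one, abs_le]
      constructor <;> linarith
    · have h1 : m < (j : ℝ) + 1 := by
        have := (Nat.floor_lt hm).1 (Nat.lt_succ_of_le (not_lt.1 h))
        exact_mod_cast this
      have h2 : m / ((j : ℝ) + 1) ≤ 1 := (div_le_one (by positivity)).2 h1.le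
      rw [mul_one, abs_of_nonneg (by linarith)]
      exact Real.one_sub_le_exp_neg _
  have hq : ∏ j ∈ Finset.range N,
      (if j < ⌊m⌋₊ then m / ((j : ℝ) + 1) * Real.exp (m / (j + 1)) else 1) ≤
      ∏ j ∈ Finset.range ⌊m⌋₊, (m / ((j : ℝ) + 1) * Real.exp (m / (j + 1))) := by
    rw [← Finset.prod_filter]
    refine Finset.prod_le_prod_of_subset_of_one_le ?_ ?_ ?_
    · intro j hj
      simpa using (Finset.mem_filter.1 hj).2
    · intro j _
      positivity
    · intro j hj _
      have h1 : ((j : ℝ) + 1) ≤ m := by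
        have := (Nat.le_floor_iff hm).1 (Nat.succ_le_of_lt (Finset.mem_range.1 hj))
        exact_mod_cast this
      exact one_le_mul_of_one_le_of_one_le ((one_le_div (by positivity)).2 h1)
        (Real.one_le_exp (by positivity))
  have hfac : ∏ j ∈ Finset.range ⌊m⌋₊, m / ((j : ℝ) + 1) ≤ Real.exp m := by
    refine le_trans (le_of_eq ?_) (Real.pow_div_factorial_le_exp m hm ⌊m⌋₊)
    rw [Finset.prod_div_distrib, Finset.prod_const, Finset.card_range,
      ← Finset.prod_range_add_one_eq_factorial]
    push_cast
    rfl
  have hlog : Real.log ⌊m⌋₊ ≤ Real.log (m + 1) := by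
    rcases Nat.eq_zero_or_pos ⌊m⌋₊ with h | h
    · rw [h, Nat.cast_zero, Real.log_zero]
      exact Real.log_nonneg (by linarith)
    · exact Real.log_le_log (by exact_mod_cast h) (by linarith [Nat.floor_le hm])
  calc ∏ j ∈ Finset.range N, |1 - m / ((j : ℝ) + 1)|
      ≤ ∏ j ∈ Finset.range N, Real.exp (-(m / (j + 1))) *
        (if j < ⌊m⌋₊ then m / ((j : ℝ) + 1) * Real.exp (m / (j + 1)) else 1) :=
        Finset.prod_le_prod (fun _ _ ↦ abs_nonneg _) fun j _ ↦ hterm j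
    _ ≤ Real.exp (-(m * harmonic N)) * (Real.exp m * Real.exp (m * harmonic ⌊m⌋₊)) := by
        rw [Finset.prod_mul_distrib, ← Real.exp_sum, Finset.sum_neg_distrib, hsum]
        gcongr
        refine hq.trans ?_
        rw [Finset.prod_mul_distrib, ← Real.exp_sum, hsum]
        gcongr
    _ ≤ Real.exp (-(m * Real.log (N + 1))) *
          (Real.exp m * Real.exp (m * (1 + Real.log (m + 1)))) := by
        have h1 := log_add_one_le_harmonic N
        have h2 := harmonic_le_one_add_log ⌊m⌋₊
        push_cast at h1
        gcongr
        linarith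
    _ = _ := by
        rw [Real.rpow_def_of_pos (by positivity), ← Real.exp_add, ← Real.exp_add, ← Real.exp_add]
        ring_nf

lemma abs_inv_GammaSeq_le {m : ℝ} (hm : 0 ≤ m) {n : ℕ} (hn : n ≠ 0) :
    |(Real.GammaSeq (1 - m) n)⁻¹| ≤ 2 * Real.exp (2 * m + m * Real.log (m + 1)) := by
  have hn' : (1 : ℝ) ≤ n := by exact_mod_cast Nat.one_le_iff_ne_zero.2 hn
  have hprod : |∏ j ∈ Finset.range (n + 1), (1 - m + j)| =
      ((n + 1).factorial : ℝ) * ∏ j ∈ Finset.range (n + 1), |1 - m / (j + 1)| := by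
    rw [Finset.abs_prod, ← Finset.prod_range_add_one_eq_factorial]
    push_cast
    rw [← Finset.prod_mul_distrib]
    refine Finset.prod_congr rfl fun j _ ↦ ?_
    have hj : (0 : ℝ) < j + 1 := by positivity
    rw [show 1 - m + (j : ℝ) = (j + 1) * (1 - m / (j + 1)) by field_simp; ring, abs_mul,
      abs_of_pos hj]
  rw [inv_GammaSeq, abs_mul, hprod, abs_of_nonneg (by positivity)]
  have h := prod_abs_one_sub_div_le hm (n + 1)
  have h2 : (((n + 1 : ℕ) : ℝ) + 1) ^ (-m) ≤ (n : ℝ) ^ (-m) :=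
    Real.rpow_le_rpow_of_nonpos (by linarith) (by push_cast; linarith) (by linarith)
  have h3 : (n : ℝ) ^ (-(1 - m)) * (n : ℝ) ^ (-m) = (n : ℝ)⁻¹ := by
    rw [← Real.rpow_add (by linarith), ← Real.rpow_neg_one]
    ring_nf
  set E := Real.exp (2 * m + m * Real.log (m + 1))
  calc (n : ℝ) ^ (-(1 - m)) / n.factorial *
        ((n + 1).factorial * ∏ j ∈ Finset.range (n + 1), |1 - m / ((j : ℝ) + 1)|)
      ≤ (n : ℝ) ^ (-(1 - m)) / n.factorial * ((n + 1).factorial * ((n : ℝ) ^ (-m) * E)) := by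
        gcongr
        exact h.trans (by gcongr)
    _ = ((n : ℝ) ^ (-(1 - m)) * (n : ℝ) ^ (-m)) * (n + 1) * E := by
        rw [Nat.factorial_succ]
        push_cast
        field_simp
    _ ≤ 2 * E := by
        rw [h3]
        gcongr
        rw [inv_mul_le_iff₀ (by linarith)]
        linarith

lemma summable_wright_bound {α : ℝ} (hα : 0 < α) (hα' : α < 1) {R : ℝ} (hR : 0 ≤ R) :
    Summable fun k : ℕ ↦ R ^ k / (k.factorial : ℝ) *
      (2 * Real.exp (2 * (α * (k + 1)) + α * (k + 1) * Real.log (α * (k + 1) + 1))) := by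
  have hlog : Tendsto (fun k : ℕ ↦ Real.log ((k : ℝ) + 2)) atTop atTop :=
    Real.tendsto_log_atTop.comp (tendsto_atTop_add_const_right _ _ tendsto_natCast_atTop_atTop)
  refine Summable.of_norm_bounded_eventually_nat
    (Real.summable_exp_neg_nat.mul_left (2 * Real.exp 6)) ?_
  filter_upwards [hlog.eventually_ge_atTop ((R + 5) / (1 - α))] with k hk
  rw [div_le_iff₀ (by linarith)] at hk
  rw [Real.norm_of_nonneg (by positivity)]
  have hk0 : (0 : ℝ) ≤ k := k.cast_nonneg
  set L := Real.log ((k : ℝ) + 2) with hL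
  have hL0 : 0 ≤ L := Real.log_nonneg (by linarith)
  have hLk : L ≤ k + 2 := (Real.log_le_sub_one_of_pos (by linarith)).trans (by linarith)
  have hexpL : Real.exp L = k + 2 := Real.exp_log (by linarith)
  have hfac : 1 / (k.factorial : ℝ) ≤ Real.exp (k + 2 - k * L) := by
    have h := Real.pow_div_factorial_le_exp ((k : ℝ) + 2) (by linarith) k
    rw [Real.exp_sub, Real.exp_nat_mul, hexpL, le_div_iff₀ (by positivity)]
    rwa [one_div_mul_eq_div]
  have hRk : R ^ k ≤ Real.exp (k * R) := by
    rw [Real.exp_nat_mul]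
    gcongr
    linarith [Real.add_one_le_exp R]
  have hm1 : α * ((k : ℝ) + 1) ≤ k + 1 := by nlinarith
  have hm2 : Real.log (α * (k + 1) + 1) ≤ L := Real.log_le_log (by positivity) (by linarith)
  have hm3 : α * ((k : ℝ) + 1) * Real.log (α * (k + 1) + 1) ≤ α * (k + 1) * L := by gcongr
  have hαL : α * L ≤ k + 2 := by nlinarith
  calc R ^ k / (k.factorial : ℝ) *
        (2 * Real.exp (2 * (α * (k + 1)) + α * (k + 1) * Real.log (α * (k + 1) + 1)))
      = 2 * (R ^ k * (1 / (k.factorial : ℝ)) *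
        Real.exp (2 * (α * (k + 1)) + α * (k + 1) * Real.log (α * (k + 1) + 1))) := by ring
    _ ≤ 2 * (Real.exp (k * R) * Real.exp (k + 2 - k * L) *
        Real.exp (2 * (k + 1) + α * (k + 1) * L)) := by gcongr
    _ ≤ 2 * Real.exp (6 + -k) := by
        rw [← Real.exp_add, ← Real.exp_add]
        refine mul_le_mul_of_nonneg_left (Real.exp_le_exp.2 ?_) zero_le_two
        nlinarith [mul_le_mul_of_nonneg_left hk hk0]
    _ = 2 * Real.exp 6 * Real.exp (-k) := by rw [Real.exp_add, mul_assoc]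

/-- Approximations of the Wright function, obtained by replacing `Γ` by `Real.GammaSeq`. -/
def wrightApprox (α : ℝ) (n : ℕ) (θ : ℝ) : ℝ :=
  (n : ℝ) ^ (α - 1) / n.factorial * wrightAux α (n + 1) (1 - α) ((n : ℝ) ^ α * θ)

lemma wrightApprox_nonneg {α : ℝ} (hα : 0 ≤ α) (hα' : α ≤ 1) (n : ℕ) {θ : ℝ} (hθ : 0 ≤ θ) :
    0 ≤ wrightApprox α n θ :=
  mul_nonneg (by positivity) (wrightAux_nonneg hα hα' _ (by linarith) (by positivity))

lemma continuous_wrightApprox (α : ℝ) (n : ℕ) : Continuous (wrightApprox α n) :=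
  continuous_const.mul ((continuous_wrightAux α _ _).comp (continuous_const.mul continuous_id))

lemma hasSum_wrightApprox (α : ℝ) {n : ℕ} (hn : n ≠ 0) (θ : ℝ) :
    HasSum (fun k : ℕ ↦ (-θ) ^ k / (k.factorial : ℝ) *
      (Real.GammaSeq (1 - α * (k + 1)) n)⁻¹) (wrightApprox α n θ) := by
  refine ((hasSum_wrightAux α (n + 1) (1 - α) ((n : ℝ) ^ α * θ)).mul_left _).congr_fun fun k ↦ ?_
  have hn' : (0 : ℝ) < n := by positivity
  have hpow : (n : ℝ) ^ (-(1 - α * (k + 1))) = (n : ℝ) ^ (α - 1) * ((n : ℝ) ^ α) ^ k := by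
    rw [← Real.rpow_mul_natCast hn'.le, ← Real.rpow_add hn']
    ring_nf
  have hp : ∏ j ∈ Finset.range (n + 1), (1 - α - α * k + (j : ℝ)) =
      ∏ j ∈ Finset.range (n + 1), (1 - α * (k + 1) + (j : ℝ)) :=
    Finset.prod_congr rfl fun j _ ↦ by ring
  rw [inv_GammaSeq, hpow, hp, neg_mul_eq_mul_neg, mul_pow]
  ring

lemma norm_wrightApprox_term_le {α : ℝ} (hα : 0 < α) {n : ℕ} (hn : n ≠ 0) {R θ : ℝ}
    (hθ : |θ| ≤ R) (k : ℕ) :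
    ‖(-θ) ^ k / (k.factorial : ℝ) * (Real.GammaSeq (1 - α * (k + 1)) n)⁻¹‖ ≤
      R ^ k / (k.factorial : ℝ) *
        (2 * Real.exp (2 * (α * (k + 1)) + α * (k + 1) * Real.log (α * (k + 1) + 1))) := by
  rw [norm_mul, norm_div, norm_pow, norm_neg, Real.norm_eq_abs, Real.norm_natCast,
    Real.norm_eq_abs]
  have hR : 0 ≤ R := (abs_nonneg θ).trans hθ
  have := abs_inv_GammaSeq_le (m := α * (k + 1)) (by positivity) hn
  gcongr

lemma exists_norm_wrightApprox_le {α : ℝ} (hα : 0 < α) (hα' : α < 1) (R : ℝ) :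
    ∃ K, ∀ n ≠ 0, ∀ θ, |θ| ≤ R → ‖wrightApprox α n θ‖ ≤ K := by
  rcases lt_or_ge R 0 with hR | hR
  · exact ⟨0, fun n _ θ hθ ↦ absurd hθ (by linarith [abs_nonneg θ])⟩
  · refine ⟨∑' k : ℕ, R ^ k / (k.factorial : ℝ) *
      (2 * Real.exp (2 * (α * (k + 1)) + α * (k + 1) * Real.log (α * (k + 1) + 1))),
      fun n hn θ hθ ↦ ?_⟩
    rw [← (hasSum_wrightApprox α hn θ).tsum_eq]
    exact tsum_of_norm_bounded (summable_wright_bound hα hα' hR).hasSum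
      (norm_wrightApprox_term_le hα hn hθ)

lemma tendsto_wrightApprox {α : ℝ} (hα : 0 < α) (hα' : α < 1) (θ : ℝ) :
    Tendsto (fun n ↦ wrightApprox α n θ) atTop (𝓝 (wrightFn α θ)) := by
  have h := tendsto_tsum_of_dominated_convergence (𝓕 := atTop)
    (f := fun n (k : ℕ) ↦ (-θ) ^ k / (k.factorial : ℝ) * (Real.GammaSeq (1 - α * (k + 1)) n)⁻¹)
    (g := fun k : ℕ ↦ (-θ) ^ k / (k.factorial : ℝ) * (Real.Gamma (1 - α * (k + 1)))⁻¹)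
    (summable_wright_bound hα hα' (abs_nonneg θ))
    (fun k ↦ (tendsto_inv_GammaSeq _).const_mul _)
    ((eventually_ne_atTop 0).mono fun n hn ↦ norm_wrightApprox_term_le hα hn le_rfl)
  have hlim : ∑' k : ℕ, (-θ) ^ k / (k.factorial : ℝ) * (Real.Gamma (1 - α * (k + 1)))⁻¹ =
      wrightFn α θ := by
    refine tsum_congr fun k ↦ ?_
    rw [show -α * (k : ℝ) + 1 - α = 1 - α * (k + 1) by ring, ← div_eq_mul_inv, div_div]
  rw [hlim] at h
  refine h.congr' ?_
  filter_upwards [eventually_ne_atTop 0] with n hn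
  exact (hasSum_wrightApprox α hn θ).tsum_eq

lemma integral_pow_mul_wrightApprox (α : ℝ) {n : ℕ} (hn : n ≠ 0) (m : ℕ) :
    IntegrableOn (fun θ ↦ θ ^ m * wrightApprox α n θ) (Set.Ioi 0) ∧
      ∫ θ in Set.Ioi (0 : ℝ), θ ^ m * wrightApprox α n θ =
        m.factorial * (Real.GammaSeq (1 + α * m) n)⁻¹ := by
  obtain ⟨hi, he⟩ := integral_pow_mul_wrightAux α (n + 1) m (1 - α)
  have hn' : (0 : ℝ) < n := by positivity
  have hb : (0 : ℝ) < (n : ℝ) ^ α := by positivity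
  have hf : (fun θ ↦ θ ^ m * wrightApprox α n θ) = fun θ ↦
      ((n : ℝ) ^ (α - 1) / n.factorial * (((n : ℝ) ^ α) ^ m)⁻¹) *
        (((n : ℝ) ^ α * θ) ^ m * wrightAux α (n + 1) (1 - α) ((n : ℝ) ^ α * θ)) := by
    funext θ
    rw [wrightApprox, mul_pow]
    field_simp
  rw [hf]
  constructor
  · refine Integrable.const_mul ?_ _
    have := (integrableOn_Ioi_comp_mul_left_iff
      (fun t ↦ t ^ m * wrightAux α (n + 1) (1 - α) t) 0 hb).2 (by simpa using hi)
    exact this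
  · have hpow : (n : ℝ) ^ (-(1 + α * m)) =
        (n : ℝ) ^ (α - 1) * (((n : ℝ) ^ α) ^ m)⁻¹ * ((n : ℝ) ^ α)⁻¹ := by
      rw [← Real.rpow_mul_natCast hn'.le, ← Real.rpow_neg hn'.le, ← Real.rpow_neg hn'.le,
        ← Real.rpow_add hn', ← Real.rpow_add hn']
      ring_nf
    have hp : ∏ j ∈ Finset.range (n + 1), (1 - α + α * (m + 1) + (j : ℝ)) =
        ∏ j ∈ Finset.range (n + 1), (1 + α * m + (j : ℝ)) :=
      Finset.prod_congr rfl fun j _ ↦ by ring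
    rw [integral_const_mul, integral_comp_mul_left_Ioi
      (fun t ↦ t ^ m * wrightAux α (n + 1) (1 - α) t) 0 hb, mul_zero, he, hp, inv_GammaSeq, hpow,
      smul_eq_mul]
    ring

lemma tendsto_setIntegral_wrightApprox {α : ℝ} (hα : 0 < α) (hα' : α < 1) (R : ℝ) :
    IntegrableOn (wrightFn α) (Set.Ioc 0 R) ∧
      Tendsto (fun n ↦ ∫ θ in Set.Ioc 0 R, wrightApprox α n θ) atTop
        (𝓝 (∫ θ in Set.Ioc 0 R, wrightFn α θ)) := by
  obtain ⟨K, hK⟩ := exists_norm_wrightApprox_le hα hα' R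
  have hK' (n : ℕ) (hn : n ≠ 0) : ∀ᵐ θ ∂volume.restrict (Set.Ioc 0 R),
      ‖wrightApprox α n θ‖ ≤ K := by
    filter_upwards [ae_restrict_mem measurableSet_Ioc] with θ hθ
    exact hK n hn θ (by rw [abs_of_pos hθ.1]; exact hθ.2)
  have hlim : ∀ᵐ θ ∂volume.restrict (Set.Ioc 0 R),
      Tendsto (fun n ↦ wrightApprox α n θ) atTop (𝓝 (wrightFn α θ)) :=
    ae_of_all _ (tendsto_wrightApprox hα hα')
  have hmeas (n : ℕ) : AEStronglyMeasurable (wrightApprox α n) (volume.restrict (Set.Ioc 0 R)) :=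
    (continuous_wrightApprox α n).aestronglyMeasurable
  have hint : Integrable (fun _ : ℝ ↦ K) (volume.restrict (Set.Ioc 0 R)) := integrable_const K
  constructor
  · refine hint.mono' (aestronglyMeasurable_of_tendsto_ae atTop hmeas hlim) ?_
    filter_upwards [hlim, ae_restrict_mem measurableSet_Ioc] with θ hθ hθ'
    refine le_of_tendsto hθ.norm ?_
    filter_upwards [eventually_ne_atTop 0] with n hn
    exact hK n hn θ (by rw [abs_of_pos hθ'.1]; exact hθ'.2)
  · exact tendsto_integral_filter_of_dominated_convergence (fun _ ↦ K)
      (Eventually.of_forall hmeas) ((eventually_ne_atTop 0).mono hK') hint hlim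

lemma setIntegral_wrightApprox_mem_Icc {α : ℝ} (hα : 0 < α) (hα' : α < 1) {n : ℕ} (hn : n ≠ 0)
    {R : ℝ} (hR : 0 < R) :
    ∫ θ in Set.Ioc 0 R, wrightApprox α n θ ∈
      Set.Icc ((Real.GammaSeq 1 n)⁻¹ - (Real.GammaSeq (1 + α) n)⁻¹ / R)
        (Real.GammaSeq 1 n)⁻¹ := by
  obtain ⟨i₀, e₀⟩ := integral_pow_mul_wrightApprox α hn 0
  obtain ⟨i₁, e₁⟩ := integral_pow_mul_wrightApprox α hn 1
  simp only [pow_zero, one_mul, pow_one, Nat.cast_zero, mul_zero, add_zero, Nat.factorial,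
    Nat.cast_one, mul_one] at i₀ e₀ i₁ e₁
  have hsub : Set.Ioi R ⊆ Set.Ioi (0 : ℝ) := Set.Ioi_subset_Ioi hR.le
  have hsplit := setIntegral_union (μ := volume) (f := wrightApprox α n)
    (Set.Ioc_disjoint_Ioi (le_refl R) : Disjoint (Set.Ioc 0 R) (Set.Ioi R)) measurableSet_Ioi
    (i₀.mono_set Set.Ioc_subset_Ioi_self) (i₀.mono_set hsub)
  rw [Set.Ioc_union_Ioi_eq_Ioi hR.le, e₀] at hsplit
  have htail0 : 0 ≤ ∫ θ in Set.Ioi R, wrightApprox α n θ :=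
    setIntegral_nonneg measurableSet_Ioi fun θ hθ ↦
      wrightApprox_nonneg hα.le hα'.le n (hR.trans hθ).le
  have htail : R * ∫ θ in Set.Ioi R, wrightApprox α n θ ≤ (Real.GammaSeq (1 + α) n)⁻¹ := by
    rw [← e₁, ← integral_const_mul]
    calc ∫ θ in Set.Ioi R, R * wrightApprox α n θ
        ≤ ∫ θ in Set.Ioi R, θ * wrightApprox α n θ :=
          setIntegral_mono_on ((i₀.mono_set hsub).const_mul R) (i₁.mono_set hsub)
            measurableSet_Ioi fun θ hθ ↦ mul_le_mul_of_nonneg_right (le_of_lt hθ)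
              (wrightApprox_nonneg hα.le hα'.le n (hR.trans hθ).le)
      _ ≤ ∫ θ in Set.Ioi (0 : ℝ), θ * wrightApprox α n θ :=
          setIntegral_mono_set i₁ ((ae_restrict_mem measurableSet_Ioi).mono fun θ hθ ↦
            mul_nonneg (le_of_lt hθ) (wrightApprox_nonneg hα.le hα'.le n (le_of_lt hθ)))
            hsub.eventuallyLE
  rw [mul_comm, ← le_div_iff₀ hR] at htail
  constructor <;> linarith

lemma setIntegral_wrightFn_mem_Icc {α : ℝ} (hα : 0 < α) (hα' : α < 1) {R : ℝ} (hR : 0 < R) :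
    ∫ θ in Set.Ioc 0 R, wrightFn α θ ∈ Set.Icc (1 - (Real.Gamma (1 + α))⁻¹ / R) 1 := by
  have h := (tendsto_setIntegral_wrightApprox hα hα' R).2
  have h₁ : Tendsto (fun n ↦ (Real.GammaSeq 1 n)⁻¹) atTop (𝓝 1) := by
    simpa using tendsto_inv_GammaSeq 1
  have h₂ := h₁.sub ((tendsto_inv_GammaSeq (1 + α)).div_const R)
  have hev := (eventually_ne_atTop 0).mono fun n hn ↦
    setIntegral_wrightApprox_mem_Icc hα hα' (n := n) hn hR
  exact ⟨le_of_tendsto_of_tendsto h₂ h (hev.mono fun n hn ↦ hn.1),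
    le_of_tendsto_of_tendsto h h₁ (hev.mono fun n hn ↦ hn.2)⟩

/-- The Wright function is nonnegative on `[0,∞)` and is a probability density:
`∫_0^∞ φ_α(θ) dθ = 1`. -/
theorem wrightFn_nonneg_and_integral_one (α : ℝ) (hα : 0 < α) (hα' : α < 1) :
    (∀ θ : ℝ, 0 ≤ θ → 0 ≤ wrightFn α θ) ∧
      ∫ θ in Set.Ioi (0:ℝ), wrightFn α θ = 1 := by
  have hnonneg : ∀ θ : ℝ, 0 ≤ θ → 0 ≤ wrightFn α θ := fun θ hθ ↦
    ge_of_tendsto' (tendsto_wrightApprox hα hα' θ) fun n ↦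
      wrightApprox_nonneg hα.le hα'.le n hθ
  refine ⟨hnonneg, ?_⟩
  have hlim : Tendsto (fun R : ℝ ↦ ∫ θ in (0 : ℝ)..R, wrightFn α θ) atTop (𝓝 1) := by
    have hlow : Tendsto (fun R : ℝ ↦ 1 - (Real.Gamma (1 + α))⁻¹ / R) atTop (𝓝 1) := by
      simpa using (tendsto_id.const_div_atTop (Real.Gamma (1 + α))⁻¹).const_sub 1
    refine tendsto_of_tendsto_of_tendsto_of_le_of_le' hlow tendsto_const_nhds ?_ ?_
    all_goals
      filter_upwards [eventually_gt_atTop 0] with R hR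
      rw [intervalIntegral.integral_of_le hR.le]
    · exact (setIntegral_wrightFn_mem_Icc hα hα' hR).1
    · exact (setIntegral_wrightFn_mem_Icc hα hα' hR).2
  have hnorm : Tendsto (fun R : ℝ ↦ ∫ θ in (0 : ℝ)..R, ‖wrightFn α θ‖) atTop (𝓝 1) := by
    refine hlim.congr' ?_
    filter_upwards [eventually_gt_atTop 0] with R hR
    rw [intervalIntegral.integral_of_le hR.le, intervalIntegral.integral_of_le hR.le]
    exact setIntegral_congr_fun measurableSet_Ioc fun θ hθ ↦
      (Real.norm_of_nonneg (hnonneg θ hθ.1.le)).symm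
  have hint := integrableOn_Ioi_of_intervalIntegral_norm_tendsto 1 0
    (fun R ↦ (tendsto_setIntegral_wrightApprox hα hα' R).1) tendsto_id hnorm
  exact tendsto_nhds_unique (intervalIntegral_tendsto_integral_Ioi 0 hint tendsto_id) hlim

end
end
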